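/- The covering dimension of the maximal ideal space 𝔐(H^∞(𝔻 × ℕ)) equals 2, where 𝔻 × ℕ is the disjoint union of countably many copies of the open unit disk 𝔻 ⊂ ℂ. -/

import Mathlib

open Set Metric WeakDual BoundedContinuousFunction Manifold Topology Complex

set_option synthInstance.maxHeartbeats 1000000
set_option maxHeartbeats 2000000

noncomputable section

/-- The covering dimension of a topological space `X` is at most `n`: every open cover
has an open refinement of order at most `n + 1`. -/
def CovDimLE (X : Type) [TopologicalSpace X] (n : ℕ) : Prop :=
  ∀ 𝒰 : Set (Set X), (∀ U ∈ 𝒰, IsOpen U) → ⋃₀ 𝒰 = Set.univ →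
    ∃ 𝒱 : Set (Set X), (∀ V ∈ 𝒱, IsOpen V) ∧ ⋃₀ 𝒱 = Set.univ ∧
      (∀ V ∈ 𝒱, ∃ U ∈ 𝒰, V ⊆ U) ∧
      ∀ x : X, {V ∈ 𝒱 | x ∈ V}.Finite ∧ {V ∈ 𝒱 | x ∈ V}.ncard ≤ n + 1

/-- `dim X = n`: the covering dimension of `X` is at most `n` but not at most `n - 1`. -/
def CovDimEq (X : Type) [TopologicalSpace X] (n : ℕ) : Prop :=
  CovDimLE X n ∧ ¬ CovDimLE X (n - 1)

/-- A Čech 2-cocycle (with coefficients in `ℤ`) on the open cover `U` of `X`. -/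
def IsCechTwoCocycle {X : Type} [TopologicalSpace X] {ι : Type}
    (U : ι → Set X) (c : ι → ι → ι → ℤ) : Prop :=
  ∀ i j k l : ι, (U i ∩ U j ∩ U k ∩ U l).Nonempty →
    c j k l - c i k l + c i j l - c i j k = 0

/-- Triviality of the second Čech cohomology group `H²(X, ℤ)`: every integral 2-cocycle on
every open cover of `X` becomes a coboundary after passing to a suitable open refinement. -/
def CechH2Trivial (X : Type) [TopologicalSpace X] : Prop :=
  ∀ (ι : Type) (U : ι → Set X), (∀ i, IsOpen (U i)) → (⋃ i, U i) = Set.univ →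
    ∀ c : ι → ι → ι → ℤ, IsCechTwoCocycle U c →
      ∃ (κ : Type) (V : κ → Set X) (τ : κ → ι),
        (∀ j, IsOpen (V j)) ∧ (⋃ j, V j) = Set.univ ∧ (∀ j, V j ⊆ U (τ j)) ∧
        ∃ b : κ → κ → ℤ, ∀ i j k : κ, (V i ∩ V j ∩ V k).Nonempty →
          c (τ i) (τ j) (τ k) = b j k - b i k + b i j

/-- The open unit disk in `ℂ`. -/
abbrev unitDisk : Set ℂ := ball (0 : ℂ) 1

/-- `𝔻 × ℕ`: the disjoint union of countably many copies of the open unit disk. -/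
abbrev DiskNat := unitDisk × ℕ

/-- The Banach algebra `H^∞(𝔻 × ℕ)` of bounded functions on `𝔻 × ℕ` that are holomorphic on
each copy of `𝔻`, realized as a subalgebra of the bounded continuous functions on `𝔻 × ℕ`. -/
def HinfDiskNat : Subalgebra ℂ (DiskNat →ᵇ ℂ) where
  carrier := {f | ∀ n : ℕ, ∃ g : ℂ → ℂ, DifferentiableOn ℂ g unitDisk ∧
    ∀ z : unitDisk, f (z, n) = g z}
  add_mem' := by
    rintro f g hf hg n
    obtain ⟨F, hF, hfF⟩ := hf n
    obtain ⟨G, hG, hgG⟩ := hg n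
    exact ⟨F + G, hF.add hG, fun z => by simp [hfF z, hgG z]⟩
  mul_mem' := by
    rintro f g hf hg n
    obtain ⟨F, hF, hfF⟩ := hf n
    obtain ⟨G, hG, hgG⟩ := hg n
    exact ⟨F * G, hF.mul hG, fun z => by simp [hfF z, hgG z]⟩
  algebraMap_mem' := fun c n =>
    ⟨fun _ => c, differentiableOn_const c, fun _ => rfl⟩

/-- The maximal ideal space `𝔐(H^∞(𝔻 × ℕ))`. -/
abbrev MaxIdealSpaceDiskNat := characterSpace ℂ HinfDiskNat

/-- The open upper half-plane. -/
def uhp : Set ℂ := {z | 0 < z.im}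

lemma isOpen_uhp : IsOpen uhp := isOpen_lt continuous_const continuous_im

/-- `cs z ζ = 1 - |b|²` where `b = (z - ζ) / (z - conj ζ)`. -/
def cs (z ζ : ℂ) : ℝ := 4 * z.im * ζ.im / normSq (z - (starRingEnd ℂ) ζ)

/-- Carleson condition for the points `Z i`, `i ∈ s`. -/
def Carl {ι : Type*} (Z : ι → ℂ) (s : Set ι) (M : ℝ) : Prop :=
  ∀ z ∈ uhp, ∀ t : Finset ι, (t : Set ι) ⊆ s → ∑ i ∈ t, cs z (Z i) ≤ M

lemma normSq_sub_conj (z ζ : ℂ) :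
    normSq (z - (starRingEnd ℂ) ζ) = (z.re - ζ.re) ^ 2 + (z.im + ζ.im) ^ 2 := by
  simp [normSq_apply]; ring

lemma normSq_sub_conj_pos {z ζ : ℂ} (hz : 0 < z.im) (hζ : 0 < ζ.im) :
    0 < normSq (z - (starRingEnd ℂ) ζ) := by
  rw [normSq_sub_conj]; positivity

lemma sub_conj_ne_zero {z ζ : ℂ} (hz : 0 < z.im) (hζ : 0 < ζ.im) :
    z - (starRingEnd ℂ) ζ ≠ 0 := normSq_pos.1 (normSq_sub_conj_pos hz hζ)

lemma cs_nonneg {z ζ : ℂ} (hz : 0 < z.im) (hζ : 0 < ζ.im) : 0 ≤ cs z ζ := by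
  have := normSq_sub_conj_pos hz hζ
  unfold cs; positivity

lemma cs_pos {z ζ : ℂ} (hz : 0 < z.im) (hζ : 0 < ζ.im) : 0 < cs z ζ := by
  have := normSq_sub_conj_pos hz hζ
  unfold cs; positivity

lemma sum_mul_exp_le {ι : Type*} (y a : ι → ℝ) (ha : ∀ i, 0 ≤ a i) (t : Finset ι) :
    ∑ n ∈ t, a n * Real.exp (-∑ m ∈ t with y m ≤ y n, a m) ≤ 1 - Real.exp (-∑ m ∈ t, a m) := by
  classical
  induction t using Finset.induction_on_max_value y with
  | empty => simp
  | insert n s hn hmax ih =>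
    rw [Finset.sum_insert hn]
    have h1 : ∑ m ∈ insert n s with y m ≤ y n, a m = a n + ∑ m ∈ s, a m := by
      rw [Finset.filter_true_of_mem, Finset.sum_insert hn]
      intro m hm
      rcases Finset.mem_insert.1 hm with rfl | hm
      · exact le_rfl
      · exact hmax m hm
    have h2 : ∑ k ∈ s, a k * Real.exp (-∑ m ∈ insert n s with y m ≤ y k, a m) ≤
        ∑ k ∈ s, a k * Real.exp (-∑ m ∈ s with y m ≤ y k, a m) := by
      refine Finset.sum_le_sum fun k _ => mul_le_mul_of_nonneg_left ?_ (ha k)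
      refine Real.exp_le_exp.2 (neg_le_neg ?_)
      refine Finset.sum_le_sum_of_subset_of_nonneg ?_ fun i _ _ => ha i
      exact Finset.filter_subset_filter _ (Finset.subset_insert _ _)
    rw [h1, Finset.sum_insert hn]
    set A := ∑ m ∈ s, a m
    have h3 : Real.exp (-A) = Real.exp (-(a n + A)) * Real.exp (a n) := by
      rw [← Real.exp_add]; ring_nf
    have h4 := Real.add_one_le_exp (a n)
    have h5 := Real.exp_pos (-(a n + A))
    nlinarith

/-- The exponent appearing in Jones' interpolation functions. -/
def jA (ζ z : ℂ) : ℂ := I * ζ.im / (z - (starRingEnd ℂ) ζ)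

lemma re_jA (ζ z : ℂ) :
    (jA ζ z).re = ζ.im * (z.im + ζ.im) / normSq (z - (starRingEnd ℂ) ζ) := by
  simp [jA, div_re]

/-- Jones' functions. -/
def JG {ι : Type*} (t : Finset ι) (Z : ι → ℂ) (n : ι) (z : ℂ) : ℂ :=
  (2 * jA (Z n) z) ^ 2 *
    exp (-∑ m ∈ t with (Z m).im ≤ (Z n).im, (jA (Z m) z - jA (Z m) (Z n)))

lemma norm_jA_sq (ζ z : ℂ) : ‖jA ζ z‖ ^ 2 = ζ.im ^ 2 / normSq (z - (starRingEnd ℂ) ζ) := by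
  simp [jA, normSq_eq_norm_sq, div_pow]

lemma norm_JG {ι : Type*} (t : Finset ι) (Z : ι → ℂ) (n : ι) (z : ℂ) :
    ‖JG t Z n z‖ = 4 * ((Z n).im ^ 2 / normSq (z - (starRingEnd ℂ) (Z n))) *
      (Real.exp (-∑ m ∈ t with (Z m).im ≤ (Z n).im, (jA (Z m) z).re) *
       Real.exp (∑ m ∈ t with (Z m).im ≤ (Z n).im, (jA (Z m) (Z n)).re)) := by
  rw [JG, norm_mul, norm_pow, norm_mul, mul_pow, norm_jA_sq, norm_exp, ← Real.exp_add]
  norm_num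
  left
  ring

lemma differentiableOn_jA {ζ : ℂ} (hζ : 0 < ζ.im) : DifferentiableOn ℂ (jA ζ) uhp := by
  intro z hz
  have := sub_conj_ne_zero hz hζ
  unfold jA
  fun_prop (disch := assumption)

lemma differentiableOn_JG {ι : Type*} {t : Finset ι} {Z : ι → ℂ} (hZ : ∀ i ∈ t, 0 < (Z i).im)
    {n : ι} (hn : n ∈ t) : DifferentiableOn ℂ (JG t Z n) uhp := by
  unfold JG
  have h := differentiableOn_jA (hZ n hn)
  refine ((h.const_mul 2).pow 2).mul (DifferentiableOn.cexp (DifferentiableOn.neg ?_))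
  refine DifferentiableOn.fun_sum fun m hm => ?_
  exact (differentiableOn_jA (hZ m (Finset.mem_filter.1 hm).1)).sub_const _

lemma re_jA_nonneg {z ζ : ℂ} (hz : 0 < z.im) (hζ : 0 < ζ.im) : 0 ≤ (jA ζ z).re := by
  rw [re_jA]
  have := normSq_sub_conj_pos hz hζ
  positivity

lemma sum_norm_JG_le {ι : Type*} {t : Finset ι} {Z : ι → ℂ} (hZ : ∀ i, 0 < (Z i).im)
    {M : ℝ} (hM : ∀ z ∈ uhp, ∑ i ∈ t, cs z (Z i) ≤ M) {z : ℂ} (hz : z ∈ uhp) :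
    ∑ n ∈ t, ‖JG t Z n z‖ ≤ 4 * Real.exp M := by
  have hz' : 0 < z.im := hz
  have key := sum_mul_exp_le (fun i => (Z i).im) (fun i => (jA (Z i) z).re)
    (fun i => re_jA_nonneg hz (hZ i)) t
  have h0 : ∀ n ∈ t, ‖JG t Z n z‖ ≤ 4 * Real.exp M * ((jA (Z n) z).re *
      Real.exp (-∑ m ∈ t with (Z m).im ≤ (Z n).im, (jA (Z m) z).re)) := by
    intro n hn
    have h1 : (Z n).im ^ 2 / normSq (z - (starRingEnd ℂ) (Z n)) ≤ (jA (Z n) z).re := by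
      rw [re_jA]
      have := normSq_sub_conj_pos hz (hZ n)
      have := hZ n
      gcongr
      nlinarith
    have h2 : ∑ m ∈ t with (Z m).im ≤ (Z n).im, (jA (Z m) (Z n)).re ≤ M := by
      refine le_trans ?_ (hM (Z n) (hZ n))
      refine (Finset.sum_le_sum (g := fun m => cs (Z n) (Z m)) ?_).trans
        (Finset.sum_le_sum_of_subset_of_nonneg (Finset.filter_subset _ _)
          fun i _ _ => cs_nonneg (hZ n) (hZ i))
      intro m hm
      have hm' := (Finset.mem_filter.1 hm).2
      rw [re_jA, cs]
      have := normSq_sub_conj_pos (hZ n) (hZ m)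
      have := hZ m
      have := hZ n
      refine div_le_div_of_nonneg_right ?_ (le_of_lt ‹0 < normSq _›)
      nlinarith
    rw [norm_JG]
    have e2 := Real.exp_le_exp.2 h2
    have h3 := re_jA_nonneg hz (hZ n)
    calc _ ≤ 4 * (jA (Z n) z).re *
        (Real.exp (-∑ m ∈ t with (Z m).im ≤ (Z n).im, (jA (Z m) z).re) * Real.exp M) := by
          gcongr
      _ = _ := by ring
  refine (Finset.sum_le_sum h0).trans ?_
  rw [← Finset.mul_sum]
  have h5 := Real.exp_pos (-∑ m ∈ t, (jA (Z m) z).re)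
  have h6 := Real.exp_pos M
  nlinarith

lemma le_norm_JG {ι : Type*} {t : Finset ι} {Z : ι → ℂ} (hZ : ∀ i, 0 < (Z i).im)
    {M : ℝ} (hM : ∀ z ∈ uhp, ∑ i ∈ t, cs z (Z i) ≤ M) {n : ι} {z : ℂ}
    (hzn : ‖z - Z n‖ ≤ (Z n).im / 2) :
    Real.exp (-(3 * M)) / 2 ≤ ‖JG t Z n z‖ := by
  have hn := hZ n
  have him : |z.im - (Z n).im| ≤ (Z n).im / 2 := by
    have := abs_im_le_norm (z - Z n)
    simp only [sub_im] at this
    exact this.trans hzn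
  have hz : 0 < z.im := by linarith [(abs_le.1 him).1]
  have hzl : (Z n).im / 2 ≤ z.im := by linarith [(abs_le.1 him).1]
  have hzu : z.im ≤ 3 / 2 * (Z n).im := by linarith [(abs_le.1 him).2]
  have h1 : ∑ m ∈ t with (Z m).im ≤ (Z n).im, (jA (Z m) z).re ≤ 3 * M := by
    refine le_trans ?_ (mul_le_mul_of_nonneg_left (hM (Z n) hn) (by norm_num))
    rw [Finset.mul_sum]
    refine (Finset.sum_le_sum (g := fun m => 3 * cs (Z n) (Z m)) ?_).trans
        (Finset.sum_le_sum_of_subset_of_nonneg (Finset.filter_subset _ _)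
          fun i _ _ => mul_nonneg (by norm_num) (cs_nonneg hn (hZ i)))
    intro m hm
    have hm' := (Finset.mem_filter.1 hm).2
    have hm0 := hZ m
    have p1 := normSq_sub_conj_pos hn hm0
    have p2 := normSq_sub_conj_pos hz hm0
    have hle : ‖Z n - (starRingEnd ℂ) (Z m)‖ ≤ 2 * ‖z - (starRingEnd ℂ) (Z m)‖ := by
      have t1 : ‖Z n - (starRingEnd ℂ) (Z m)‖ ≤ ‖z - (starRingEnd ℂ) (Z m)‖ + ‖z - Z n‖ := by
        have := norm_sub_le (z - (starRingEnd ℂ) (Z m)) (z - Z n)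
        simpa using this
      have t2 := abs_im_le_norm (z - (starRingEnd ℂ) (Z m))
      simp only [sub_im, conj_im, sub_neg_eq_add] at t2
      have t3 := le_abs_self (z.im + (Z m).im)
      linarith
    have hle2 : normSq (Z n - (starRingEnd ℂ) (Z m)) ≤ 4 * normSq (z - (starRingEnd ℂ) (Z m)) := by
      rw [normSq_eq_norm_sq, normSq_eq_norm_sq]
      nlinarith [norm_nonneg (Z n - (starRingEnd ℂ) (Z m))]
    rw [re_jA, cs, ← mul_div_assoc, div_le_div_iff₀ p2 p1]
    calc (Z m).im * (z.im + (Z m).im) * normSq (Z n - (starRingEnd ℂ) (Z m))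
        ≤ (Z m).im * (5 / 2 * (Z n).im) * (4 * normSq (z - (starRingEnd ℂ) (Z m))) := by
          gcongr; linarith
      _ ≤ _ := by
          have : 0 ≤ (Z m).im * (Z n).im * normSq (z - (starRingEnd ℂ) (Z m)) := by positivity
          nlinarith
  have h2 : 0 ≤ ∑ m ∈ t with (Z m).im ≤ (Z n).im, (jA (Z m) (Z n)).re :=
    Finset.sum_nonneg fun m _ => re_jA_nonneg hn (hZ m)
  rw [norm_JG]
  have h3 : 1 / 2 ≤ 4 * ((Z n).im ^ 2 / normSq (z - (starRingEnd ℂ) (Z n))) := by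
    have p := normSq_sub_conj_pos hz hn
    rw [← mul_div_assoc, div_le_div_iff₀ (by norm_num) p, normSq_sub_conj]
    have : |z.re - (Z n).re| ≤ (Z n).im / 2 := by
      have := abs_re_le_norm (z - Z n)
      simp only [sub_re] at this
      exact this.trans hzn
    have := sq_le_sq' (by linarith [(abs_le.1 this).1]) (abs_le.1 this).2
    nlinarith
  have e1 := Real.exp_le_exp.2 (neg_le_neg h1)
  have e2 := Real.one_le_exp h2
  calc Real.exp (-(3 * M)) / 2 = 1 / 2 * (Real.exp (-(3 * M)) * 1) := by ring
    _ ≤ _ := by gcongr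

lemma dist_le_of_norm_le_ball {f : ℂ → ℂ} {c z : ℂ} {R M : ℝ}
    (hd : DifferentiableOn ℂ f (ball c R)) (hM : ∀ w ∈ ball c R, ‖f w‖ ≤ M) (hz : z ∈ ball c R) :
    dist (f z) (f c) ≤ 2 * M / R * dist z c := by
  refine dist_le_div_mul_dist_of_mapsTo_ball hd (fun w hw => ?_) hz
  have hR : 0 < R := nonempty_ball.mp ⟨_, hz⟩
  rw [mem_closedBall, dist_eq_norm]
  linarith [norm_sub_le (f w) (f c), hM w hw, hM c (mem_ball_self hR)]

/-- The limit of a sequence along the fixed nonprincipal ultrafilter on `ℕ`. -/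
def ulim {E : Type*} [TopologicalSpace E] [Nonempty E] (a : ℕ → E) : E :=
  (Filter.hyperfilter ℕ : Filter ℕ).limUnder a

lemma tendsto_ulim {E : Type*} [NormedAddCommGroup E] [ProperSpace E] {a : ℕ → E} {M : ℝ}
    (h : ∀ᶠ n in (Filter.hyperfilter ℕ : Filter ℕ), ‖a n‖ ≤ M) :
    Filter.Tendsto a (Filter.hyperfilter ℕ) (𝓝 (ulim a)) := by
  have hc : IsCompact (closedBall (0 : E) M) := isCompact_closedBall _ _
  obtain ⟨x, -, hx⟩ := hc.ultrafilter_le_nhds ((Filter.hyperfilter ℕ).map a) (by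
    rw [Filter.le_principal_iff]
    refine Filter.mem_map.2 (Filter.mem_of_superset h fun n hn => ?_)
    simpa using hn)
  exact tendsto_nhds_limUnder ⟨x, hx⟩

lemma norm_ulim_le {E : Type*} [NormedAddCommGroup E] [ProperSpace E] {a : ℕ → E} {M : ℝ}
    (h : ∀ᶠ n in (Filter.hyperfilter ℕ : Filter ℕ), ‖a n‖ ≤ M) : ‖ulim a‖ ≤ M :=
  le_of_tendsto (tendsto_ulim h).norm h

lemma differentiableOn_ulim {F : ℕ → ℂ → ℂ} {V : Set ℂ} (hV : IsOpen V) {M : ℝ}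
    (hF : ∀ᶠ n in (Filter.hyperfilter ℕ : Filter ℕ),
      DifferentiableOn ℂ (F n) V ∧ ∀ z ∈ V, ‖F n z‖ ≤ M) :
    DifferentiableOn ℂ (fun z => ulim fun n => F n z) V := by
  refine TendstoLocallyUniformlyOn.differentiableOn (φ := Filter.hyperfilter ℕ) (F := F) ?_
    (hF.mono fun n h => h.1) hV
  rw [Metric.tendstoLocallyUniformlyOn_iff]
  intro ε hε x hx
  have ht : ∀ y ∈ V, Filter.Tendsto (fun n => F n y) (Filter.hyperfilter ℕ)
      (𝓝 (ulim fun n => F n y)) :=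
    fun y hy => tendsto_ulim (hF.mono fun n h => h.2 y hy)
  obtain ⟨R, hR, hRV⟩ := Metric.isOpen_iff.1 hV x hx
  have hM : 0 ≤ M := by
    obtain ⟨n, hn⟩ := hF.exists
    exact (norm_nonneg _).trans (hn.2 x hx)
  have hlip : ∀ᶠ n in (Filter.hyperfilter ℕ : Filter ℕ), ∀ y ∈ ball x R,
      dist (F n y) (F n x) ≤ 2 * M / R * dist y x :=
    hF.mono fun n h y hy => dist_le_of_norm_le_ball (h.1.mono hRV) (fun w hw => h.2 w (hRV hw)) hy
  have hlip' : ∀ y ∈ ball x R, dist (ulim fun n => F n y) (ulim fun n => F n x)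
      ≤ 2 * M / R * dist y x := fun y hy =>
    le_of_tendsto ((ht y (hRV hy)).dist (ht x hx)) (hlip.mono fun n h => h y hy)
  have hδ : 0 < ε / (4 * (2 * M / R + 1)) := by positivity
  refine ⟨ball x (min R (ε / (4 * (2 * M / R + 1)))),
    mem_nhdsWithin_of_mem_nhds (ball_mem_nhds _ (lt_min hR hδ)), ?_⟩
  filter_upwards [hlip, Metric.tendsto_nhds.1 (ht x hx) (ε / 4) (by linarith)] with n h1 h2 y hy
  have hyR : y ∈ ball x R := ball_subset_ball (min_le_left _ _) hy
  have hyd : dist y x ≤ ε / (4 * (2 * M / R + 1)) := (lt_of_lt_of_le hy (min_le_right _ _)).le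
  have hL : 2 * M / R * dist y x ≤ ε / 4 := by
    have h0 : 0 ≤ 2 * M / R := by positivity
    rw [le_div_iff₀ (by positivity)] at hyd
    nlinarith [dist_nonneg (x := y) (y := x)]
  have a1 := h1 y hyR
  have a2 := hlip' y hyR
  have t1 := dist_triangle4 (ulim fun n => F n y) (ulim fun n => F n x) (F n x) (F n y)
  rw [dist_comm (F n x)] at h2
  rw [dist_comm (F n x) (F n y)] at t1
  linarith

/-- The Blaschke factor of the upper half-plane with zero `ζ`. -/
def bl (ζ z : ℂ) : ℂ := (z - ζ) / (z - (starRingEnd ℂ) ζ)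

lemma norm_bl_sq {z ζ : ℂ} (hz : 0 < z.im) (hζ : 0 < ζ.im) : ‖bl ζ z‖ ^ 2 = 1 - cs z ζ := by
  have h := normSq_sub_conj_pos hz hζ
  rw [bl, norm_div, div_pow, ← normSq_eq_norm_sq, ← normSq_eq_norm_sq, cs, div_eq_iff h.ne',
    sub_mul, div_mul_cancel₀ _ h.ne', normSq_sub_conj]
  simp [normSq_apply]; ring

lemma cs_le_one {z ζ : ℂ} (hz : 0 < z.im) (hζ : 0 < ζ.im) : cs z ζ ≤ 1 := by
  nlinarith [norm_bl_sq hz hζ, sq_nonneg ‖bl ζ z‖]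

lemma norm_bl_le_one {z ζ : ℂ} (hz : 0 < z.im) (hζ : 0 < ζ.im) : ‖bl ζ z‖ ≤ 1 := by
  nlinarith [norm_bl_sq hz hζ, norm_nonneg (bl ζ z), cs_nonneg hz hζ]

lemma differentiableOn_bl {ζ : ℂ} (hζ : 0 < ζ.im) : DifferentiableOn ℂ (bl ζ) uhp := by
  intro z hz
  have := sub_conj_ne_zero hz hζ
  unfold bl
  fun_prop (disch := assumption)

lemma exp_neg_div_le {c δ : ℝ} (hδ : 0 < δ) (hc : δ ≤ 1 - c) (hc0 : 0 ≤ c) :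
    Real.exp (-(c / δ)) ≤ 1 - c := by
  have h1 := Real.add_one_le_exp (c / δ)
  have h2 : 0 < c / δ + 1 := by positivity
  rw [Real.exp_neg]
  refine (inv_anti₀ h2 h1).trans ?_
  rw [inv_le_iff_one_le_mul₀ h2]
  have : (1 - c) * (c / δ + 1) = (1 - c) / δ * c + (1 - c) := by field_simp
  rw [this]
  have h3 : 1 ≤ (1 - c) / δ := by rw [le_div_iff₀ hδ]; linarith
  nlinarith

lemma exp_le_prod_norm_bl {ι : Type*} {t : Finset ι} {Z : ι → ℂ} (hZ : ∀ i ∈ t, 0 < (Z i).im)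
    {z : ℂ} (hz : 0 < z.im) {M δ : ℝ} (hM : ∑ i ∈ t, cs z (Z i) ≤ M) (hδ : 0 < δ)
    (h : ∀ i ∈ t, δ ≤ ‖bl (Z i) z‖) :
    Real.exp (-(M / δ ^ 2)) ≤ ‖∏ i ∈ t, bl (Z i) z‖ := by
  have h1 : Real.exp (-(M / δ ^ 2)) ≤ ‖∏ i ∈ t, bl (Z i) z‖ ^ 2 := by
    rw [norm_prod, ← Finset.prod_pow]
    calc Real.exp (-(M / δ ^ 2)) ≤ Real.exp (∑ i ∈ t, -(cs z (Z i) / δ ^ 2)) := by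
          rw [Finset.sum_neg_distrib, ← Finset.sum_div]
          gcongr
      _ = ∏ i ∈ t, Real.exp (-(cs z (Z i) / δ ^ 2)) := Real.exp_sum _ _
      _ ≤ _ := by
        refine Finset.prod_le_prod (fun i _ => (Real.exp_pos _).le) fun i hi => ?_
        rw [norm_bl_sq hz (hZ i hi)]
        refine exp_neg_div_le (by positivity) ?_ (cs_nonneg hz (hZ i hi))
        rw [← norm_bl_sq hz (hZ i hi)]
        exact pow_le_pow_left₀ hδ.le (h i hi) 2
  have h2 : ‖∏ i ∈ t, bl (Z i) z‖ ≤ 1 := by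
    rw [norm_prod]
    exact Finset.prod_le_one (fun _ _ => norm_nonneg _) fun i hi => norm_bl_le_one hz (hZ i hi)
  nlinarith [norm_nonneg (∏ i ∈ t, bl (Z i) z)]

lemma norm_prod_bl_le {ι : Type*} {t : Finset ι} {Z : ι → ℂ} (hZ : ∀ i ∈ t, 0 < (Z i).im)
    {z : ℂ} (hz : 0 < z.im) {i : ι} (hi : i ∈ t) :
    ‖∏ i ∈ t, bl (Z i) z‖ ≤ ‖bl (Z i) z‖ := by
  classical
  rw [← Finset.mul_prod_erase t _ hi, norm_mul, norm_prod]
  refine mul_le_of_le_one_right (norm_nonneg _) ?_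
  exact Finset.prod_le_one (fun _ _ => norm_nonneg _)
    fun j hj => norm_bl_le_one hz (hZ j (Finset.mem_of_mem_erase hj))

lemma norm_prod_bl_le_one {ι : Type*} {t : Finset ι} {Z : ι → ℂ} (hZ : ∀ i ∈ t, 0 < (Z i).im)
    {z : ℂ} (hz : 0 < z.im) : ‖∏ i ∈ t, bl (Z i) z‖ ≤ 1 := by
  rw [norm_prod]
  exact Finset.prod_le_one (fun _ _ => norm_nonneg _) fun j hj => norm_bl_le_one hz (hZ j hj)

/-- Comparison of `cs` under perturbation of the point. -/
lemma cs_le_mul {z a b : ℂ} (hz : 0 < z.im) (ha : 0 < a.im) (hb : 0 < b.im) {K : ℝ}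
    (hK : 0 ≤ K) (hab : ‖a - b‖ ≤ K * b.im) (hab' : ‖a - b‖ ≤ K * a.im) :
    cs z a ≤ (1 + K) ^ 3 * cs z b := by
  have p1 := normSq_sub_conj_pos hz ha
  have p2 := normSq_sub_conj_pos hz hb
  have e : ‖(starRingEnd ℂ) a - (starRingEnd ℂ) b‖ = ‖a - b‖ := by
    rw [← map_sub, norm_conj]
  have h1a : a.im ≤ ‖z - (starRingEnd ℂ) a‖ := by
    have := (le_abs_self _).trans (abs_im_le_norm (z - (starRingEnd ℂ) a))
    simp at this; linarith
  have him := (le_abs_self _).trans (abs_im_le_norm (a - b))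
  rw [sub_im] at him
  have h2 : ‖z - (starRingEnd ℂ) b‖ ≤ (1 + K) * ‖z - (starRingEnd ℂ) a‖ := by
    have := norm_add_le (z - (starRingEnd ℂ) a) ((starRingEnd ℂ) a - (starRingEnd ℂ) b)
    rw [sub_add_sub_cancel] at this
    nlinarith
  have h3 : a.im ≤ (1 + K) * b.im := by linarith
  have h4 : normSq (z - (starRingEnd ℂ) b) ≤ (1 + K) ^ 2 * normSq (z - (starRingEnd ℂ) a) := by
    rw [normSq_eq_norm_sq, normSq_eq_norm_sq, ← mul_pow]
    exact pow_le_pow_left₀ (norm_nonneg _) h2 2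
  rw [cs, cs, ← mul_div_assoc, div_le_div_iff₀ p1 p2]
  calc 4 * z.im * a.im * normSq (z - (starRingEnd ℂ) b)
      ≤ 4 * z.im * ((1 + K) * b.im) * ((1 + K) ^ 2 * normSq (z - (starRingEnd ℂ) a)) := by
        gcongr
    _ = _ := by ring

section Pompeiu

open MeasureTheory

/-- The operator `∂̄`. -/
def dbar (f : ℂ → ℂ) (z : ℂ) : ℂ := (fderiv ℝ f z 1 + I * fderiv ℝ f z I) / 2

lemma locallyIntegrable_inv : LocallyIntegrable (fun z : ℂ => z⁻¹) := by
  refine locallyIntegrable_of_norm_le_rpow (C := 1) (α := 1) (by simp) (by simp) ?_ ?_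
  · refine Filter.Eventually.of_forall fun z => ?_
    rw [norm_inv, Real.rpow_neg (norm_nonneg _), Real.rpow_one, one_mul]
  · exact measurable_inv.aestronglyMeasurable

/-- The point `e^{iθ}`. -/
def eit (θ : ℝ) : ℂ := exp (θ * I)

lemma norm_eit (θ : ℝ) : ‖eit θ‖ = 1 := norm_exp_ofReal_mul_I θ

lemma hasDerivAt_eit (θ : ℝ) : HasDerivAt eit (I * eit θ) θ := by
  have h : HasDerivAt (fun θ : ℝ => (θ : ℂ) * I) (1 * I) θ := (hasDerivAt_id θ).ofReal_comp.mul_const I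
  have := h.cexp
  unfold eit
  convert this using 1
  ring

lemma continuous_eit : Continuous eit := by unfold eit; fun_prop

lemma norm_fderiv_bdd {h : ℂ → ℂ} (hh : ContDiff ℝ 1 h) (hs : HasCompactSupport h) :
    ∃ C R : ℝ, 0 < R ∧ (∀ z, ‖fderiv ℝ h z‖ ≤ C) ∧ (∀ z, R ≤ ‖z‖ → h z = 0 ∧ fderiv ℝ h z = 0) := by
  obtain ⟨C, hC⟩ := (hs.fderiv (𝕜 := ℝ)).exists_bound_of_continuous (hh.continuous_fderiv one_ne_zero)
  obtain ⟨R, hR, hR'⟩ := hs.isCompact.isBounded.exists_pos_norm_lt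
  refine ⟨C, R, hR, hC, fun z hz => ?_⟩
  have h1 : z ∉ tsupport h := fun h => absurd (hR' z h) (not_lt.2 hz)
  exact ⟨image_eq_zero_of_notMem_tsupport h1,
    image_eq_zero_of_notMem_tsupport fun h2 => h1 (tsupport_fderiv_subset ℝ h2)⟩

lemma integrableOn_polar {F : ℝ × ℝ → ℂ} (hF : Continuous F) {R : ℝ}
    (hR : ∀ p : ℝ × ℝ, R ≤ p.1 → F p = 0) :
    IntegrableOn F (Ioi (0 : ℝ) ×ˢ Ioo (-Real.pi) Real.pi) := by
  have h1 : IntegrableOn F (Icc (0 : ℝ) R ×ˢ Icc (-Real.pi) Real.pi) :=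
    hF.continuousOn.integrableOn_compact (isCompact_Icc.prod isCompact_Icc)
  refine IntegrableOn.of_forall_sdiff_eq_zero h1 (measurableSet_Ioi.prod measurableSet_Ioo) ?_
  rintro ⟨r, θ⟩ ⟨⟨hr, hθ⟩, hn⟩
  refine hR _ ?_
  by_contra hlt
  exact hn ⟨⟨(mem_Ioi.1 hr).le, (not_le.1 hlt).le⟩, Ioo_subset_Icc_self hθ⟩

lemma integral_radial {h : ℂ → ℂ} (hh : ContDiff ℝ 1 h) (hs : HasCompactSupport h) (θ : ℝ) :
    ∫ r in Ioi (0 : ℝ), fderiv ℝ h (r * eit θ) (eit θ) = -h 0 := by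
  obtain ⟨C, R, hR, -, hz⟩ := norm_fderiv_bdd hh hs
  have hd : ∀ r : ℝ, HasDerivAt (fun r : ℝ => h (r * eit θ)) (fderiv ℝ h (r * eit θ) (eit θ)) r := by
    intro r
    have h1 : HasDerivAt (fun r : ℝ => (r : ℂ) * eit θ) (1 * eit θ) r :=
      (hasDerivAt_id r).ofReal_comp.mul_const _
    have h2 := (hh.differentiable one_ne_zero (r * eit θ)).hasFDerivAt.comp_hasDerivAt r h1
    simpa [Function.comp_def] using h2
  have hc : ContDiff ℝ 1 (fun r : ℝ => h (r * eit θ)) :=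
    hh.comp (ofRealCLM.contDiff.mul contDiff_const)
  have hcs : HasCompactSupport (fun r : ℝ => h (r * eit θ)) := by
    refine HasCompactSupport.intro (isCompact_Icc (a := -R) (b := R)) fun r hr => (hz _ ?_).1
    rw [norm_mul, norm_eit, mul_one, norm_real, Real.norm_eq_abs]
    by_contra hlt
    exact hr (abs_le.1 (not_le.1 hlt).le)
  have := hcs.integral_Ioi_deriv_eq hc 0
  simp only [fun r => (hd r).deriv] at this
  simpa using this

lemma integral_angular {h : ℂ → ℂ} (hh : ContDiff ℝ 1 h) {r : ℝ} (hr : 0 < r) :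
    ∫ θ in Ioo (-Real.pi) Real.pi, fderiv ℝ h (r * eit θ) (I * eit θ) = 0 := by
  have hd : ∀ θ : ℝ, HasDerivAt (fun θ : ℝ => h (r * eit θ))
      (r * fderiv ℝ h (r * eit θ) (I * eit θ)) θ := by
    intro θ
    have h1 := (hasDerivAt_eit θ).const_mul (r : ℂ)
    have h2 := (hh.differentiable one_ne_zero (r * eit θ)).hasFDerivAt.comp_hasDerivAt θ h1
    have e : (r : ℂ) * (I * eit θ) = r • (I * eit θ) := by simp
    rw [e, map_smul] at h2
    simpa [Function.comp_def] using h2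
  have hcont : Continuous fun θ : ℝ => fderiv ℝ h (r * eit θ) (I * eit θ) := by
    have := hh.continuous_fderiv one_ne_zero
    have := continuous_eit
    fun_prop
  have := intervalIntegral.integral_eq_sub_of_hasDerivAt (a := -Real.pi) (b := Real.pi)
    (fun θ _ => hd θ) ((continuous_const.mul hcont).intervalIntegrable _ _)
  rw [intervalIntegral.integral_const_mul, intervalIntegral.integral_of_le
    (by linarith [Real.pi_pos]), integral_Ioc_eq_integral_Ioo] at this
  have e : eit Real.pi = eit (-Real.pi) := by simp [eit, exp_neg]
  rw [e, sub_self] at this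
  exact (mul_eq_zero.1 this).resolve_left (by exact_mod_cast hr.ne')

lemma integral_inv_mul_dbar {h : ℂ → ℂ} (hh : ContDiff ℝ 1 h) (hs : HasCompactSupport h) :
    ∫ z, z⁻¹ * dbar h z = -(Real.pi * h 0) := by
  obtain ⟨C, R, hR, -, hz⟩ := norm_fderiv_bdd hh hs
  have hfd := hh.continuous_fderiv one_ne_zero
  set S : Set (ℝ × ℝ) := Ioi (0 : ℝ) ×ˢ Ioo (-Real.pi) Real.pi with hS
  set A : ℝ × ℝ → ℂ := fun p => fderiv ℝ h (p.1 * eit p.2) (eit p.2) with hA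
  set B : ℝ × ℝ → ℂ := fun p => fderiv ℝ h (p.1 * eit p.2) (I * eit p.2) with hB
  have cA : Continuous A := by
    have := continuous_eit
    fun_prop
  have cB : Continuous B := by
    have := continuous_eit
    fun_prop
  have zz : ∀ p : ℝ × ℝ, R ≤ p.1 → fderiv ℝ h (p.1 * eit p.2) = 0 := fun p hp => by
    refine (hz _ ?_).2
    rw [norm_mul, norm_eit, mul_one, norm_real, Real.norm_eq_abs]
    exact hp.trans (le_abs_self _)
  have iA : IntegrableOn A S := integrableOn_polar cA (R := R) fun p hp => by simp [hA, zz p hp]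
  have iB : IntegrableOn B S := integrableOn_polar cB (R := R) fun p hp => by simp [hB, zz p hp]
  have vA : ∫ p in S, A p = -(2 * Real.pi * h 0) := by
    have e : (volume.restrict S : Measure (ℝ × ℝ)) =
        (volume.restrict (Ioi (0 : ℝ))).prod (volume.restrict (Ioo (-Real.pi) Real.pi)) := by
      rw [Measure.prod_restrict]; rfl
    rw [IntegrableOn, e] at iA
    rw [e, integral_prod_symm _ iA]
    simp only [hA, integral_radial hh hs]
    simp
    left
    rw [max_eq_left (by linarith [Real.pi_pos])]
    push_cast
    ring
  have vB : ∫ p in S, B p = 0 := by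
    have e : (volume.restrict S : Measure (ℝ × ℝ)) =
        (volume.restrict (Ioi (0 : ℝ))).prod (volume.restrict (Ioo (-Real.pi) Real.pi)) := by
      rw [Measure.prod_restrict]; rfl
    rw [IntegrableOn, e] at iB
    rw [e, integral_prod _ iB]
    refine setIntegral_eq_zero_of_forall_eq_zero fun r hr => ?_
    exact integral_angular hh hr
  rw [← Complex.integral_comp_polarCoord_symm]
  have eS : polarCoord.target = S := rfl
  rw [eS]
  have e : ∀ p ∈ S, p.1 • ((Complex.polarCoord.symm p)⁻¹ * dbar h (Complex.polarCoord.symm p)) =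
      (A p + I * B p) / 2 := by
    rintro ⟨r, θ⟩ ⟨hr, -⟩
    have hr0 : (r : ℂ) ≠ 0 := by exact_mod_cast (mem_Ioi.1 hr).ne'
    have e1 : Complex.polarCoord.symm (r, θ) = r * eit θ := by
      simp [eit, exp_mul_I]
    have e0 : eit θ ≠ 0 := exp_ne_zero _
    set L := fderiv ℝ h (r * eit θ) with hL
    have lin : ∀ v : ℂ, L v = v.re * L 1 + v.im * L I := fun v => by
      have : v = v.re • (1 : ℂ) + v.im • I := by simp [re_add_im]
      conv_lhs => rw [this, map_add, map_smul, map_smul]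
      simp
    have e2 : (eit θ)⁻¹ = Real.cos θ - Real.sin θ * I := by
      rw [eit, ← exp_neg, ← neg_mul, exp_mul_I]; simp [sub_eq_add_neg]
    have e3 : (eit θ).re = Real.cos θ := by simp [eit, exp_ofReal_mul_I_re]
    have e4 : (eit θ).im = Real.sin θ := by simp [eit, exp_ofReal_mul_I_im]
    simp only [hA, hB, e1, dbar, ← hL]
    rw [lin (eit θ), lin (I * eit θ), mul_inv, e2]
    simp only [mul_re, mul_im, I_re, I_im, e3, e4, real_smul]
    push_cast
    field_simp
    linear_combination (-(sin (θ : ℂ)) * L I) * I_sq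
  rw [setIntegral_congr_fun (measurableSet_Ioi.prod measurableSet_Ioo) e,
    integral_div, integral_add iA (iB.const_mul I), integral_const_mul, vA, vB]
  ring

lemma hasCompactSupport_of_ball {g : ℂ → ℂ} (h0 : ∀ s, 1 < ‖s‖ → g s = 0) :
    HasCompactSupport g :=
  HasCompactSupport.intro (isCompact_closedBall (0 : ℂ) 1) fun s hs => h0 s (by simpa using hs)

lemma cauchy_transform_aux {g : ℂ → ℂ} (hg : ContDiff ℝ 1 g) (hc : HasCompactSupport g) :
    Differentiable ℝ (fun t : ℂ => ∫ s, s⁻¹ * g (t - s)) ∧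
    ∀ t, dbar (fun t : ℂ => ∫ s, s⁻¹ * g (t - s)) t = Real.pi * g t := by
  have hd := fun t => hc.hasFDerivAt_convolution_right (ContinuousLinearMap.mul ℝ ℂ)
    locallyIntegrable_inv hg t
  have e : (fun t : ℂ => ∫ s, s⁻¹ * g (t - s)) =
      convolution (fun z : ℂ => z⁻¹) g (ContinuousLinearMap.mul ℝ ℂ) volume := by
    ext t
    simp [convolution_def]
  rw [e]
  refine ⟨fun t => (hd t).differentiableAt, fun t => ?_⟩
  have hcf := hc.fderiv (𝕜 := ℝ)
  have hcc := hg.continuous_fderiv one_ne_zero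
  rw [dbar, (hd t).fderiv, convolution_precompR_apply _ locallyIntegrable_inv hcf hcc,
    convolution_precompR_apply _ locallyIntegrable_inv hcf hcc, convolution_def, convolution_def]
  simp only [ContinuousLinearMap.mul_apply']
  have hitg : ∀ v : ℂ, Integrable (fun s : ℂ => s⁻¹ * fderiv ℝ g (t - s) v) := by
    intro v
    have h1 : HasCompactSupport fun a => fderiv ℝ g a v :=
      hcf.comp_left (g := fun L : ℂ →L[ℝ] ℂ => L v) rfl
    have h2 : Continuous fun a => fderiv ℝ g a v := by fun_prop
    have := h1.convolutionExists_right (ContinuousLinearMap.mul ℝ ℂ) locallyIntegrable_inv h2 t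
    simpa [ConvolutionExistsAt] using this
  have hcd : ContDiff ℝ 1 fun s => g (t - s) := hg.comp (contDiff_const.sub contDiff_id)
  have hcs : HasCompactSupport fun s => g (t - s) :=
    hc.comp_homeomorph (Homeomorph.subLeft t)
  have key := integral_inv_mul_dbar hcd hcs
  have ed : ∀ s, dbar (fun s => g (t - s)) s = -((fderiv ℝ g (t - s) 1 + I * fderiv ℝ g (t - s) I) / 2) := by
    intro s
    have h1 : HasFDerivAt (fun s => g (t - s)) ((fderiv ℝ g (t - s)).comp (-ContinuousLinearMap.id ℝ ℂ)) s :=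
      (hg.differentiable one_ne_zero (t - s)).hasFDerivAt.comp s ((hasFDerivAt_id s).const_sub t)
    rw [dbar, h1.fderiv]
    simp
    ring
  simp only [ed, sub_zero] at key
  rw [← integral_const_mul, ← integral_add (hitg 1) ((hitg I).const_mul I), ← integral_div]
  rw [← neg_inj, ← key, ← integral_neg]
  congr 1
  ext s
  ring

lemma inv_sub_expand {t s : ℂ} (h1 : ‖s‖ ≤ 1) (h2 : 3 / 2 ≤ ‖t‖) (K : ℕ) :
    ‖(t - s)⁻¹ - ∑ k ∈ Finset.range K, s ^ k * t⁻¹ ^ (k + 1)‖ ≤ 2 * (2 / 3 : ℝ) ^ K := by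
  have ht : t ≠ 0 := norm_pos_iff.1 (by linarith)
  have hts : 1 / 2 ≤ ‖t - s‖ := by linarith [norm_sub_norm_le t s]
  have hts0 : t - s ≠ 0 := norm_pos_iff.1 (by linarith)
  have e : (t - s)⁻¹ - ∑ k ∈ Finset.range K, s ^ k * t⁻¹ ^ (k + 1) =
      (s * t⁻¹) ^ K * (t - s)⁻¹ := by
    have h := geom_sum_mul (s * t⁻¹) K
    have h3 : ∑ k ∈ Finset.range K, s ^ k * t⁻¹ ^ (k + 1) =
        (∑ k ∈ Finset.range K, (s * t⁻¹) ^ k) * t⁻¹ := by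
      rw [Finset.sum_mul]
      refine Finset.sum_congr rfl fun k _ => ?_
      rw [mul_pow]; ring
    rw [h3]
    have h4 : (∑ k ∈ Finset.range K, (s * t⁻¹) ^ k) * t⁻¹ * (t - s) = 1 - (s * t⁻¹) ^ K := by
      have : t⁻¹ * (t - s) = -(s * t⁻¹ - 1) := by field_simp; ring
      rw [mul_assoc, this, mul_neg, h]; ring
    field_simp at h4 ⊢
    linear_combination (-1 : ℂ) * h4
  rw [e, norm_mul, norm_pow, norm_mul, norm_inv, norm_inv, mul_comm]
  have i1 : ‖t - s‖⁻¹ ≤ 2 := by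
    rw [inv_le_comm₀ (by linarith) (by norm_num)]; linarith
  have i2 : ‖s‖ * ‖t‖⁻¹ ≤ 2 / 3 := by
    rw [← div_eq_mul_inv, div_le_div_iff₀ (by linarith) (by norm_num)]; linarith
  gcongr

/-- Solution of `∂̄V = g` for `g` supported in the unit disc, with its expansion at infinity. -/
theorem exists_cauchy_transform : ∃ C : ℝ, 1 ≤ C ∧ ∀ (g : ℂ → ℂ) (M : ℝ), ContDiff ℝ 1 g →
    (∀ s, 1 < ‖s‖ → g s = 0) → (∀ s, ‖g s‖ ≤ M) → ∃ (V : ℂ → ℂ) (c : ℕ → ℂ),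
      Differentiable ℝ V ∧ (∀ t, dbar V t = g t) ∧ (∀ t, ‖V t‖ ≤ C * M) ∧
      (∀ k, ‖c k‖ ≤ C * M) ∧
      ∀ t, 3 / 2 ≤ ‖t‖ → ∀ K : ℕ,
        ‖V t - ∑ k ∈ Finset.range K, c k * t⁻¹ ^ (k + 1)‖ ≤ C * M * (2 / 3 : ℝ) ^ K := by
  have hint0 : IntegrableOn (fun z : ℂ => ‖z‖⁻¹) (closedBall 0 1) := by
    simpa [IntegrableOn] using (locallyIntegrable_inv.integrableOn_isCompact (isCompact_closedBall 0 1)).norm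
  set C0 := ∫ z in closedBall (0 : ℂ) 1, ‖z‖⁻¹ with hC0
  have hC00 : 0 ≤ C0 := setIntegral_nonneg measurableSet_closedBall fun z _ => by positivity
  have hvol : (volume (closedBall (0 : ℂ) 1)).toReal = Real.pi := by simp
  have hpi := Real.pi_pos
  have hpi3 := Real.pi_gt_three
  refine ⟨C0 + Real.pi + 2, by linarith, fun g M hg h0 hM => ?_⟩
  have hc := hasCompactSupport_of_ball h0
  have hM0 : 0 ≤ M := (norm_nonneg _).trans (hM 0)
  obtain ⟨a1, a2⟩ := cauchy_transform_aux hg hc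
  set W : ℂ → ℂ := fun t : ℂ => ∫ s, s⁻¹ * g (t - s) with hW
  have hWs : ∀ t, W t = ∫ s, (t - s)⁻¹ * g s := fun t => by
    rw [hW, ← integral_sub_left_eq_self _ volume t]
    simp
  have hgc := hg.continuous
  have supp : ∀ F : ℂ → ℂ, ∫ s, F s * g s = ∫ s in closedBall (0 : ℂ) 1, F s * g s := by
    intro F
    symm
    refine setIntegral_eq_integral_of_forall_compl_eq_zero fun s hs => ?_
    rw [h0 s (by simpa using hs), mul_zero]
  have hbd : ∀ (F : ℂ → ℂ) (N : ℝ), 0 ≤ N → (∀ s ∈ closedBall (0 : ℂ) 1, ‖F s‖ ≤ N) →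
      ‖∫ s in closedBall (0 : ℂ) 1, F s * g s‖ ≤ Real.pi * (N * M) := by
    intro F N hN hF
    have := norm_setIntegral_le_of_norm_le_const (μ := volume) (s := closedBall (0 : ℂ) 1)
      (f := fun s => F s * g s) (C := N * M) (by simp [volume_closedBall]) fun s hs => by
        rw [norm_mul]
        exact mul_le_mul (hF s hs) (hM s) (norm_nonneg _) hN
    rw [measureReal_def, hvol] at this
    linarith
  refine ⟨fun t => (Real.pi : ℂ)⁻¹ * W t, fun k => (Real.pi : ℂ)⁻¹ *
    ∫ s in closedBall (0 : ℂ) 1, s ^ k * g s, ?_, ?_, ?_, ?_, ?_⟩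
  · exact a1.const_mul _
  · intro t
    have h1 : fderiv ℝ (fun t => (Real.pi : ℂ)⁻¹ * W t) t = (Real.pi : ℂ)⁻¹ • fderiv ℝ W t :=
      fderiv_const_mul (a1 t) _
    have h2 := a2 t
    have h3 : (Real.pi : ℂ) ≠ 0 := by exact_mod_cast hpi.ne'
    rw [dbar] at h2 ⊢
    rw [h1]
    simp only [_root_.smul_apply, smul_eq_mul]
    field_simp
    linear_combination 2 * h2
  · intro t
    have hb : ∀ s, ‖s⁻¹ * g (t - s)‖ ≤ M * ((closedBall (0 : ℂ) 1).indicator (fun z => ‖z‖⁻¹) s +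
        (closedBall t 1).indicator (fun _ => (1 : ℝ)) s) := by
      intro s
      rw [norm_mul, norm_inv]
      by_cases h1 : s ∈ closedBall (0 : ℂ) 1
      · rw [indicator_of_mem h1]
        have : 0 ≤ (closedBall t 1).indicator (fun _ => (1 : ℝ)) s :=
          indicator_nonneg (fun _ _ => zero_le_one) _
        have h3 : 0 ≤ ‖s‖⁻¹ := by positivity
        nlinarith [hM (t - s)]
      · rw [indicator_of_notMem h1]
        by_cases h2 : s ∈ closedBall t 1
        · rw [indicator_of_mem h2]
          have h3 : ‖s‖⁻¹ ≤ 1 := inv_le_one_of_one_le₀ (by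
            have : 1 < ‖s‖ := by simpa using h1
            exact this.le)
          have h4 : 0 ≤ ‖s‖⁻¹ := by positivity
          nlinarith [hM (t - s), norm_nonneg (g (t - s))]
        · rw [indicator_of_notMem h2, h0]
          · simp
          · rw [mem_closedBall, dist_eq_norm, not_le, ← norm_neg] at h2
            simpa using h2
    have hi1 : Integrable ((closedBall (0 : ℂ) 1).indicator fun z => ‖z‖⁻¹) :=
      hint0.integrable_indicator measurableSet_closedBall
    have hi2 : Integrable ((closedBall t 1).indicator (fun _ : ℂ => (1 : ℝ))) :=
      (integrable_indicator_iff measurableSet_closedBall).2 (by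
        rw [integrableOn_const_iff]
        right
        exact measure_closedBall_lt_top)
    have := norm_integral_le_of_norm_le ((hi1.add hi2).const_mul M) (Filter.Eventually.of_forall hb)
    have e1 : ∫ s, M * (((closedBall (0 : ℂ) 1).indicator (fun z => ‖z‖⁻¹) +
        (closedBall t 1).indicator (fun _ => (1 : ℝ))) s) = M * (C0 + Real.pi) := by
      rw [integral_const_mul, integral_add' hi1 hi2, integral_indicator measurableSet_closedBall,
        integral_indicator measurableSet_closedBall]
      simp [hC0, measureReal_def]
    rw [norm_mul, norm_inv, norm_real, Real.norm_eq_abs, abs_of_pos hpi]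
    have h5 : ‖W t‖ ≤ M * (C0 + Real.pi) := by
      rw [← e1]; exact this
    have h6 : Real.pi⁻¹ ≤ 1 := inv_le_one_of_one_le₀ (by linarith)
    have h7 : 0 < Real.pi⁻¹ := by positivity
    nlinarith [norm_nonneg (W t)]
  · intro k
    have := hbd (fun s => s ^ k) 1 zero_le_one fun s hs => by
      rw [norm_pow]
      exact pow_le_one₀ (norm_nonneg _) (by simpa using hs)
    rw [norm_mul, norm_inv, norm_real, Real.norm_eq_abs, abs_of_pos hpi, inv_mul_le_iff₀ hpi]
    refine this.trans ?_
    gcongr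
    linarith
  · intro t ht K
    have e : (Real.pi : ℂ)⁻¹ * W t - ∑ k ∈ Finset.range K,
        ((Real.pi : ℂ)⁻¹ * ∫ s in closedBall (0 : ℂ) 1, s ^ k * g s) * t⁻¹ ^ (k + 1) =
        (Real.pi : ℂ)⁻¹ * ∫ s in closedBall (0 : ℂ) 1,
          ((t - s)⁻¹ - ∑ k ∈ Finset.range K, s ^ k * t⁻¹ ^ (k + 1)) * g s := by
      have hcont : ContinuousOn (fun s => (t - s)⁻¹ * g s) (closedBall 0 1) := by
        refine ContinuousOn.mul (ContinuousOn.inv₀ (by fun_prop) fun s hs => ?_) hgc.continuousOn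
        have : ‖s‖ ≤ 1 := by simpa using hs
        intro h
        rw [sub_eq_zero.1 h] at ht
        linarith
      rw [hWs, supp]
      simp only [sub_mul, Finset.sum_mul]
      rw [integral_sub, integral_finsetSum, mul_sub, Finset.mul_sum]
      · congr 1
        refine Finset.sum_congr rfl fun k _ => ?_
        rw [mul_assoc, ← integral_mul_const]
        congr 2
        ext s
        ring
      · intro k _
        exact (Continuous.continuousOn (by fun_prop)).integrableOn_compact (isCompact_closedBall _ _)
      · exact hcont.integrableOn_compact (isCompact_closedBall _ _)
      · refine integrable_finsetSum _ fun k _ => ?_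
        exact (Continuous.continuousOn (by fun_prop)).integrableOn_compact (isCompact_closedBall _ _)
    rw [e]
    have := hbd (fun s => (t - s)⁻¹ - ∑ k ∈ Finset.range K, s ^ k * t⁻¹ ^ (k + 1))
      (2 * (2 / 3 : ℝ) ^ K) (by positivity) fun s hs => inv_sub_expand (by simpa using hs) ht K
    rw [norm_mul, norm_inv, norm_real, Real.norm_eq_abs, abs_of_pos hpi, inv_mul_le_iff₀ hpi]
    refine this.trans (mul_le_mul_of_nonneg_left ?_ hpi.le)
    have : 0 ≤ (2 / 3 : ℝ) ^ K := by positivity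
    nlinarith [mul_nonneg hM0 this]

end Pompeiu

lemma dbar_congr {f g : ℂ → ℂ} {z : ℂ} (h : f =ᶠ[𝓝 z] g) : dbar f z = dbar g z := by
  rw [dbar, dbar, h.fderiv_eq]

lemma dbar_const (c z : ℂ) : dbar (fun _ => c) z = 0 := by
  simp [dbar]

lemma dbar_add {f g : ℂ → ℂ} {z : ℂ} (hf : DifferentiableAt ℝ f z) (hg : DifferentiableAt ℝ g z) :
    dbar (fun z => f z + g z) z = dbar f z + dbar g z := by
  rw [dbar, fderiv_fun_add hf hg, dbar, dbar]
  simp only [_root_.add_apply]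
  ring

lemma dbar_sub {f g : ℂ → ℂ} {z : ℂ} (hf : DifferentiableAt ℝ f z) (hg : DifferentiableAt ℝ g z) :
    dbar (fun z => f z - g z) z = dbar f z - dbar g z := by
  rw [dbar, fderiv_fun_sub hf hg, dbar, dbar]
  simp only [_root_.sub_apply]
  ring

lemma dbar_mul {f g : ℂ → ℂ} {z : ℂ} (hf : DifferentiableAt ℝ f z) (hg : DifferentiableAt ℝ g z) :
    dbar (fun z => f z * g z) z = f z * dbar g z + dbar f z * g z := by
  rw [dbar, fderiv_fun_mul hf hg, dbar, dbar]
  simp only [_root_.add_apply, _root_.smul_apply, smul_eq_mul]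
  ring

lemma dbar_sum {ι : Type*} (s : Finset ι) {f : ι → ℂ → ℂ} {z : ℂ}
    (hf : ∀ i ∈ s, DifferentiableAt ℝ (f i) z) :
    dbar (fun z => ∑ i ∈ s, f i z) z = ∑ i ∈ s, dbar (f i) z := by
  rw [dbar, fderiv_fun_sum hf]
  simp only [_root_.sum_apply, dbar]
  rw [Finset.mul_sum, ← Finset.sum_add_distrib, Finset.sum_div]

lemma dbar_of_differentiableAt {f : ℂ → ℂ} {z : ℂ} (hf : DifferentiableAt ℂ f z) : dbar f z = 0 := by
  rw [dbar, hf.fderiv_restrictScalars ℝ]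
  simp only [ContinuousLinearMap.coe_restrictScalars']
  have : fderiv ℂ f z I = I * fderiv ℂ f z 1 := by
    conv_lhs => rw [show (I : ℂ) = I • (1 : ℂ) by simp, map_smul, smul_eq_mul]
  rw [this, ← mul_assoc, I_mul_I]
  ring

lemma differentiableAt_of_dbar {f : ℂ → ℂ} {z : ℂ} (hf : DifferentiableAt ℝ f z)
    (h : dbar f z = 0) : DifferentiableAt ℂ f z := by
  rw [differentiableAt_complex_iff_differentiableAt_real]
  refine ⟨hf, ?_⟩
  rw [dbar, div_eq_zero_iff] at h
  have h1 : fderiv ℝ f z 1 = -(I * fderiv ℝ f z I) :=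
    eq_neg_of_add_eq_zero_left (h.resolve_right (by norm_num))
  rw [smul_eq_mul, h1, mul_neg, ← mul_assoc, I_mul_I]
  ring

/-- Affine real-linear substitution. -/
lemma dbar_comp_affine {V : ℂ → ℂ} {ζ : ℂ} {w : ℝ} {z : ℂ}
    (hV : DifferentiableAt ℝ V ((z - ζ) / w)) :
    dbar (fun z => V ((z - ζ) / w)) z = dbar V ((z - ζ) / w) / w := by
  have h1 : HasFDerivAt (fun z : ℂ => (z - ζ) / w) ((w⁻¹ : ℝ) • ContinuousLinearMap.id ℝ ℂ) z := by
    have : (fun z : ℂ => (z - ζ) / w) = fun z => (w⁻¹ : ℝ) • (z - ζ) := by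
      funext z; rw [real_smul]; push_cast; rw [div_eq_inv_mul]
    rw [this]
    exact ((hasFDerivAt_id z).sub_const ζ).const_smul (w⁻¹ : ℝ)
  have h2 : HasFDerivAt (fun z => V ((z - ζ) / w)) _ z := hV.hasFDerivAt.comp z h1
  rw [dbar, dbar, h2.fderiv]
  simp only [ContinuousLinearMap.comp_apply, _root_.smul_apply,
    ContinuousLinearMap.id_apply, map_smul]
  simp only [real_smul]
  push_cast
  field_simp

lemma dbar_inv {f : ℂ → ℂ} {z : ℂ} (hf : DifferentiableAt ℝ f z) (h0 : f z ≠ 0) :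
    dbar (fun z => (f z)⁻¹) z = -(dbar f z / f z ^ 2) := by
  have h2 : DifferentiableAt ℝ (fun z => (f z)⁻¹) z := hf.inv h0
  have h1 := dbar_mul hf h2
  have h3 : (fun z => f z * (f z)⁻¹) =ᶠ[𝓝 z] fun _ => 1 := by
    filter_upwards [hf.continuousAt.eventually_ne h0] with s hs
    exact mul_inv_cancel₀ hs
  rw [dbar_congr h3, dbar_const] at h1
  have h4 : f z * dbar (fun z => (f z)⁻¹) z = -(dbar f z * (f z)⁻¹) := eq_neg_of_add_eq_zero_left h1.symm
  field_simp at h4 ⊢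
  linear_combination h4

lemma contDiffOn_dbar {f : ℂ → ℂ} {U : Set ℂ} (hU : IsOpen U) (hf : ContDiffOn ℝ 2 f U) :
    ContDiffOn ℝ 1 (dbar f) U := by
  have h := hf.fderiv_of_isOpen hU (m := 1) (by norm_num)
  unfold dbar
  exact ((h.clm_apply contDiffOn_const).add
    (contDiffOn_const.mul (h.clm_apply contDiffOn_const))).div_const 2

/-- A smooth step function. -/
def SS (t : ℝ) : ℝ := Real.smoothTransition (5 * t + 1 / 2)

lemma SS_zero {t : ℝ} (h : t ≤ -(1 / 10)) : SS t = 0 :=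
  Real.smoothTransition.zero_of_nonpos (by linarith)

lemma SS_one {t : ℝ} (h : 1 / 10 ≤ t) : SS t = 1 :=
  Real.smoothTransition.one_of_one_le (by linarith)

lemma SS_mono : Monotone SS := fun a b h => Real.smoothTransition.monotone (by linarith)

lemma contDiff_SS {n : ℕ∞} : ContDiff ℝ n SS :=
  Real.smoothTransition.contDiff.comp (by fun_prop)

/-- A smooth bump function whose integer translates form a partition of unity. -/
def al (t : ℝ) : ℝ := SS (t + 1 / 2) - SS (t - 1 / 2)

lemma contDiff_al {n : ℕ∞} : ContDiff ℝ n al :=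
  (contDiff_SS.comp (by fun_prop)).sub (contDiff_SS.comp (by fun_prop))

lemma al_nonneg (t : ℝ) : 0 ≤ al t := sub_nonneg.2 (SS_mono (by linarith))

lemma al_le_one (t : ℝ) : al t ≤ 1 := by
  have h1 : SS (t + 1 / 2) ≤ 1 := Real.smoothTransition.le_one _
  have h2 : 0 ≤ SS (t - 1 / 2) := Real.smoothTransition.nonneg _
  unfold al; linarith

lemma al_eq_zero {t : ℝ} (h : 3 / 5 ≤ |t|) : al t = 0 := by
  unfold al
  rcases le_abs.1 h with h | h
  · rw [SS_one (by linarith), SS_one (by linarith), sub_self]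
  · rw [SS_zero (by linarith), SS_zero (by linarith), sub_self]

lemma abs_lt_of_al_ne_zero {t : ℝ} (h : al t ≠ 0) : |t| < 3 / 5 := by
  by_contra hn
  exact h (al_eq_zero (not_lt.1 hn))

lemma exists_deriv_al_bound : ∃ C : ℝ, 0 < C ∧ ∀ t, |deriv al t| ≤ C := by
  have hc : HasCompactSupport al :=
    HasCompactSupport.intro (isCompact_Icc (a := -1) (b := 1)) fun t ht => al_eq_zero (by
      by_contra hn
      rw [not_le, abs_lt] at hn
      exact ht ⟨by linarith, by linarith⟩)
  obtain ⟨C, hC⟩ := hc.deriv.exists_bound_of_continuous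
    ((contDiff_al (n := 1)).continuous_deriv le_rfl)
  exact ⟨max C 1, by positivity, fun t => (hC t).trans (le_max_left _ _)⟩

/-- The integers at distance at most `7/10` from `T`. -/
def win (T : ℝ) : Finset ℤ := Finset.Icc ⌈T - 7 / 10⌉ ⌊T + 7 / 10⌋

lemma mem_win {T : ℝ} {r : ℤ} : r ∈ win T ↔ |T - r| ≤ 7 / 10 := by
  rw [win, Finset.mem_Icc, Int.ceil_le, Int.le_floor, abs_le]
  constructor <;> rintro ⟨a, b⟩ <;> constructor <;> linarith

lemma sum_win {T T' : ℝ} (h : |T' - T| ≤ 1 / 10) : ∑ r ∈ win T, al (T' - r) = 1 := by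
  obtain ⟨h1, h2⟩ := abs_le.1 h
  set m := ⌈T - 7 / 10⌉ with hm
  set n := ⌊T + 7 / 10⌋ with hn
  have m1 : (m : ℝ) < T - 7 / 10 + 1 := Int.ceil_lt_add_one _
  have m2 : T - 7 / 10 ≤ m := Int.le_ceil _
  have n1 : T + 7 / 10 < n + 1 := Int.lt_floor_add_one _
  have n2 : (n : ℝ) ≤ T + 7 / 10 := Int.floor_le _
  have a1 : SS (T' - m + 1 / 2) = 1 := SS_one (by linarith)
  have a2 : SS (T' - n - 1 / 2) = 0 := SS_zero (by linarith)
  have c1 : m ≤ n := by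
    have : (m : ℝ) < n + 1 := by linarith
    have : m < n + 1 := by exact_mod_cast this
    omega
  have c2 : n ≤ m + 1 := by
    have : (n : ℝ) < m + 2 := by linarith
    have : n < m + 2 := by exact_mod_cast this
    omega
  rw [win, ← hm, ← hn]
  rcases (by omega : n = m ∨ n = m + 1) with e | e
  · rw [e] at a2 ⊢
    rw [Finset.Icc_self, Finset.sum_singleton, al, a1, a2, sub_zero]
  · have : Finset.Icc m n = {m, m + 1} := by
      ext x; simp only [Finset.mem_Icc, Finset.mem_insert, Finset.mem_singleton]; omega
    rw [this, Finset.sum_pair (by omega)]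
    rw [e] at a2
    push_cast at a2 ⊢
    have e3 : T' - (m : ℝ) - 1 / 2 = T' - (m + 1) + 1 / 2 := by ring
    rw [al, al, a1, a2, e3]
    ring

lemma exists_window_pair (b : ℝ) : ∃ k : ℤ, (∀ l : ℤ, al (b - l) ≠ 0 → l = k ∨ l = k + 1) ∧
    (1 / 10 ≤ |b - k - 1 / 2| → ∃ k', ∀ l : ℤ, al (b - l) ≠ 0 → l = k') := by
  refine ⟨⌊b⌋, fun l hl => ?_, fun h => ?_⟩
  · have h1 := abs_lt.1 (abs_lt_of_al_ne_zero hl)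
    have h2 := Int.floor_le b
    have h3 := Int.lt_floor_add_one b
    have h4 : (l : ℝ) < ⌊b⌋ + 2 := by linarith
    have h5 : (⌊b⌋ : ℝ) - 1 < l := by linarith
    have h4' : l < ⌊b⌋ + 2 := by exact_mod_cast h4
    have h5' : ⌊b⌋ - 1 < l := by exact_mod_cast h5
    omega
  · have h2 := Int.floor_le b
    have h3 := Int.lt_floor_add_one b
    rcases le_abs.1 h with h | h
    · refine ⟨⌊b⌋ + 1, fun l hl => ?_⟩
      have h1 := abs_lt.1 (abs_lt_of_al_ne_zero hl)
      have h4 : (l : ℝ) < ⌊b⌋ + 2 := by linarith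
      have h5 : (⌊b⌋ : ℝ) < l := by linarith
      have h4' : l < ⌊b⌋ + 2 := by exact_mod_cast h4
      have h5' : ⌊b⌋ < l := by exact_mod_cast h5
      omega
    · refine ⟨⌊b⌋, fun l hl => ?_⟩
      have h1 := abs_lt.1 (abs_lt_of_al_ne_zero hl)
      have h4 : (l : ℝ) < ⌊b⌋ + 1 := by linarith
      have h5 : (⌊b⌋ : ℝ) - 1 < l := by linarith
      have h4' : l < ⌊b⌋ + 1 := by exact_mod_cast h4
      have h5' : ⌊b⌋ - 1 < l := by exact_mod_cast h5
      omega

/-- Admissible subdivision parameters. -/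
def GoodP (P : ℕ) : Prop := 8 ≤ P ∧ Even P

/-- Width of the bricks in row `r`. -/
def bw (P : ℕ) (r : ℤ) : ℝ := (2 : ℝ) ^ (-(r / (P : ℤ))) / P

/-- Horizontal shift of row `r`. -/
def bs (r : ℤ) : ℝ := ((r % 2 : ℤ) : ℝ) / 2

/-- Height of row `r`. -/
def bh (P : ℕ) (r : ℤ) : ℝ := (2 : ℝ) ^ (-(r : ℝ) / P)

/-- The brick center. -/
def bc (P : ℕ) (τ : ℤ × ℤ) : ℂ := ⟨(τ.2 + bs τ.1) * bw P τ.1, bh P τ.1⟩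

/-- The row coordinate. -/
def rowT (P : ℕ) (z : ℂ) : ℝ := -(P : ℝ) * (Real.log z.im / Real.log 2)

/-- The column coordinate in row `r`. -/
def colB (P : ℕ) (r : ℤ) (z : ℂ) : ℝ := z.re / bw P r - bs r

/-- The brick bump functions. -/
def chi (P : ℕ) (τ : ℤ × ℤ) (z : ℂ) : ℝ := al (rowT P z - τ.1) * al (colB P τ.1 z - τ.2)

/-- The bricks which are relevant near `z`. -/
def act (P : ℕ) (z : ℂ) : Finset (ℤ × ℤ) :=
  (win (rowT P z)).biUnion fun r => (win (colB P r z)).image fun k => (r, k)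

lemma mem_act {P : ℕ} {z : ℂ} {τ : ℤ × ℤ} :
    τ ∈ act P z ↔ τ.1 ∈ win (rowT P z) ∧ τ.2 ∈ win (colB P τ.1 z) := by
  obtain ⟨r, k⟩ := τ
  simp [act]

lemma chi_nonneg (P : ℕ) (τ : ℤ × ℤ) (z : ℂ) : 0 ≤ chi P τ z := mul_nonneg (al_nonneg _) (al_nonneg _)

lemma chi_le_one (P : ℕ) (τ : ℤ × ℤ) (z : ℂ) : chi P τ z ≤ 1 :=
  mul_le_one₀ (al_le_one _) (al_nonneg _) (al_le_one _)

lemma GoodP.pos {P : ℕ} (hP : GoodP P) : (0 : ℝ) < P := by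
  have := hP.1
  have : 0 < P := by omega
  exact_mod_cast this

lemma bw_pos {P : ℕ} (hP : GoodP P) (r : ℤ) : 0 < bw P r := by
  have := hP.pos
  unfold bw; positivity

lemma bh_pos (P : ℕ) (r : ℤ) : 0 < bh P r := by unfold bh; positivity

lemma bc_mem (P : ℕ) (τ : ℤ × ℤ) : 0 < (bc P τ).im := bh_pos P τ.1

lemma bh_le {P : ℕ} (hP : GoodP P) (r : ℤ) : bh P r ≤ P * bw P r := by
  have hp := hP.pos
  rw [bw, mul_div_cancel₀ _ hp.ne', bh, ← Real.rpow_intCast]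
  refine Real.rpow_le_rpow_of_exponent_le (by norm_num) ?_
  push_cast
  rw [neg_div]
  refine neg_le_neg ?_
  rw [le_div_iff₀ hp]
  have h1 : r / (P : ℤ) * P ≤ r := Int.ediv_mul_le _ (by have := hP.1; omega)
  exact_mod_cast h1

lemma le_bh {P : ℕ} (hP : GoodP P) (r : ℤ) : P * bw P r ≤ 2 * bh P r := by
  have hp := hP.pos
  have e : 2 * bh P r = (2 : ℝ) ^ (1 + -(r : ℝ) / P) := by
    rw [Real.rpow_add (by norm_num), Real.rpow_one, bh]
  rw [e, bw, mul_div_cancel₀ _ hp.ne', ← Real.rpow_intCast]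
  refine Real.rpow_le_rpow_of_exponent_le (by norm_num) ?_
  push_cast
  have h1 : r < (r / (P : ℤ) + 1) * P := Int.lt_ediv_add_one_mul_self _ (by have := hP.1; omega)
  have h2 : (r : ℝ) < (((r / (P : ℤ) : ℤ) : ℝ) + 1) * P := by exact_mod_cast h1
  have h3 : (r : ℝ) / P < ((r / (P : ℤ) : ℤ) : ℝ) + 1 := by rwa [div_lt_iff₀ hp]
  rw [neg_div]
  linarith

lemma bw_le {P : ℕ} (hP : GoodP P) (r : ℤ) : bw P r ≤ bh P r / 4 := by
  have h1 := le_bh hP r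
  have h2 : (8 : ℝ) ≤ P := by exact_mod_cast hP.1
  have := bw_pos hP r
  nlinarith

lemma sum_act {P : ℕ} {z z' : ℂ} (h1 : |rowT P z' - rowT P z| ≤ 1 / 10)
    (h2 : ∀ r ∈ win (rowT P z), |colB P r z' - colB P r z| ≤ 1 / 10) :
    ∑ τ ∈ act P z, chi P τ z' = 1 := by
  rw [Finset.sum_finset_product _ (win (rowT P z)) (fun r => win (colB P r z)) fun p => mem_act]
  simp only [chi]
  rw [← sum_win h1]
  refine Finset.sum_congr rfl fun r hr => ?_
  rw [← Finset.mul_sum, sum_win (h2 r hr), mul_one]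

lemma chi_eq_zero_of_notMem {P : ℕ} {z z' : ℂ} (h1 : |rowT P z' - rowT P z| ≤ 1 / 10)
    (h2 : ∀ r ∈ win (rowT P z), |colB P r z' - colB P r z| ≤ 1 / 10) {τ : ℤ × ℤ}
    (hτ : τ ∉ act P z) : chi P τ z' = 0 := by
  by_contra hne
  unfold chi at hne
  rw [← ne_eq, mul_ne_zero_iff] at hne
  have a1 := abs_lt.1 (abs_lt_of_al_ne_zero hne.1)
  have a2 := abs_lt.1 (abs_lt_of_al_ne_zero hne.2)
  refine hτ (mem_act.2 ?_)
  have b1 := abs_le.1 h1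
  have m1 : τ.1 ∈ win (rowT P z) := by
    rw [mem_win, abs_le]; constructor <;> linarith
  have b2 := abs_le.1 (h2 _ m1)
  refine ⟨m1, ?_⟩
  rw [mem_win, abs_le]; constructor <;> linarith

lemma continuousAt_rowT (P : ℕ) {z : ℂ} (hz : z ∈ uhp) : ContinuousAt (rowT P) z := by
  have : z.im ≠ 0 := ne_of_gt hz
  unfold rowT
  exact continuousAt_const.mul ((continuous_im.continuousAt.log this).div_const _)

lemma eventually_close (P : ℕ) {z : ℂ} (hz : z ∈ uhp) : ∀ᶠ z' in 𝓝 z,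
    z' ∈ uhp ∧ |rowT P z' - rowT P z| ≤ 1 / 10 ∧
      ∀ r ∈ win (rowT P z), |colB P r z' - colB P r z| ≤ 1 / 10 := by
  refine Filter.Eventually.and (isOpen_uhp.mem_nhds hz) (Filter.Eventually.and ?_ ?_)
  · have := Metric.continuousAt_iff'.1 (continuousAt_rowT P hz) (1 / 10) (by norm_num)
    exact this.mono fun z' h => le_of_lt h
  · rw [Filter.eventually_all_finset]
    intro r _
    have hc : Continuous (colB P r) := by unfold colB; fun_prop
    have := Metric.continuousAt_iff'.1 (hc.continuousAt (x := z)) (1 / 10) (by norm_num)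
    exact this.mono fun z' h => le_of_lt h

/-- Near a point of the half-plane only finitely many bricks matter, and they sum to `1`. -/
lemma eventually_chi (P : ℕ) {z : ℂ} (hz : z ∈ uhp) : ∀ᶠ z' in 𝓝 z,
    ∑ τ ∈ act P z, chi P τ z' = 1 ∧ ∀ τ ∉ act P z, chi P τ z' = 0 :=
  (eventually_close P hz).mono fun _ h =>
    ⟨sum_act h.2.1 h.2.2, fun _ hτ => chi_eq_zero_of_notMem h.2.1 h.2.2 hτ⟩

lemma bh_eq {P : ℕ} (hP : GoodP P) {z : ℂ} (hz : z ∈ uhp) (r : ℤ) :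
    z.im = bh P r * (2 : ℝ) ^ ((r - rowT P z) / P) := by
  have hp := hP.pos
  have hy : 0 < z.im := hz
  rw [bh, ← Real.rpow_add (by norm_num)]
  have : -(r : ℝ) / P + (r - rowT P z) / P = Real.logb 2 z.im := by
    unfold rowT Real.logb; field_simp; ring
  rw [this, Real.rpow_logb (by norm_num) (by norm_num) hy]

lemma two_rpow_le {x : ℝ} (h0 : 0 ≤ x) (h1 : x ≤ 1) : (2 : ℝ) ^ x ≤ 1 + x := by
  have := rpow_one_add_le_one_add_mul_self (s := 1) (by norm_num) h0 h1
  norm_num at this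
  linarith

lemma abs_two_rpow_sub_one {x c : ℝ} (h : |x| ≤ c) (h1 : c ≤ 1) : |(2 : ℝ) ^ x - 1| ≤ c := by
  have h0 : 0 ≤ c := (abs_nonneg _).trans h
  obtain ⟨a, b⟩ := abs_le.1 h
  have l1 : (2 : ℝ) ^ x ≤ 1 + c :=
    (Real.rpow_le_rpow_of_exponent_le (by norm_num) b).trans (two_rpow_le h0 h1)
  have l2 : (2 : ℝ) ^ (-x) ≤ 1 + c :=
    (Real.rpow_le_rpow_of_exponent_le (by norm_num) (by linarith)).trans (two_rpow_le h0 h1)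
  have l3 : (2 : ℝ) ^ x * (2 : ℝ) ^ (-x) = 1 := by
    rw [← Real.rpow_add (by norm_num)]; simp
  have l4 : 0 < (2 : ℝ) ^ x := by positivity
  rw [abs_le]
  constructor
  · nlinarith
  · linarith

lemma abs_im_sub_bh_le {P : ℕ} (hP : GoodP P) {z : ℂ} (hz : z ∈ uhp) {r : ℤ}
    (h : |rowT P z - r| ≤ 3 / 5) : |z.im - bh P r| ≤ 3 / 5 * bw P r := by
  have hp := hP.pos
  have hP8 : (8 : ℝ) ≤ P := by exact_mod_cast hP.1
  have hb := bh_pos P r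
  have h1 : |((r : ℝ) - rowT P z) / P| ≤ 3 / 5 / P := by
    rw [abs_div, abs_of_pos hp, abs_sub_comm]
    gcongr
  have h2 := abs_two_rpow_sub_one h1 (by rw [div_le_one hp]; linarith)
  have e : z.im - bh P r = bh P r * ((2 : ℝ) ^ ((r - rowT P z) / P) - 1) := by
    rw [mul_sub, ← bh_eq hP hz r, mul_one]
  rw [e, abs_mul, abs_of_pos hb]
  calc bh P r * |(2 : ℝ) ^ ((r - rowT P z) / P) - 1| ≤ (P * bw P r) * (3 / 5 / P) := by
        gcongr
        · exact mul_nonneg hp.le (bw_pos hP r).le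
        · exact bh_le hP r
    _ = 3 / 5 * bw P r := by field_simp

lemma norm_sub_bc_le {P : ℕ} (hP : GoodP P) {z : ℂ} (hz : z ∈ uhp) {τ : ℤ × ℤ}
    (h : chi P τ z ≠ 0) : ‖z - bc P τ‖ ≤ 17 / 20 * bw P τ.1 := by
  have hw := bw_pos hP τ.1
  unfold chi at h
  obtain ⟨a1, a2⟩ := mul_ne_zero_iff.1 h
  have b1 := abs_im_sub_bh_le hP hz (abs_lt_of_al_ne_zero a1).le
  have b2 := abs_lt_of_al_ne_zero a2
  have b3 : |z.re - (τ.2 + bs τ.1) * bw P τ.1| ≤ 3 / 5 * bw P τ.1 := by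
    have e : z.re - (τ.2 + bs τ.1) * bw P τ.1 = (colB P τ.1 z - τ.2) * bw P τ.1 := by
      unfold colB; field_simp; ring
    rw [e, abs_mul, abs_of_pos hw]
    gcongr
  have s1 := sq_le_sq' (by linarith [(abs_le.1 b1).1]) (abs_le.1 b1).2
  have s2 := sq_le_sq' (by linarith [(abs_le.1 b3).1]) (abs_le.1 b3).2
  refine le_of_sq_le_sq ?_ (by positivity)
  rw [Complex.sq_norm, normSq_apply]
  simp only [sub_re, sub_im, bc]
  nlinarith

lemma im_le_of_abs_rowT {P : ℕ} (hP : GoodP P) {z : ℂ} (hz : z ∈ uhp) {r : ℤ}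
    (h : |rowT P z - r| ≤ 3 / 5) : z.im ≤ 2 * P * bw P r := by
  have h1 := (abs_le.1 (abs_im_sub_bh_le hP hz h)).2
  have h2 := bh_le hP r
  have hP8 : (8 : ℝ) ≤ P := by exact_mod_cast hP.1
  have := bw_pos hP r
  nlinarith

lemma contDiffAt_chi (P : ℕ) (τ : ℤ × ℤ) {n : ℕ∞} {z : ℂ} (hz : z ∈ uhp) :
    ContDiffAt ℝ n (chi P τ) z := by
  have hy : z.im ≠ 0 := ne_of_gt hz
  have him : ContDiffAt ℝ n Complex.im z := Complex.imCLM.contDiff.contDiffAt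
  have hre : ContDiffAt ℝ n Complex.re z := Complex.reCLM.contDiff.contDiffAt
  have h1 : ContDiffAt ℝ n (fun z => rowT P z - τ.1) z :=
    (contDiffAt_const.mul ((him.log hy).div_const _)).sub contDiffAt_const
  have h2 : ContDiffAt ℝ n (fun z => colB P τ.1 z - τ.2) z :=
    ((hre.div_const _).sub contDiffAt_const).sub contDiffAt_const
  exact (contDiff_al.contDiffAt.comp z h1).mul (contDiff_al.contDiffAt.comp z h2)

lemma hasDerivAt_al (t : ℝ) : HasDerivAt al (deriv al t) t :=
  ((contDiff_al (n := 1)).differentiable one_ne_zero t).hasDerivAt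

lemma fderiv_chi_one {P : ℕ} (τ : ℤ × ℤ) {z : ℂ} (hz : z ∈ uhp) :
    fderiv ℝ (chi P τ) z 1 =
      al (rowT P z - τ.1) * (deriv al (colB P τ.1 z - τ.2) * (1 / bw P τ.1)) := by
  have hd := ((contDiffAt_chi P τ (n := 1) hz).differentiableAt one_ne_zero).hasFDerivAt
  have hl : HasDerivAt (fun t : ℝ => z + t * 1) 1 0 := by
    simpa using (Complex.ofRealCLM.hasDerivAt (x := (0:ℝ))).const_add z
  have h1 : HasDerivAt (fun t : ℝ => chi P τ (z + t * 1)) (fderiv ℝ (chi P τ) z 1) 0 := by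
    have := hd
    rw [show z = z + ((0 : ℝ) : ℂ) * 1 by simp] at this
    have h := this.comp_hasDerivAt (0 : ℝ) hl
    simpa [Function.comp_def] using h
  have h2 : HasDerivAt (fun t : ℝ => chi P τ (z + t * 1))
      (al (rowT P z - τ.1) * (deriv al (colB P τ.1 z - τ.2) * (1 / bw P τ.1))) 0 := by
    have e : (fun t : ℝ => chi P τ (z + t * 1)) = fun t : ℝ =>
        al (rowT P z - τ.1) * al ((z.re + t) / bw P τ.1 - bs τ.1 - τ.2) := by
      funext t; simp [chi, rowT, colB]
    rw [e]
    refine HasDerivAt.const_mul _ ?_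
    have hi : HasDerivAt (fun t : ℝ => (z.re + t) / bw P τ.1 - bs τ.1 - τ.2) (1 / bw P τ.1) 0 :=
      ((((hasDerivAt_id (0 : ℝ)).const_add z.re).div_const _).sub_const _).sub_const _
    have ho := hasDerivAt_al (colB P τ.1 z - τ.2)
    have e2 : colB P τ.1 z - τ.2 = (z.re + 0) / bw P τ.1 - bs τ.1 - τ.2 := by simp [colB]
    rw [e2] at ho ⊢
    exact ho.comp (0 : ℝ) hi
  exact h1.unique h2

lemma fderiv_chi_I {P : ℕ} (τ : ℤ × ℤ) {z : ℂ} (hz : z ∈ uhp) :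
    fderiv ℝ (chi P τ) z I =
      deriv al (rowT P z - τ.1) * (-P * (1 / z.im / Real.log 2)) * al (colB P τ.1 z - τ.2) := by
  have hy : z.im ≠ 0 := ne_of_gt hz
  have hd := ((contDiffAt_chi P τ (n := 1) hz).differentiableAt one_ne_zero).hasFDerivAt
  have hl : HasDerivAt (fun t : ℝ => z + t * I) I 0 := by
    simpa using ((Complex.ofRealCLM.hasDerivAt (x := (0:ℝ))).mul_const I).const_add z
  have h1 : HasDerivAt (fun t : ℝ => chi P τ (z + t * I)) (fderiv ℝ (chi P τ) z I) 0 := by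
    have := hd
    rw [show z = z + ((0 : ℝ) : ℂ) * I by simp] at this
    have h := this.comp_hasDerivAt (0 : ℝ) hl
    simpa [Function.comp_def] using h
  have h2 : HasDerivAt (fun t : ℝ => chi P τ (z + t * I))
      (deriv al (rowT P z - τ.1) * (-P * (1 / z.im / Real.log 2)) * al (colB P τ.1 z - τ.2)) 0 := by
    have e : (fun t : ℝ => chi P τ (z + t * I)) = fun t : ℝ =>
        al (-P * (Real.log (z.im + t) / Real.log 2) - τ.1) * al (colB P τ.1 z - τ.2) := by
      funext t; simp [chi, rowT, colB]
    rw [e]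
    refine HasDerivAt.mul_const ?_ _
    have hi : HasDerivAt (fun t : ℝ => -P * (Real.log (z.im + t) / Real.log 2) - τ.1)
        (-P * (1 / z.im / Real.log 2)) 0 := by
      have := (((hasDerivAt_id (0 : ℝ)).const_add z.im).log (by simpa using hy))
      simpa using (((this.div_const (Real.log 2)).const_mul (-(P : ℝ))).sub_const (τ.1 : ℝ))
    have ho := hasDerivAt_al (rowT P z - τ.1)
    have e2 : rowT P z - τ.1 = -P * (Real.log (z.im + 0) / Real.log 2) - τ.1 := by simp [rowT]
    rw [e2] at ho ⊢
    exact ho.comp (0 : ℝ) hi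
  exact h1.unique h2

lemma exists_fderiv_chi_bound {P : ℕ} (hP : GoodP P) : ∃ C : ℝ, 0 < C ∧ ∀ τ, ∀ z ∈ uhp,
    |fderiv ℝ (chi P τ) z 1| ≤ C / z.im ∧ |fderiv ℝ (chi P τ) z I| ≤ C / z.im := by
  obtain ⟨C, hC, hb⟩ := exists_deriv_al_bound
  have hp := hP.pos
  have hlog : 1 / 2 < Real.log 2 := by linarith [Real.log_two_gt_d9]
  refine ⟨C * (2 * P), by positivity, fun τ z hz => ⟨?_, ?_⟩⟩
  · have hy : 0 < z.im := hz
    have hw := bw_pos hP τ.1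
    rw [fderiv_chi_one τ hz]
    by_cases h0 : al (rowT P z - τ.1) = 0
    · rw [h0, zero_mul, abs_zero]; positivity
    · have h1 := im_le_of_abs_rowT hP hz (abs_lt_of_al_ne_zero h0).le
      rw [abs_mul, abs_mul, abs_of_nonneg (al_nonneg _), abs_of_pos (by positivity : 0 < 1 / bw P τ.1)]
      calc _ ≤ 1 * (C * (1 / bw P τ.1)) := by
            gcongr
            · exact al_le_one _
            · exact hb _
        _ ≤ _ := by
            rw [one_mul, mul_one_div, div_le_div_iff₀ hw hy]
            nlinarith
  · have hy : 0 < z.im := hz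
    rw [fderiv_chi_I τ hz, abs_mul, abs_mul, abs_of_nonneg (al_nonneg _), abs_mul, abs_neg,
      abs_of_pos hp, abs_of_pos (by positivity : 0 < 1 / z.im / Real.log 2)]
    calc _ ≤ C * (P * (1 / z.im / (1 / 2))) * 1 := by
          gcongr
          · exact al_nonneg _
          · exact hb _
          · exact al_le_one _
      _ = _ := by field_simp

lemma row_cases {P : ℕ} {τ : ℤ × ℤ} {z : ℂ} (h : chi P τ z ≠ 0) :
    τ.1 = ⌊rowT P z⌋ ∨ τ.1 = ⌊rowT P z⌋ + 1 := by
  unfold chi at h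
  have h1 := abs_lt.1 (abs_lt_of_al_ne_zero (mul_ne_zero_iff.1 h).1)
  have h2 := Int.floor_le (rowT P z)
  have h3 := Int.lt_floor_add_one (rowT P z)
  have h4 : (τ.1 : ℝ) < ⌊rowT P z⌋ + 2 := by linarith
  have h5 : (⌊rowT P z⌋ : ℝ) - 1 < τ.1 := by linarith
  have h4' : τ.1 < ⌊rowT P z⌋ + 2 := by exact_mod_cast h4
  have h5' : ⌊rowT P z⌋ - 1 < τ.1 := by exact_mod_cast h5
  omega

lemma bw_succ {P : ℕ} (hP : GoodP P) (m : ℤ) :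
    (bw P (m + 1) = bw P m ∧ |bs (m + 1) - bs m| = 1 / 2) ∨
      (bw P m = 2 * bw P (m + 1) ∧ bs m = 1 / 2 ∧ bs (m + 1) = 0) := by
  obtain ⟨h8, q, hq⟩ := hP
  have hp : 0 < (P : ℤ) := by omega
  have e1 := Int.mul_ediv_add_emod m P
  have e2 := Int.emod_nonneg m hp.ne'
  have e3 := Int.emod_lt_of_pos m hp
  set j := m / (P : ℤ) with hj
  set i := m % (P : ℤ) with hi
  by_cases hc : i + 1 < P
  · left
    constructor
    · have : (m + 1) / (P : ℤ) = j := by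
        rw [← e1, show (P : ℤ) * j + i + 1 = (i + 1) + P * j by ring, Int.add_mul_ediv_left _ _ hp.ne',
          Int.ediv_eq_zero_of_lt (by omega) hc, zero_add]
      rw [bw, bw, this, ← hj]
    · unfold bs
      rcases Int.emod_two_eq_zero_or_one m with h | h
      · have : (m + 1) % 2 = 1 := by omega
        rw [h, this]; norm_num
      · have : (m + 1) % 2 = 0 := by omega
        rw [h, this]; norm_num
  · right
    have hi' : i = P - 1 := by omega
    have hm : m + 1 = P * (j + 1) := by rw [← e1, hi']; ring
    refine ⟨?_, ?_, ?_⟩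
    · have : (m + 1) / (P : ℤ) = j + 1 := by rw [hm, Int.mul_ediv_cancel_left _ hp.ne']
      rw [bw, bw, this, ← hj, neg_add, zpow_add₀ (by norm_num : (2 : ℝ) ≠ 0)]
      norm_num
      ring
    · have h2 : (m + 1) % 2 = 0 := by
        rw [hm, hq]; push_cast
        rw [show ((q : ℤ) + q) * (j + 1) = 2 * (q * (j + 1)) by ring, Int.mul_emod_right]
      have : m % 2 = 1 := by omega
      rw [bs, this]; norm_num
    · have h2 : (m + 1) % 2 = 0 := by
        rw [hm, hq]; push_cast
        rw [show ((q : ℤ) + q) * (j + 1) = 2 * (q * (j + 1)) by ring, Int.mul_emod_right]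
      rw [bs, h2]; norm_num

lemma no_double_pair {P : ℕ} (hP : GoodP P) (m k k' : ℤ) (z : ℂ)
    (h : |colB P m z - k - 1 / 2| < 1 / 10) (h' : |colB P (m + 1) z - k' - 1 / 2| < 1 / 10) :
    False := by
  have hw := bw_pos hP m
  have hw' := bw_pos hP (m + 1)
  rw [abs_lt] at h h'
  unfold colB at h h'
  rcases bw_succ hP m with ⟨h1, h2⟩ | ⟨h1, h2, h3⟩
  · rw [h1] at h'
    rcases (abs_eq (by norm_num)).1 h2 with h2 | h2
    · have a1 : (k' : ℝ) - k < 0 := by linarith [h.1, h.2, h'.1, h'.2]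
      have a2 : (-1 : ℝ) < k' - k := by linarith [h.1, h.2, h'.1, h'.2]
      have a1' : k' - k < 0 := by exact_mod_cast a1
      have a2' : -1 < k' - k := by exact_mod_cast a2
      omega
    · have a1 : (k' : ℝ) - k < 1 := by linarith [h.1, h.2, h'.1, h'.2]
      have a2 : (0 : ℝ) < k' - k := by linarith [h.1, h.2, h'.1, h'.2]
      have a1' : k' - k < 1 := by exact_mod_cast a1
      have a2' : 0 < k' - k := by exact_mod_cast a2
      omega
  · have e : z.re / bw P (m + 1) = 2 * (z.re / bw P m) := by rw [h1]; field_simp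
    rw [e, h3] at h'
    rw [h2] at h
    have a1 : (k' : ℝ) - 2 * k < 2 := by linarith [h.1, h.2, h'.1, h'.2]
    have a2 : (1 : ℝ) < k' - 2 * k := by linarith [h.1, h.2, h'.1, h'.2]
    have a1' : k' - 2 * k < 2 := by exact_mod_cast a1
    have a2' : 1 < k' - 2 * k := by exact_mod_cast a2
    omega

/-- At most three bricks are active at each point. -/
lemma exists_three {P : ℕ} (hP : GoodP P) (z : ℂ) :
    ∃ S : Finset (ℤ × ℤ), S.card ≤ 3 ∧ ∀ τ, chi P τ z ≠ 0 → τ ∈ S := by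
  set m := ⌊rowT P z⌋ with hm
  obtain ⟨k, hk, hk1⟩ := exists_window_pair (colB P m z)
  obtain ⟨l, hl, hl1⟩ := exists_window_pair (colB P (m + 1) z)
  have key : ∀ τ : ℤ × ℤ, chi P τ z ≠ 0 → (τ.1 = m ∧ al (colB P m z - τ.2) ≠ 0) ∨
      (τ.1 = m + 1 ∧ al (colB P (m + 1) z - τ.2) ≠ 0) := by
    intro τ h
    have h' := h
    unfold chi at h'
    have h2 := (mul_ne_zero_iff.1 h').2
    rcases row_cases h with e | e
    · left; rw [e] at h2; exact ⟨e, h2⟩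
    · right; rw [e] at h2; exact ⟨e, h2⟩
  by_cases hA : 1 / 10 ≤ |colB P m z - k - 1 / 2|
  · obtain ⟨k', hk'⟩ := hk1 hA
    refine ⟨{(m, k'), (m + 1, l), (m + 1, l + 1)}, Finset.card_le_three, fun τ hτ => ?_⟩
    simp only [Finset.mem_insert, Finset.mem_singleton, Prod.ext_iff]
    rcases key τ hτ with ⟨a, b⟩ | ⟨a, b⟩
    · exact Or.inl ⟨a, hk' _ b⟩
    · rcases hl _ b with h | h <;> simp [a, h]
  · have hB : 1 / 10 ≤ |colB P (m + 1) z - l - 1 / 2| := by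
      by_contra hB
      exact no_double_pair hP m k l z (not_le.1 hA) (not_le.1 hB)
    obtain ⟨l', hl'⟩ := hl1 hB
    refine ⟨{(m, k), (m, k + 1), (m + 1, l')}, Finset.card_le_three, fun τ hτ => ?_⟩
    simp only [Finset.mem_insert, Finset.mem_singleton, Prod.ext_iff]
    rcases key τ hτ with ⟨a, b⟩ | ⟨a, b⟩
    · rcases hk _ b with h | h <;> simp [a, h]
    · exact Or.inr (Or.inr ⟨a, hl' _ b⟩)

section Coloring
variable {Col : Type*} [DecidableEq Col]

/-- The sum of the bump functions of the bricks of color `v`. -/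
def ph (P : ℕ) (c : ℤ × ℤ → Col) (v : Col) (z : ℂ) : ℝ :=
  ∑ τ ∈ act P z, if c τ = v then chi P τ z else 0

/-- The bricks overlapping a brick of a different color. -/
def Jmp (P : ℕ) (c : ℤ × ℤ → Col) : Set (ℤ × ℤ) :=
  {τ | ∃ τ', ∃ z ∈ uhp, chi P τ z ≠ 0 ∧ chi P τ' z ≠ 0 ∧ c τ' ≠ c τ}

lemma chi_eq_zero_of_notMem_self {P : ℕ} {z : ℂ} {τ : ℤ × ℤ} (hτ : τ ∉ act P z) : chi P τ z = 0 :=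
  chi_eq_zero_of_notMem (by simp) (by simp) hτ

lemma sum_chi {P : ℕ} (z : ℂ) : ∑ τ ∈ act P z, chi P τ z = 1 := sum_act (by simp) (by simp)

lemma ph_eq_sum {P : ℕ} (c : ℤ × ℤ → Col) (v : Col) {z : ℂ} {S : Finset (ℤ × ℤ)}
    (h : ∀ τ ∉ S, chi P τ z = 0) : ph P c v z = ∑ τ ∈ S, if c τ = v then chi P τ z else 0 := by
  have h1 : ph P c v z = ∑ τ ∈ act P z ∪ S, if c τ = v then chi P τ z else 0 := by
    refine Finset.sum_subset Finset.subset_union_left fun τ _ h => ?_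
    rw [chi_eq_zero_of_notMem_self h, ite_self]
  rw [h1]
  refine (Finset.sum_subset Finset.subset_union_right fun τ _ h' => ?_).symm
  rw [h τ h', ite_self]

lemma ph_eventuallyEq {P : ℕ} (c : ℤ × ℤ → Col) (v : Col) {z : ℂ} (hz : z ∈ uhp) :
    ph P c v =ᶠ[𝓝 z] fun z' => ∑ τ ∈ act P z, if c τ = v then chi P τ z' else 0 :=
  (eventually_chi P hz).mono fun _ h => ph_eq_sum c v h.2

lemma contDiffAt_ph {P : ℕ} (c : ℤ × ℤ → Col) (v : Col) {n : ℕ∞} {z : ℂ} (hz : z ∈ uhp) :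
    ContDiffAt ℝ n (ph P c v) z := by
  refine ContDiffAt.congr_of_eventuallyEq ?_ (ph_eventuallyEq c v hz)
  refine ContDiffAt.sum fun τ _ => ?_
  by_cases h : c τ = v
  · simpa [h] using contDiffAt_chi P τ hz
  · simpa [h] using contDiffAt_const

lemma ph_nonneg {P : ℕ} (c : ℤ × ℤ → Col) (v : Col) (z : ℂ) : 0 ≤ ph P c v z :=
  Finset.sum_nonneg fun τ _ => by split_ifs; exacts [chi_nonneg _ _ _, le_rfl]

lemma sum_ph {P : ℕ} [Fintype Col] (c : ℤ × ℤ → Col) (z : ℂ) : ∑ v, ph P c v z = 1 := by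
  unfold ph
  rw [Finset.sum_comm, ← sum_chi (P := P) z]
  exact Finset.sum_congr rfl fun τ _ => by simp

lemma ph_le_one {P : ℕ} (c : ℤ × ℤ → Col) (v : Col) (z : ℂ) : ph P c v z ≤ 1 := by
  rw [← sum_chi (P := P) z]
  exact Finset.sum_le_sum fun τ _ => by split_ifs; exacts [le_rfl, chi_nonneg _ _ _]

lemma exists_chi_ne_zero_of_ph {P : ℕ} {c : ℤ × ℤ → Col} {v : Col} {z : ℂ} (h : ph P c v z ≠ 0) :
    ∃ τ, c τ = v ∧ chi P τ z ≠ 0 := by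
  obtain ⟨τ, -, h⟩ := Finset.exists_ne_zero_of_sum_ne_zero h
  by_cases hc : c τ = v
  · exact ⟨τ, hc, by simpa [hc] using h⟩
  · simp [hc] at h

lemma ncard_ph_ne_zero {P : ℕ} (hP : GoodP P) (c : ℤ × ℤ → Col) (z : ℂ) :
    {v | ph P c v z ≠ 0}.Finite ∧ {v | ph P c v z ≠ 0}.ncard ≤ 3 := by
  obtain ⟨S, h3, hS⟩ := exists_three hP z
  have hsub : {v | ph P c v z ≠ 0} ⊆ (S.image c : Finset Col) := by
    intro v hv
    obtain ⟨τ, h1, h2⟩ := exists_chi_ne_zero_of_ph hv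
    exact Finset.mem_coe.2 (Finset.mem_image.2 ⟨τ, hS τ h2, h1⟩)
  refine ⟨(Finset.finite_toSet _).subset hsub, ?_⟩
  calc _ ≤ ((S.image c : Finset Col) : Set Col).ncard := Set.ncard_le_ncard hsub (Finset.finite_toSet _)
    _ = (S.image c).card := Set.ncard_coe_finset _
    _ ≤ S.card := Finset.card_image_le
    _ ≤ 3 := h3

lemma ph_eq_of_notMem_Jmp {P : ℕ} {c : ℤ × ℤ → Col} {v : Col} {z : ℂ} (hz : z ∈ uhp) {τ : ℤ × ℤ}
    (hτ : τ ∉ Jmp P c) (h : chi P τ z ≠ 0) : ph P c v z = if c τ = v then 1 else 0 := by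
  have : ∀ τ' ∈ act P z, (if c τ' = v then chi P τ' z else 0) =
      (if c τ = v then 1 else 0) * chi P τ' z := by
    intro τ' _
    by_cases h0 : chi P τ' z = 0
    · simp [h0]
    · have : c τ' = c τ := by
        by_contra hne
        exact hτ ⟨τ', z, hz, h, h0, hne⟩
      rw [this, ite_mul, one_mul, zero_mul]
  rw [ph, Finset.sum_congr rfl this, ← Finset.mul_sum, sum_chi, mul_one]

lemma card_win_le (T : ℝ) : (win T).card ≤ 2 := by
  rw [win, Int.card_Icc]
  have m2 : T - 7 / 10 ≤ ⌈T - 7 / 10⌉ := Int.le_ceil _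
  have n2 : (⌊T + 7 / 10⌋ : ℝ) ≤ T + 7 / 10 := Int.floor_le _
  have : (⌊T + 7 / 10⌋ : ℝ) < ⌈T - 7 / 10⌉ + 2 := by linarith
  have : ⌊T + 7 / 10⌋ < ⌈T - 7 / 10⌉ + 2 := by exact_mod_cast this
  omega

lemma card_act_le (P : ℕ) (z : ℂ) : (act P z).card ≤ 4 := by
  refine (Finset.card_biUnion_le_card_mul _ _ 2 fun r _ => ?_).trans
    (by have := card_win_le (rowT P z); omega)
  exact Finset.card_image_le.trans (card_win_le _)

lemma isOpen_chi_ne_zero (P : ℕ) (τ : ℤ × ℤ) : IsOpen {z | z ∈ uhp ∧ chi P τ z ≠ 0} := by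
  have hc : ContinuousOn (chi P τ) uhp := fun z hz =>
    (contDiffAt_chi P τ (n := 1) hz).continuousAt.continuousWithinAt
  exact hc.isOpen_inter_preimage isOpen_uhp isOpen_ne

/-- The complex valued version of `ph`. -/
def phc (P : ℕ) (c : ℤ × ℤ → Col) (v : Col) (z : ℂ) : ℂ := ph P c v z

lemma contDiffAt_phc {P : ℕ} (c : ℤ × ℤ → Col) (v : Col) {n : ℕ∞} {z : ℂ} (hz : z ∈ uhp) :
    ContDiffAt ℝ n (phc P c v) z :=
  Complex.ofRealCLM.contDiff.contDiffAt.comp z (contDiffAt_ph c v hz)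

lemma norm_dbar_ofReal_le {f : ℂ → ℝ} {z : ℂ} {B : ℝ} (hf : DifferentiableAt ℝ f z)
    (h1 : |fderiv ℝ f z 1| ≤ B) (hI : |fderiv ℝ f z I| ≤ B) :
    ‖dbar (fun z => (f z : ℂ)) z‖ ≤ B := by
  have h : HasFDerivAt (fun z => (f z : ℂ)) (Complex.ofRealCLM.comp (fderiv ℝ f z)) z :=
    Complex.ofRealCLM.hasFDerivAt.comp z hf.hasFDerivAt
  rw [dbar, h.fderiv]
  simp only [ContinuousLinearMap.comp_apply, ofRealCLM_apply]
  rw [norm_div]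
  have := norm_add_le (((fderiv ℝ f z 1 : ℝ)) : ℂ) (I * (fderiv ℝ f z I : ℝ))
  rw [norm_mul, norm_I, one_mul, norm_real, norm_real] at this
  simp only [Real.norm_eq_abs] at this
  rw [div_le_iff₀ (by simp)]
  simp
  linarith

lemma exists_dbar_phc_bound {P : ℕ} (hP : GoodP P) : ∃ C : ℝ, 0 < C ∧
    ∀ (c : ℤ × ℤ → Col) (v : Col), ∀ z ∈ uhp, ‖dbar (phc P c v) z‖ ≤ C / z.im := by
  obtain ⟨C, hC, hb⟩ := exists_fderiv_chi_bound hP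
  refine ⟨4 * C, by positivity, fun c v z hz => ?_⟩
  have hy : 0 < z.im := hz
  have e : phc P c v =ᶠ[𝓝 z] fun z' =>
      ∑ τ ∈ act P z, if c τ = v then (chi P τ z' : ℂ) else 0 := by
    filter_upwards [ph_eventuallyEq (P := P) c v hz] with z' h
    rw [phc, h]
    push_cast
    exact Finset.sum_congr rfl fun τ _ => by split_ifs <;> simp
  have hd : ∀ τ, DifferentiableAt ℝ (fun z => (chi P τ z : ℂ)) z := fun τ =>
    Complex.ofRealCLM.differentiableAt.comp z
      ((contDiffAt_chi P τ (n := 1) hz).differentiableAt one_ne_zero)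
  rw [dbar_congr e, dbar_sum]
  · refine (norm_sum_le_of_le (act P z) (f := fun τ => dbar (fun z' => if c τ = v then (chi P τ z' : ℂ) else 0) z)
      (n := fun _ => C / z.im) fun τ _ => ?_).trans ?_
    · by_cases h : c τ = v
      · simp only [h, if_true]
        exact norm_dbar_ofReal_le ((contDiffAt_chi P τ (n := 1) hz).differentiableAt one_ne_zero)
          (hb τ z hz).1 (hb τ z hz).2
      · simp only [h, if_false, dbar_const, norm_zero]; positivity
    · rw [Finset.sum_const, nsmul_eq_mul, mul_div_assoc]
      gcongr
      exact_mod_cast card_act_le P z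
  · intro τ _
    by_cases h : c τ = v
    · simpa [h] using hd τ
    · simp [h]

lemma dbar_phc_eq_zero {P : ℕ} {c : ℤ × ℤ → Col} {v : Col} {z : ℂ} (hz : z ∈ uhp) {τ : ℤ × ℤ}
    (hτ : τ ∉ Jmp P c) (h : chi P τ z ≠ 0) : dbar (phc P c v) z = 0 := by
  have : phc P c v =ᶠ[𝓝 z] fun _ => (((if c τ = v then 1 else 0 : ℝ)) : ℂ) := by
    filter_upwards [(isOpen_chi_ne_zero P τ).mem_nhds ⟨hz, h⟩] with s hs
    rw [phc, ph_eq_of_notMem_Jmp hs.1 hτ hs.2]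
  rw [dbar_congr this, dbar_const]

end Coloring

/-- The right-hand sides for which the `∂̄`-equation can be solved with bounds. -/
def DTame (P : ℕ) (J : Set (ℤ × ℤ)) (L : ℝ) (D : ℂ → ℂ) : Prop :=
  ContDiffOn ℝ 1 D uhp ∧ (∀ z ∈ uhp, ‖D z‖ ≤ L / z.im) ∧
    ∀ τ ∉ J, ∀ z ∈ uhp, chi P τ z ≠ 0 → D z = 0

lemma mem_uhp_of_near {P : ℕ} (hP : GoodP P) {τ : ℤ × ℤ} {z : ℂ}
    (h : ‖z - bc P τ‖ ≤ bw P τ.1) : bw P τ.1 ≤ z.im ∧ z ∈ uhp ∧ ‖z - bc P τ‖ ≤ (bc P τ).im / 2 := by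
  have hw := bw_pos hP τ.1
  have h1 := bw_le hP τ.1
  have h2 := (abs_le.1 ((abs_im_le_norm (z - bc P τ)).trans h)).1
  have h3 : (bc P τ).im = bh P τ.1 := rfl
  rw [sub_im, h3] at h2
  refine ⟨by linarith, ?_, by rw [h3]; linarith⟩
  show 0 < z.im
  linarith

/-- The statement about Cauchy transforms for a given constant. -/
def CauchyConst (C : ℝ) : Prop := 1 ≤ C ∧ ∀ (g : ℂ → ℂ) (M : ℝ), ContDiff ℝ 1 g →
    (∀ s, 1 < ‖s‖ → g s = 0) → (∀ s, ‖g s‖ ≤ M) → ∃ (V : ℂ → ℂ) (c : ℕ → ℂ),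
      Differentiable ℝ V ∧ (∀ t, dbar V t = g t) ∧ (∀ t, ‖V t‖ ≤ C * M) ∧
      (∀ k, ‖c k‖ ≤ C * M) ∧
      ∀ t, 3 / 2 ≤ ‖t‖ → ∀ K : ℕ,
        ‖V t - ∑ k ∈ Finset.range K, c k * t⁻¹ ^ (k + 1)‖ ≤ C * M * (2 / 3 : ℝ) ^ K

lemma exists_brick_solution {C : ℝ} (hC : CauchyConst C) {P : ℕ} (hP : GoodP P)
    {J : Set (ℤ × ℤ)} {L γ : ℝ} (hL : 0 ≤ L) (hγ : 0 < γ) {D : ℂ → ℂ} (hD : DTame P J L D)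
    (τ : ℤ × ℤ) {G : ℂ → ℂ} (hG : DifferentiableOn ℂ G uhp)
    (hGγ : ∀ z, ‖z - bc P τ‖ ≤ (bc P τ).im / 2 → γ ≤ ‖G z‖) :
    ∃ (V : ℂ → ℂ) (c : ℕ → ℂ), Differentiable ℝ V ∧
      (∀ z ∈ uhp, dbar (fun z => V ((z - bc P τ) / bw P τ.1) * G z) z = chi P τ z * D z) ∧
      (∀ t, ‖V t‖ ≤ C * (L / γ)) ∧ (∀ k, ‖c k‖ ≤ C * (L / γ)) ∧
      ∀ t, 3 / 2 ≤ ‖t‖ → ∀ K : ℕ,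
        ‖V t - ∑ k ∈ Finset.range K, c k * t⁻¹ ^ (k + 1)‖ ≤ C * (L / γ) * (2 / 3 : ℝ) ^ K := by
  classical
  set ζ := bc P τ with hζ
  set w := bw P τ.1 with hw
  have hw0 : 0 < w := bw_pos hP τ.1
  have hwC : (w : ℂ) ≠ 0 := by exact_mod_cast hw0.ne'
  set g : ℂ → ℂ := fun t => if ‖t‖ < 1 then
    w * chi P τ (ζ + w * t) * D (ζ + w * t) / G (ζ + w * t) else 0 with hg
  have hdist : ∀ t : ℂ, ‖ζ + w * t - ζ‖ = w * ‖t‖ := fun t => by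
    rw [add_sub_cancel_left, norm_mul, norm_real, Real.norm_of_nonneg hw0.le]
  have hnear : ∀ t : ℂ, ‖t‖ < 1 → w ≤ (ζ + w * t).im ∧ ζ + w * t ∈ uhp ∧ γ ≤ ‖G (ζ + w * t)‖ := by
    intro t ht
    have h1 : ‖ζ + w * t - ζ‖ ≤ w := by rw [hdist]; nlinarith
    obtain ⟨a, b, c⟩ := mem_uhp_of_near hP h1
    exact ⟨a, b, hGγ _ c⟩
  have hgz : ∀ t : ℂ, 9 / 10 < ‖t‖ → g t = 0 := by
    intro t ht
    by_cases h1 : ‖t‖ < 1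
    · simp only [hg, h1, if_true]
      have : chi P τ (ζ + w * t) = 0 := by
        by_contra hne
        have := norm_sub_bc_le hP (hnear t h1).2.1 hne
        rw [← hζ, ← hw, hdist] at this
        nlinarith
      simp [this]
    · simp only [hg, h1, if_false]
  have hgs : ContDiff ℝ 1 g := by
    rw [contDiff_iff_contDiffAt]
    intro t
    by_cases h1 : ‖t‖ < 1
    · have he : g =ᶠ[𝓝 t] fun t => w * chi P τ (ζ + w * t) * D (ζ + w * t) / G (ζ + w * t) := by
        filter_upwards [(isOpen_lt continuous_norm continuous_const).mem_nhds h1] with s hs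
        exact if_pos hs
      refine ContDiffAt.congr_of_eventuallyEq ?_ he
      obtain ⟨-, h2, h3⟩ := hnear t h1
      have ha : ContDiffAt ℝ 1 (fun t : ℂ => ζ + w * t) t := by fun_prop
      have hc : ContDiffAt ℝ 1 (fun z => (chi P τ z : ℂ)) (ζ + w * t) :=
        Complex.ofRealCLM.contDiff.contDiffAt.comp _ (contDiffAt_chi P τ h2)
      have hd : ContDiffAt ℝ 1 D (ζ + w * t) := hD.1.contDiffAt (isOpen_uhp.mem_nhds h2)
      have hGs : ContDiffAt ℝ 1 G (ζ + w * t) :=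
        ((hG.contDiffOn isOpen_uhp).contDiffAt (isOpen_uhp.mem_nhds h2)).restrict_scalars ℝ
      have hG0 : G (ζ + w * t) ≠ 0 := norm_pos_iff.1 (hγ.trans_le h3)
      have := ((contDiffAt_const (c := (w : ℂ))).mul hc).mul hd |>.mul (hGs.inv hG0)
      exact (this.comp t ha)
    · have he : g =ᶠ[𝓝 t] fun _ => 0 := by
        have : 9 / 10 < ‖t‖ := by linarith [not_lt.1 h1]
        filter_upwards [(isOpen_lt continuous_const continuous_norm).mem_nhds this] with s hs
        exact hgz s hs
      exact contDiffAt_const.congr_of_eventuallyEq he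
  have hgb : ∀ t, ‖g t‖ ≤ L / γ := by
    intro t
    by_cases h1 : ‖t‖ < 1
    · simp only [hg, h1, if_true]
      obtain ⟨h2, h3, h4⟩ := hnear t h1
      have h5 := hD.2.1 _ h3
      rw [norm_div, norm_mul, norm_mul, norm_real, norm_real, Real.norm_of_nonneg hw0.le,
        Real.norm_of_nonneg (chi_nonneg _ _ _)]
      refine div_le_div₀ hL ?_ hγ h4
      calc w * chi P τ (ζ + w * t) * ‖D (ζ + w * t)‖ ≤ w * 1 * (L / (ζ + w * t).im) := by
            have := chi_le_one P τ (ζ + w * t)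
            have := chi_nonneg P τ (ζ + w * t)
            gcongr
        _ ≤ w * 1 * (L / w) := by gcongr
        _ = L := by field_simp
    · simp only [hg, h1, if_false, norm_zero]; positivity
  obtain ⟨V, c, hV, hVd, hVb, hc, hexp⟩ := hC.2 g (L / γ) hgs (fun s hs => hgz s (by linarith)) hgb
  refine ⟨V, c, hV, fun z hz => ?_, hVb, hc, hexp⟩
  have d1 : DifferentiableAt ℝ (fun z : ℂ => V ((z - ζ) / w)) z :=
    (hV _).comp z (by fun_prop)
  have d2 : DifferentiableAt ℂ G z := hG.differentiableAt (isOpen_uhp.mem_nhds hz)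
  rw [dbar_mul d1 (d2.restrictScalars ℝ), dbar_of_differentiableAt d2, dbar_comp_affine (hV _), hVd,
    mul_zero, zero_add]
  have e : ζ + w * ((z - ζ) / w) = z := by field_simp; ring
  by_cases h1 : ‖(z - ζ) / w‖ < 1
  · obtain ⟨-, -, h4⟩ := hnear _ h1
    rw [e] at h4
    have hG0 : G z ≠ 0 := norm_pos_iff.1 (hγ.trans_le h4)
    simp only [hg, h1, if_true, e]
    field_simp
  · have : chi P τ z = 0 := by
      by_contra hne
      have h2 := norm_sub_bc_le hP hz hne
      rw [← hζ, ← hw] at h2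
      refine h1 ?_
      rw [norm_div, norm_real, Real.norm_of_nonneg hw0.le, div_lt_one hw0]
      linarith
    rw [hgz _ (by linarith [not_lt.1 h1]), this]
    simp

lemma le_norm_bl_of_far {P : ℕ} (hP : GoodP P) {τ : ℤ × ℤ} {z : ℂ} (hz : z ∈ uhp)
    (h : 3 / 2 * bw P τ.1 ≤ ‖z - bc P τ‖) :
    3 / (3 + 4 * (P : ℝ)) ≤ ‖bl (bc P τ) z‖ := by
  have hw := bw_pos hP τ.1
  have hp := hP.pos
  have h1 := bh_le hP τ.1
  have hb := bh_pos P τ.1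
  have h0 : 0 < ‖z - (starRingEnd ℂ) (bc P τ)‖ :=
    norm_pos_iff.2 (sub_conj_ne_zero hz (bc_mem P τ))
  have h2 : ‖z - (starRingEnd ℂ) (bc P τ)‖ ≤ ‖z - bc P τ‖ + 2 * bh P τ.1 := by
    have e : z - (starRingEnd ℂ) (bc P τ) = (z - bc P τ) + ((2 * bh P τ.1 : ℝ) : ℂ) * I := by
      apply Complex.ext <;> simp [bc]; ring
    rw [e]
    refine (norm_add_le _ _).trans ?_
    rw [norm_mul, norm_I, mul_one, norm_real, Real.norm_of_nonneg (by positivity)]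
  rw [bl, norm_div, div_le_div_iff₀ (by positivity) h0]
  nlinarith

lemma exists_finite_dbar_solution {C : ℝ} (hC : CauchyConst C) {P : ℕ} (hP : GoodP P)
    {J : Set (ℤ × ℤ)} {L M : ℝ} (hL : 0 ≤ L) {D : ℂ → ℂ} (hD : DTame P J L D)
    (hJ : Carl (bc P) J M) (t : Finset (ℤ × ℤ)) (ht : (t : Set (ℤ × ℤ)) ⊆ J) :
    ∃ (u B : ℂ → ℂ) (H : ℕ → ℂ → ℂ),
      (∀ z ∈ uhp, ‖u z‖ ≤ C * (L / (Real.exp (-(3 * M)) / 2)) * (4 * Real.exp M)) ∧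
      (∀ z ∈ uhp, DifferentiableAt ℝ u z) ∧
      (∀ z ∈ uhp, dbar u z = ∑ τ ∈ t, chi P τ z * D z) ∧
      DifferentiableOn ℂ B uhp ∧ (∀ z ∈ uhp, ‖B z‖ ≤ 1) ∧
      (∀ z ∈ uhp, (∀ τ ∈ t, 3 / 2 * bw P τ.1 ≤ ‖z - bc P τ‖) →
        Real.exp (-(M / (3 / (3 + 4 * (P : ℝ))) ^ 2)) ≤ ‖B z‖) ∧
      ∀ K, DifferentiableOn ℂ (H K) uhp ∧
        (∀ z ∈ uhp, ‖H K z‖ ≤ K * (C * (L / (Real.exp (-(3 * M)) / 2)) * (4 * Real.exp M))) ∧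
        ∀ z ∈ uhp, (∀ τ ∈ t, 3 / 2 * bw P τ.1 ≤ ‖z - bc P τ‖) →
          ‖u z * B z ^ K - H K z‖ ≤
            C * (L / (Real.exp (-(3 * M)) / 2)) * (4 * Real.exp M) * (2 / 3 : ℝ) ^ K * ‖B z‖ ^ K := by
  set γ := Real.exp (-(3 * M)) / 2 with hγ
  have hγ0 : 0 < γ := by positivity
  have hZ : ∀ τ, 0 < (bc P τ).im := bc_mem P
  have hMt : ∀ z ∈ uhp, ∑ i ∈ t, cs z (bc P i) ≤ M := fun z hz => hJ z hz t ht
  set G := JG t (bc P) with hG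
  have hGd : ∀ τ ∈ t, DifferentiableOn ℂ (G τ) uhp := fun τ hτ =>
    differentiableOn_JG (fun i _ => hZ i) hτ
  have hex : ∀ τ, ∃ (V : ℂ → ℂ) (c : ℕ → ℂ), τ ∈ t → (Differentiable ℝ V ∧
      (∀ z ∈ uhp, dbar (fun z => V ((z - bc P τ) / bw P τ.1) * G τ z) z = chi P τ z * D z) ∧
      (∀ t, ‖V t‖ ≤ C * (L / γ)) ∧ (∀ k, ‖c k‖ ≤ C * (L / γ)) ∧
      ∀ t, 3 / 2 ≤ ‖t‖ → ∀ K : ℕ,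
        ‖V t - ∑ k ∈ Finset.range K, c k * t⁻¹ ^ (k + 1)‖ ≤ C * (L / γ) * (2 / 3 : ℝ) ^ K) := by
    intro τ
    by_cases hτ : τ ∈ t
    · obtain ⟨V, c, h⟩ := exists_brick_solution hC hP hL hγ0 hD τ (hGd τ hτ)
        (fun z hz => le_norm_JG hZ hMt hz)
      exact ⟨V, c, fun _ => h⟩
    · exact ⟨0, 0, fun h => absurd h hτ⟩
  choose V c hVc using hex
  have hC0 : 0 ≤ C := by linarith [hC.1]
  have hA0 : 0 ≤ C * (L / γ) := by positivity
  set A := C * (L / γ) with hA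
  have hGs : ∀ z ∈ uhp, ∑ n ∈ t, ‖G n z‖ ≤ 4 * Real.exp M := fun z hz => sum_norm_JG_le hZ hMt hz
  have hsumG : ∀ z ∈ uhp, ∀ F : ℤ × ℤ → ℂ, ∀ a, 0 ≤ a → (∀ τ ∈ t, ‖F τ‖ ≤ a * ‖G τ z‖) →
      ‖∑ τ ∈ t, F τ‖ ≤ a * (4 * Real.exp M) := by
    intro z hz F a ha hF
    refine (norm_sum_le_of_le t hF).trans ?_
    rw [← Finset.mul_sum]
    exact mul_le_mul_of_nonneg_left (hGs z hz) ha
  have hVd : ∀ τ ∈ t, ∀ z ∈ uhp,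
      DifferentiableAt ℝ (fun z => V τ ((z - bc P τ) / bw P τ.1) * G τ z) z := by
    intro τ hτ z hz
    refine DifferentiableAt.mul (((hVc τ hτ).1 _).comp z (by fun_prop)) ?_
    exact ((hGd τ hτ).differentiableAt (isOpen_uhp.mem_nhds hz)).restrictScalars ℝ
  classical
  set H : ℕ → ℂ → ℂ := fun K z => ∑ τ ∈ t, (∑ k ∈ Finset.range K, c τ k *
    ((∏ i ∈ t.erase τ, bl (bc P i) z) ^ K * bl (bc P τ) z ^ (K - (k + 1)) *
      (bw P τ.1 / (z - (starRingEnd ℂ) (bc P τ))) ^ (k + 1))) * G τ z with hH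
  refine ⟨fun z => ∑ τ ∈ t, V τ ((z - bc P τ) / bw P τ.1) * G τ z,
    fun z => ∏ τ ∈ t, bl (bc P τ) z, H, ?_, ?_, ?_, ?_, ?_, ?_, fun K => ⟨?_, ?_, ?_⟩⟩
  · intro z hz
    refine hsumG z hz _ _ hA0 fun τ hτ => ?_
    rw [norm_mul]
    exact mul_le_mul_of_nonneg_right ((hVc τ hτ).2.2.1 _) (norm_nonneg _)
  · intro z hz
    exact DifferentiableAt.fun_sum fun τ hτ => hVd τ hτ z hz
  · intro z hz
    rw [dbar_sum _ fun τ hτ => hVd τ hτ z hz]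
    exact Finset.sum_congr rfl fun τ hτ => (hVc τ hτ).2.1 z hz
  · exact DifferentiableOn.fun_finsetProd fun τ _ => differentiableOn_bl (hZ τ)
  · intro z hz
    exact norm_prod_bl_le_one (fun i _ => hZ i) hz
  · intro z hz hfar
    have hp := hP.pos
    exact exp_le_prod_norm_bl (fun i _ => hZ i) hz (hMt z hz) (by positivity)
      fun i hi => le_norm_bl_of_far hP hz (hfar i hi)
  · refine DifferentiableOn.fun_sum fun τ hτ => DifferentiableOn.mul
      (DifferentiableOn.fun_sum fun k _ => DifferentiableOn.const_mul ?_ _) (hGd τ hτ)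
    refine ((DifferentiableOn.fun_finsetProd fun i _ => differentiableOn_bl (hZ i)).pow K).mul
      ((differentiableOn_bl (hZ τ)).pow _) |>.mul (DifferentiableOn.pow ?_ _)
    refine DifferentiableOn.div (by fun_prop) (by fun_prop) fun z hz => sub_conj_ne_zero hz (hZ τ)
  · intro z hz
    rw [← mul_assoc]
    refine hsumG z hz _ _ (by positivity) fun τ hτ => ?_
    rw [norm_mul]
    refine mul_le_mul_of_nonneg_right ?_ (norm_nonneg _)
    refine (norm_sum_le_of_le (Finset.range K) (n := fun _ => A) fun k _ => ?_).trans (by simp)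
    have b1 : ‖(∏ i ∈ t.erase τ, bl (bc P i) z) ^ K‖ ≤ 1 := by
      rw [norm_pow]
      exact pow_le_one₀ (norm_nonneg _) (norm_prod_bl_le_one (fun i _ => hZ i) hz)
    have b2 : ‖bl (bc P τ) z ^ (K - (k + 1))‖ ≤ 1 := by
      rw [norm_pow]
      exact pow_le_one₀ (norm_nonneg _) (norm_bl_le_one hz (hZ τ))
    have b3 : ‖(bw P τ.1 / (z - (starRingEnd ℂ) (bc P τ))) ^ (k + 1)‖ ≤ 1 := by
      rw [norm_pow]
      refine pow_le_one₀ (norm_nonneg _) ?_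
      have hw := bw_pos hP τ.1
      rw [norm_div, norm_real, Real.norm_of_nonneg hw.le,
        div_le_one (norm_pos_iff.2 (sub_conj_ne_zero hz (hZ τ)))]
      refine le_trans ?_ ((le_abs_self _).trans (abs_im_le_norm _))
      have h1 := bw_le hP τ.1
      have h2 : 0 < z.im := hz
      have h3 : (bc P τ).im = bh P τ.1 := rfl
      rw [sub_im, conj_im, h3]
      linarith
    rw [norm_mul, norm_mul, norm_mul]
    calc ‖c τ k‖ * _ ≤ A * (1 * 1 * 1) := by
          gcongr
          exact (hVc τ hτ).2.2.2.1 k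
      _ = A := by ring
  · intro z hz hfar
    have e : (∑ τ ∈ t, V τ ((z - bc P τ) / bw P τ.1) * G τ z) * (∏ τ ∈ t, bl (bc P τ) z) ^ K - H K z =
        (∏ τ ∈ t, bl (bc P τ) z) ^ K * ∑ τ ∈ t, (V τ ((z - bc P τ) / bw P τ.1) -
          ∑ k ∈ Finset.range K, c τ k * ((z - bc P τ) / bw P τ.1)⁻¹ ^ (k + 1)) * G τ z := by
      rw [mul_comm, hH, Finset.mul_sum, Finset.mul_sum, ← Finset.sum_sub_distrib]
      refine Finset.sum_congr rfl fun τ hτ => ?_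
      have hw : (bw P τ.1 : ℂ) ≠ 0 := by exact_mod_cast (bw_pos hP τ.1).ne'
      have h1 : z - (starRingEnd ℂ) (bc P τ) ≠ 0 := sub_conj_ne_zero hz (hZ τ)
      have h2 : z - bc P τ ≠ 0 := by
        have := hfar τ hτ
        have := bw_pos hP τ.1
        exact norm_pos_iff.1 (by linarith)
      rw [sub_mul, mul_sub, ← mul_assoc, sub_right_inj]
      have h4 : ∑ k ∈ Finset.range K, c τ k *
          ((∏ i ∈ t.erase τ, bl (bc P i) z) ^ K * bl (bc P τ) z ^ (K - (k + 1)) *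
            (bw P τ.1 / (z - (starRingEnd ℂ) (bc P τ))) ^ (k + 1)) =
          (∏ τ ∈ t, bl (bc P τ) z) ^ K *
            ∑ k ∈ Finset.range K, c τ k * ((z - bc P τ) / bw P τ.1)⁻¹ ^ (k + 1) := by
        rw [Finset.mul_sum]
        refine Finset.sum_congr rfl fun k hk => ?_
        have h3 : (bw P τ.1 : ℂ) / (z - (starRingEnd ℂ) (bc P τ)) =
            bl (bc P τ) z * ((z - bc P τ) / bw P τ.1)⁻¹ := by
          unfold bl; field_simp
        have h5 : bl (bc P τ) z ^ K = bl (bc P τ) z ^ (K - (k + 1)) * bl (bc P τ) z ^ (k + 1) := by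
          rw [← pow_add, Nat.sub_add_cancel (Finset.mem_range.1 hk)]
        rw [h3, mul_pow, ← Finset.mul_prod_erase t _ hτ, mul_pow, h5]
        ring
      rw [h4]
      ring
    rw [e, norm_mul, norm_pow, mul_comm, mul_right_comm A]
    refine mul_le_mul_of_nonneg_right ?_ (by positivity)
    rw [mul_right_comm, mul_right_comm A]
    have := hsumG z hz (fun τ => (V τ ((z - bc P τ) / bw P τ.1) -
      ∑ k ∈ Finset.range K, c τ k * ((z - bc P τ) / bw P τ.1)⁻¹ ^ (k + 1)) * G τ z)
      (A * (2 / 3 : ℝ) ^ K) (by positivity) fun τ hτ => ?_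
    · exact this
    rw [norm_mul]
    refine mul_le_mul_of_nonneg_right ((hVc τ hτ).2.2.2.2 _ ?_ K) (norm_nonneg _)
    have hw := bw_pos hP τ.1
    rw [norm_div, norm_real, Real.norm_of_nonneg hw.le, le_div_iff₀ hw]
    exact hfar τ hτ

/-- Square boxes of indices. -/
def sqBox (N : ℕ) : Finset (ℤ × ℤ) := Finset.Icc (-(N : ℤ)) N ×ˢ Finset.Icc (-(N : ℤ)) N

lemma eventually_subset_sqBox (S : Finset (ℤ × ℤ)) : ∃ N0, ∀ N ≥ N0, S ⊆ sqBox N := by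
  refine ⟨S.sup fun p => p.1.natAbs + p.2.natAbs, fun N hN p hp => ?_⟩
  have := (Finset.le_sup (f := fun p : ℤ × ℤ => p.1.natAbs + p.2.natAbs) hp).trans hN
  simp only [sqBox, Finset.mem_product, Finset.mem_Icc]
  omega

lemma eventually_hyperfilter_ge (N0 : ℕ) :
    ∀ᶠ n in (Filter.hyperfilter ℕ : Filter ℕ), N0 ≤ n :=
  Nat.hyperfilter_le_atTop (Filter.eventually_ge_atTop N0)

theorem exists_dbar_solution {P : ℕ} (hP : GoodP P) {L : ℝ} (hL : 0 ≤ L) (M : ℝ) :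
    ∃ C c : ℝ, 0 < C ∧ 0 < c ∧ ∀ (J : Set (ℤ × ℤ)) (D : ℂ → ℂ), DTame P J L D →
      Carl (bc P) J M → ∃ (u B : ℂ → ℂ) (H : ℕ → ℂ → ℂ),
      (∀ z ∈ uhp, ‖u z‖ ≤ C) ∧ (∀ z ∈ uhp, DifferentiableAt ℝ u z) ∧
      (∀ z ∈ uhp, dbar u z = D z) ∧
      DifferentiableOn ℂ B uhp ∧ (∀ z ∈ uhp, ‖B z‖ ≤ 1) ∧
      (∀ z ∈ uhp, (∀ τ ∈ J, 3 / 2 * bw P τ.1 ≤ ‖z - bc P τ‖) → c ≤ ‖B z‖) ∧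
      ∀ K, DifferentiableOn ℂ (H K) uhp ∧ (∀ z ∈ uhp, ‖H K z‖ ≤ K * C) ∧
        ∀ z ∈ uhp, (∀ τ ∈ J, 3 / 2 * bw P τ.1 ≤ ‖z - bc P τ‖) →
          ‖u z * B z ^ K - H K z‖ ≤ C * (2 / 3 : ℝ) ^ K * ‖B z‖ ^ K := by
  classical
  obtain ⟨C0, hC0⟩ : ∃ C, CauchyConst C := exists_cauchy_transform
  have hC00 : 0 ≤ C0 := by linarith [hC0.1]
  set C1 := C0 * (L / (Real.exp (-(3 * M)) / 2)) * (4 * Real.exp M) with hC1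
  have hC10 : 0 ≤ C1 := by positivity
  set c := Real.exp (-(M / (3 / (3 + 4 * (P : ℝ))) ^ 2)) with hc
  refine ⟨C1 + 1, c, by positivity, Real.exp_pos _, fun J D hD hJ => ?_⟩
  have hex := fun N : ℕ => exists_finite_dbar_solution hC0 hP hL hD hJ ((sqBox N).filter (· ∈ J))
    (fun τ hτ => (Finset.mem_filter.1 (Finset.mem_coe.1 hτ)).2)
  choose u B H hu hud hudb hB hB1 hBc hH using hex
  simp only [← hC1, ← hc] at hu hBc hH
  have hmem : ∀ N, ∀ τ ∈ (sqBox N).filter (· ∈ J), τ ∈ J := fun N τ h => (Finset.mem_filter.1 h).2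
  have tu : ∀ z ∈ uhp, Filter.Tendsto (fun N => u N z) (Filter.hyperfilter ℕ)
      (𝓝 (ulim fun N => u N z)) := fun z hz =>
    tendsto_ulim (Filter.Eventually.of_forall fun N => hu N z hz)
  have tB : ∀ z ∈ uhp, Filter.Tendsto (fun N => B N z) (Filter.hyperfilter ℕ)
      (𝓝 (ulim fun N => B N z)) := fun z hz =>
    tendsto_ulim (Filter.Eventually.of_forall fun N => hB1 N z hz)
  have tH : ∀ K, ∀ z ∈ uhp, Filter.Tendsto (fun N => H N K z) (Filter.hyperfilter ℕ)
      (𝓝 (ulim fun N => H N K z)) := fun K z hz =>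
    tendsto_ulim (Filter.Eventually.of_forall fun N => (hH N K).2.1 z hz)
  have loc : ∀ z ∈ uhp, DifferentiableAt ℝ (fun z => ulim fun N => u N z) z ∧
      dbar (fun z => ulim fun N => u N z) z = D z := by
    intro z hz
    obtain ⟨N0, hN0⟩ := eventually_subset_sqBox (act P z)
    obtain ⟨r, hr, hball⟩ := Metric.mem_nhds_iff.1
      (Filter.Eventually.and (isOpen_uhp.mem_nhds hz) (eventually_chi P hz))
    have hdb : ∀ N ≥ N0, ∀ z' ∈ ball z r, dbar (u N) z' = D z' := by
      intro N hN z' hz'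
      obtain ⟨h1, h2, h3⟩ := hball hz'
      rw [hudb N z' h1, ← Finset.sum_mul]
      by_cases hD0 : D z' = 0
      · rw [hD0, mul_zero]
      have hJ' : ∀ τ, chi P τ z' ≠ 0 → τ ∈ J := fun τ h => by
        by_contra hn
        exact hD0 (hD.2.2 τ hn z' h1 h)
      have e : ∑ τ ∈ (sqBox N).filter (· ∈ J), (chi P τ z' : ℂ) = 1 := by
        have : ∑ τ ∈ (sqBox N).filter (· ∈ J), chi P τ z' = 1 := by
          rw [← h2, Finset.sum_subset (Finset.subset_union_left (s₂ := act P z)),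
            Finset.sum_subset (Finset.subset_union_right (s₁ := (sqBox N).filter (· ∈ J)) (s₂ := act P z))]
          · exact fun τ _ h => h3 τ h
          · intro τ hτ hn
            by_contra hne
            rcases Finset.mem_union.1 hτ with h | h
            · exact hn h
            · exact hn (Finset.mem_filter.2 ⟨hN0 N hN h, hJ' τ hne⟩)
        exact_mod_cast this
      rw [e, one_mul]
    have hzr : ball z r ∈ 𝓝 z := ball_mem_nhds z hr
    have hbu : ∀ s ∈ ball z r, s ∈ uhp := fun s hs => (hball hs).1
    have hhol : DifferentiableOn ℂ (fun s => ulim fun N => u N s - u N0 s) (ball z r) := by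
      refine differentiableOn_ulim isOpen_ball (M := C1 + C1) ?_
      refine (eventually_hyperfilter_ge N0).mono fun N hN => ⟨fun s hs => ?_, fun s hs => ?_⟩
      · refine (differentiableAt_of_dbar ((hud N s (hbu s hs)).sub (hud N0 s (hbu s hs))) ?_).differentiableWithinAt
        have := dbar_sub (hud N s (hbu s hs)) (hud N0 s (hbu s hs))
        rw [hdb N hN s hs, hdb N0 le_rfl s hs, sub_self] at this
        exact this
      · exact (norm_sub_le _ _).trans (add_le_add (hu N s (hbu s hs)) (hu N0 s (hbu s hs)))
    have heq : (fun s => ulim fun N => u N s) =ᶠ[𝓝 z]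
        fun s => (ulim fun N => u N s - u N0 s) + u N0 s := by
      filter_upwards [hzr] with s hs
      have t1 := (tu s (hbu s hs)).sub_const (u N0 s)
      have t2 : Filter.Tendsto (fun N => u N s - u N0 s) (Filter.hyperfilter ℕ)
          (𝓝 (ulim fun N => u N s - u N0 s)) :=
        tendsto_ulim (M := C1 + C1) (Filter.Eventually.of_forall fun N =>
          (norm_sub_le _ _).trans (add_le_add (hu N s (hbu s hs)) (hu N0 s (hbu s hs))))
      rw [tendsto_nhds_unique t2 t1]
      ring
    have hda := hhol.differentiableAt hzr
    constructor
    · exact ((hda.restrictScalars ℝ).add (hud N0 z hz)).congr_of_eventuallyEq heq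
    · rw [dbar_congr heq, dbar_add (hda.restrictScalars ℝ) (hud N0 z hz), dbar_of_differentiableAt hda,
        zero_add, hdb N0 le_rfl z (mem_ball_self hr)]
  refine ⟨fun z => ulim fun N => u N z, fun z => ulim fun N => B N z,
    fun K z => ulim fun N => H N K z, fun z hz => ?_, fun z hz => (loc z hz).1,
    fun z hz => (loc z hz).2, ?_, fun z hz => ?_, fun z hz hfar => ?_, fun K => ⟨?_, ?_, ?_⟩⟩
  · exact (norm_ulim_le (Filter.Eventually.of_forall fun N => hu N z hz)).trans (by linarith)
  · exact differentiableOn_ulim isOpen_uhp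
      (Filter.Eventually.of_forall fun N => ⟨hB N, fun z hz => hB1 N z hz⟩)
  · exact norm_ulim_le (Filter.Eventually.of_forall fun N => hB1 N z hz)
  · exact ge_of_tendsto (tB z hz).norm (Filter.Eventually.of_forall fun N =>
      hBc N z hz fun τ hτ => hfar τ (hmem N τ hτ))
  · exact differentiableOn_ulim isOpen_uhp
      (Filter.Eventually.of_forall fun N => ⟨(hH N K).1, (hH N K).2.1⟩)
  · intro z hz
    refine (norm_ulim_le (Filter.Eventually.of_forall fun N => (hH N K).2.1 z hz)).trans ?_
    gcongr
    linarith
  · intro z hz hfar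
    have h1 : ‖(ulim fun N => u N z) * (ulim fun N => B N z) ^ K - ulim fun N => H N K z‖ ≤
        C1 * (2 / 3 : ℝ) ^ K * ‖ulim fun N => B N z‖ ^ K := by
      refine le_of_tendsto_of_tendsto (((tu z hz).mul ((tB z hz).pow K)).sub (tH K z hz)).norm
        (((tB z hz).norm.pow K).const_mul _) (Filter.Eventually.of_forall fun N => ?_)
      exact (hH N K).2.2 z hz fun τ hτ => hfar τ (hmem N τ hτ)
    refine h1.trans ?_
    gcongr
    linarith

section Martingale

/-- The greedy discretization of a dyadic martingale. -/
def colr (M : ℕ → ℤ → ℂ) (rd : ℂ → ℂ) (ε : ℝ) : ℕ → ℤ → ℂ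
  | 0, κ => rd (M 0 κ)
  | n + 1, κ => open Classical in
      if ‖M (n + 1) κ - colr M rd ε n (κ / 2)‖ ≤ ε then colr M rd ε n (κ / 2) else rd (M (n + 1) κ)

/-- The boxes where the discretization changes. -/
def stp (M : ℕ → ℤ → ℂ) (rd : ℂ → ℂ) (ε : ℝ) : ℕ → ℤ → Prop
  | 0, _ => True
  | n + 1, κ => ε < ‖M (n + 1) κ - colr M rd ε n (κ / 2)‖

/-- The boxes on the left (`par = 0`) or right (`par = 1`) edge of a stopping box. -/
def sid (s : ℕ → ℤ → Prop) (par : ℤ) : ℕ → ℤ → Prop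
  | 0, κ => s 0 κ
  | n + 1, κ => s (n + 1) κ ∨ (κ % 2 = par ∧ sid s par n (κ / 2))

open Classical in
/-- The weighted number of descendants in `S` up to depth `D`. -/
def WN (S : ℕ → ℤ → Prop) : ℕ → ℕ → ℤ → ℝ
  | 0, _, _ => 0
  | D + 1, n, κ => (((if S (n + 1) (2 * κ) then 1 else 0) + WN S D (n + 1) (2 * κ)) +
      ((if S (n + 1) (2 * κ + 1) then 1 else 0) + WN S D (n + 1) (2 * κ + 1))) / 2

lemma WN_or_le (S T : ℕ → ℤ → Prop) (D n : ℕ) (κ : ℤ) :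
    WN (fun n κ => S n κ ∨ T n κ) D n κ ≤ WN S D n κ + WN T D n κ := by
  classical
  induction D generalizing n κ with
  | zero => simp [WN]
  | succ D ih =>
    have key : ∀ p q : Prop, ∀ [Decidable p] [Decidable q] [Decidable (p ∨ q)],
        (if p ∨ q then (1 : ℝ) else 0) ≤ (if p then 1 else 0) + (if q then 1 else 0) := by
      intro p q _ _ _
      by_cases hp : p <;> by_cases hq : q <;> simp [hp, hq]
    rw [WN, WN, WN]
    have h1 := ih (n + 1) (2 * κ)
    have h2 := ih (n + 1) (2 * κ + 1)
    have k1 := @key (S (n + 1) (2 * κ)) (T (n + 1) (2 * κ)) (Classical.propDecidable _)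
      (Classical.propDecidable _) (Classical.propDecidable _)
    have k2 := @key (S (n + 1) (2 * κ + 1)) (T (n + 1) (2 * κ + 1)) (Classical.propDecidable _)
      (Classical.propDecidable _) (Classical.propDecidable _)
    linarith

lemma WN_sid_le (s : ℕ → ℤ → Prop) {par : ℤ} (hpar : par = 0 ∨ par = 1) (D n : ℕ) (κ : ℤ) :
    WN (sid s par) D n κ ≤ 1 + 2 * WN s D n κ := by
  classical
  suffices h : WN (sid s par) D n κ ≤ (if sid s par n κ then 1 else 0) + 2 * WN s D n κ by
    split_ifs at h <;> linarith
  induction D generalizing n κ with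
  | zero => simp only [WN]; split_ifs <;> norm_num
  | succ D ih =>
    rw [WN, WN]
    have h1 := ih (n + 1) (2 * κ)
    have h2 := ih (n + 1) (2 * κ + 1)
    have e1 : sid s par (n + 1) (2 * κ) ↔ s (n + 1) (2 * κ) ∨ (0 = par ∧ sid s par n κ) := by
      rw [sid, show (2 * κ) % 2 = 0 by omega, show 2 * κ / 2 = κ by omega]
    have e2 : sid s par (n + 1) (2 * κ + 1) ↔ s (n + 1) (2 * κ + 1) ∨ (1 = par ∧ sid s par n κ) := by
      rw [sid, show (2 * κ + 1) % 2 = 1 by omega, show (2 * κ + 1) / 2 = κ by omega]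
    simp only [e1, e2] at h1 h2 ⊢
    by_cases c : sid s par n κ <;> rcases hpar with rfl | rfl <;> by_cases a : s (n + 1) (2 * κ) <;>
      by_cases b : s (n + 1) (2 * κ + 1) <;>
      simp only [a, b, c, and_true, and_false, or_true, or_false, if_true, if_false,
        zero_ne_one, one_ne_zero, or_self] at h1 h2 ⊢ <;> linarith

variable {M : ℕ → ℤ → ℂ} {rd : ℂ → ℂ} {ε : ℝ}

lemma norm_sub_colr_le (hε : 0 ≤ ε) (hb : ∀ n κ, ‖M n κ‖ ≤ 1)
    (hrd : ∀ w, ‖w‖ ≤ 1 → ‖w - rd w‖ ≤ ε / 4) (n : ℕ) (κ : ℤ) :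
    ‖M n κ - colr M rd ε n κ‖ ≤ ε := by
  cases n with
  | zero => rw [colr]; exact (hrd _ (hb 0 κ)).trans (by linarith)
  | succ n =>
    rw [colr]
    split_ifs with h
    · exact h
    · exact (hrd _ (hb _ κ)).trans (by linarith)

lemma colr_mem {Gr : Finset ℂ} (h : ∀ w, rd w ∈ Gr) (n : ℕ) (κ : ℤ) : colr M rd ε n κ ∈ Gr := by
  induction n generalizing κ with
  | zero => exact h _
  | succ n ih =>
    rw [colr]
    split_ifs
    exacts [ih _, h _]

lemma colr_succ_of_not_stp {n : ℕ} {κ : ℤ} (h : ¬ stp M rd ε (n + 1) κ) :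
    colr M rd ε (n + 1) κ = colr M rd ε n (κ / 2) := by
  rw [colr, if_pos (not_lt.1 h)]

lemma colr_adjacent {n : ℕ} {κ : ℤ} (h : colr M rd ε n κ ≠ colr M rd ε n (κ + 1)) :
    sid (stp M rd ε) 1 n κ ∨ sid (stp M rd ε) 0 n (κ + 1) := by
  induction n generalizing κ with
  | zero => exact Or.inl trivial
  | succ n ih =>
    by_cases h1 : stp M rd ε (n + 1) κ
    · exact Or.inl (Or.inl h1)
    by_cases h2 : stp M rd ε (n + 1) (κ + 1)
    · exact Or.inr (Or.inl h2)
    rw [colr_succ_of_not_stp h1, colr_succ_of_not_stp h2] at h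
    rcases Int.emod_two_eq_zero_or_one κ with hk | hk
    · exact absurd rfl (by rwa [show (κ + 1) / 2 = κ / 2 by omega] at h)
    · rw [show (κ + 1) / 2 = κ / 2 + 1 by omega] at h
      rcases ih h with h | h
      · exact Or.inl (Or.inr ⟨hk, h⟩)
      · refine Or.inr (Or.inr ⟨by omega, ?_⟩)
        rwa [show (κ + 1) / 2 = κ / 2 + 1 by omega]

/-- The energy gained at a child box. -/
lemma energy_step (hε : 0 ≤ ε) (hb : ∀ n κ, ‖M n κ‖ ≤ 1)
    (hrd : ∀ w, ‖w‖ ≤ 1 → ‖w - rd w‖ ≤ ε / 4) (n : ℕ) (κ : ℤ) [Decidable (stp M rd ε (n + 1) κ)] :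
    ‖M (n + 1) κ‖ ^ 2 - ‖M (n + 1) κ - colr M rd ε n (κ / 2)‖ ^ 2 +
      15 / 16 * ε ^ 2 * (if stp M rd ε (n + 1) κ then 1 else 0) ≤
    ‖M (n + 1) κ‖ ^ 2 - ‖M (n + 1) κ - colr M rd ε (n + 1) κ‖ ^ 2 := by
  by_cases h : stp M rd ε (n + 1) κ
  · rw [if_pos h]
    have h1 : ε < ‖M (n + 1) κ - colr M rd ε n (κ / 2)‖ := h
    have h2 : ‖M (n + 1) κ - colr M rd ε (n + 1) κ‖ ≤ ε / 4 := by
      rw [colr, if_neg (not_le.2 h1)]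
      exact hrd _ (hb _ _)
    have h3 := norm_nonneg (M (n + 1) κ - colr M rd ε (n + 1) κ)
    nlinarith
  · rw [if_neg h, colr_succ_of_not_stp h]
    linarith

lemma norm_sq_sub_norm_sub_sq (a c : ℂ) :
    ‖a‖ ^ 2 - ‖a - c‖ ^ 2 = 2 * (a.re * c.re + a.im * c.im) - (c.re ^ 2 + c.im ^ 2) := by
  rw [Complex.sq_norm, Complex.sq_norm, normSq_apply, normSq_apply, sub_re, sub_im]
  ring

lemma WN_stp_le (hε : 0 ≤ ε) (hb : ∀ n κ, ‖M n κ‖ ≤ 1)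
    (hM : ∀ n κ, M n κ = (M (n + 1) (2 * κ) + M (n + 1) (2 * κ + 1)) / 2)
    (hrd : ∀ w, ‖w‖ ≤ 1 → ‖w - rd w‖ ≤ ε / 4) (D n : ℕ) (κ : ℤ) :
    15 / 16 * ε ^ 2 * WN (stp M rd ε) D n κ ≤
      1 - (‖M n κ‖ ^ 2 - ‖M n κ - colr M rd ε n κ‖ ^ 2) := by
  classical
  induction D generalizing n κ with
  | zero =>
    have := hb n κ
    have := norm_nonneg (M n κ)
    rw [WN, mul_zero]
    nlinarith [sq_nonneg ‖M n κ - colr M rd ε n κ‖]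
  | succ D ih =>
    have h1 := ih (n + 1) (2 * κ)
    have h2 := ih (n + 1) (2 * κ + 1)
    have e1 := energy_step hε hb hrd n (2 * κ)
    have e2 := energy_step hε hb hrd n (2 * κ + 1)
    rw [show 2 * κ / 2 = κ by omega, norm_sq_sub_norm_sub_sq] at e1
    rw [show (2 * κ + 1) / 2 = κ by omega, norm_sq_sub_norm_sub_sq] at e2
    rw [WN, norm_sq_sub_norm_sub_sq]
    have r1 : (M n κ).re = ((M (n + 1) (2 * κ)).re + (M (n + 1) (2 * κ + 1)).re) / 2 := by
      rw [hM]; simp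
    have r2 : (M n κ).im = ((M (n + 1) (2 * κ)).im + (M (n + 1) (2 * κ + 1)).im) / 2 := by
      rw [hM]; simp
    rw [r1, r2]
    linarith

lemma WN_side_le (hε : 0 < ε) (hb : ∀ n κ, ‖M n κ‖ ≤ 1)
    (hM : ∀ n κ, M n κ = (M (n + 1) (2 * κ) + M (n + 1) (2 * κ + 1)) / 2)
    (hrd : ∀ w, ‖w‖ ≤ 1 → ‖w - rd w‖ ≤ ε / 4) (D n : ℕ) (κ : ℤ) :
    WN (fun n κ => sid (stp M rd ε) 0 n κ ∨ sid (stp M rd ε) 1 n κ) D n κ ≤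
      2 + 4 * ((1 + ε ^ 2) / (15 / 16 * ε ^ 2)) := by
  have h1 := WN_or_le (sid (stp M rd ε) 0) (sid (stp M rd ε) 1) D n κ
  have h2 := WN_sid_le (stp M rd ε) (par := 0) (Or.inl rfl) D n κ
  have h3 := WN_sid_le (stp M rd ε) (par := 1) (Or.inr rfl) D n κ
  have h4 := WN_stp_le hε.le hb hM hrd D n κ
  have h5 := norm_sub_colr_le hε.le hb hrd n κ
  have h6 : WN (stp M rd ε) D n κ ≤ (1 + ε ^ 2) / (15 / 16 * ε ^ 2) := by
    rw [le_div_iff₀ (by positivity), mul_comm]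
    have := norm_nonneg (M n κ - colr M rd ε n κ)
    nlinarith [sq_nonneg ‖M n κ‖]
  linarith

end Martingale

/-- Uniform bound for sums of a Poisson type kernel over the integers. -/
lemma exists_sum_kernel_le : ∃ C : ℝ, 0 < C ∧ ∀ (a : ℝ) (s : Finset ℤ),
    ∑ k ∈ s, 1 / (1 + (a - k) ^ 2) ≤ C := by
  have hs : Summable fun k : ℤ => 1 / (1 + (k : ℝ) ^ 2) := by
    have h1 : Summable fun k : ℤ => 1 / (k : ℝ) ^ 2 :=
      Real.summable_one_div_int_pow.2 (by norm_num)
    have h2 : Summable fun k : ℤ => if k = 0 then (1 : ℝ) else 0 :=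
      summable_of_ne_finset_zero (s := {0}) fun k hk => if_neg (by simpa using hk)
    refine Summable.of_nonneg_of_le (fun k => by positivity) (fun k => ?_) (h1.add h2)
    by_cases hk : k = 0
    · simp [hk]
    · have : (0 : ℝ) < (k : ℝ) ^ 2 := by positivity
      rw [if_neg hk, add_zero]
      exact one_div_le_one_div_of_le this (by linarith)
  have hpos : 0 ≤ ∑' k : ℤ, 1 / (1 + (k : ℝ) ^ 2) := tsum_nonneg fun k => by positivity
  refine ⟨3 * (∑' k : ℤ, 1 / (1 + (k : ℝ) ^ 2)) + 1, by linarith, fun a s => ?_⟩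
  have h1 : ∑ k ∈ s, 1 / (1 + (a - k) ^ 2) ≤
      ∑ k ∈ s, 3 * (1 / (1 + (((k - ⌊a⌋ : ℤ) : ℝ)) ^ 2)) := by
    refine Finset.sum_le_sum fun k _ => ?_
    have h3 : (0 : ℝ) < 1 + (a - k) ^ 2 := by positivity
    have h4 : (0 : ℝ) < 1 + (((k - ⌊a⌋ : ℤ) : ℝ)) ^ 2 := by positivity
    rw [mul_one_div, div_le_div_iff₀ h3 h4]
    push_cast
    have h5 := Int.floor_le a
    have h6 := Int.lt_floor_add_one a
    nlinarith [sq_nonneg ((a - k) - (a - ⌊a⌋) + 2 * (a - k)), sq_nonneg (2 * (a - k) + (a - ⌊a⌋))]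
  have h2 : ∑ k ∈ s, (1 / (1 + (((k - ⌊a⌋ : ℤ) : ℝ)) ^ 2)) ≤ ∑' k : ℤ, 1 / (1 + (k : ℝ) ^ 2) := by
    have := hs.sum_le_tsum (s.image fun k => k - ⌊a⌋) fun k _ => by positivity
    rwa [Finset.sum_image fun x _ y _ h => by simpa using h] at this
  rw [← Finset.mul_sum] at h1
  linarith

/-- The sum of the weights of the descendants in `S`. -/
lemma sum_desc_le (S : ℕ → ℤ → Prop) (D n : ℕ) (κ : ℤ) (t : Finset (ℕ × ℤ))
    (ht : ∀ q ∈ t, S q.1 q.2 ∧ n ≤ q.1 ∧ q.1 ≤ n + D ∧ q.2 / 2 ^ (q.1 - n) = κ) :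
    ∑ q ∈ t, (1 / 2 : ℝ) ^ (q.1 - n) ≤ 1 + WN S D n κ := by
  classical
  suffices h : ∑ q ∈ t, (1 / 2 : ℝ) ^ (q.1 - n) ≤ (if S n κ then 1 else 0) + WN S D n κ by
    split_ifs at h <;> linarith
  have self : ∀ (n : ℕ) (κ : ℤ) (t : Finset (ℕ × ℤ)), (∀ q ∈ t, S q.1 q.2 ∧ q.1 = n ∧
      q.2 / 2 ^ (q.1 - n) = κ) → ∑ q ∈ t, (1 / 2 : ℝ) ^ (q.1 - n) ≤ if S n κ then 1 else 0 := by
    intro n κ t ht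
    have hsub : t ⊆ {(n, κ)} := fun q hq => by
      obtain ⟨-, h1, h2⟩ := ht q hq
      rw [h1] at h2
      simp at h2
      simp [Prod.ext_iff, h1, h2]
    rcases Finset.subset_singleton_iff.1 hsub with h | h
    · rw [h, Finset.sum_empty]; split_ifs <;> norm_num
    · have h1 := (ht (n, κ) (by rw [h]; simp)).1
      rw [h, if_pos h1]
      simp
  induction D generalizing n κ t with
  | zero =>
    rw [WN, add_zero]
    exact self n κ t fun q hq => by
      obtain ⟨h1, h2, h3, h4⟩ := ht q hq
      exact ⟨h1, by omega, h4⟩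
  | succ D ih =>
    have e1 := Finset.sum_filter_add_sum_filter_not t (fun q => q.1 = n)
      (fun q => (1 / 2 : ℝ) ^ (q.1 - n))
    have e2 := Finset.sum_filter_add_sum_filter_not (t.filter fun q => ¬ q.1 = n)
      (fun q => q.2 / 2 ^ (q.1 - (n + 1)) = 2 * κ) (fun q => (1 / 2 : ℝ) ^ (q.1 - n))
    have k0 := self n κ (t.filter fun q => q.1 = n) fun q hq => by
      obtain ⟨h0, h0'⟩ := Finset.mem_filter.1 hq
      obtain ⟨h1, h2, h3, h4⟩ := ht q h0
      exact ⟨h1, h0', h4⟩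
    have halve : ∀ u : Finset (ℕ × ℤ), (∀ q ∈ u, n + 1 ≤ q.1) →
        ∑ q ∈ u, (1 / 2 : ℝ) ^ (q.1 - n) = (∑ q ∈ u, (1 / 2 : ℝ) ^ (q.1 - (n + 1))) / 2 := by
      intro u hu
      rw [Finset.sum_div]
      refine Finset.sum_congr rfl fun q hq => ?_
      have := hu q hq
      rw [show q.1 - n = (q.1 - (n + 1)) + 1 by omega, pow_succ]
      ring
    have par : ∀ q ∈ t, ¬ q.1 = n → (q.2 / 2 ^ (q.1 - (n + 1))) / 2 = κ := by
      intro q hq hn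
      obtain ⟨h1, h2, h3, h4⟩ := ht q hq
      rw [← h4, show q.1 - n = (q.1 - (n + 1)) + 1 by omega, pow_succ,
        Int.ediv_ediv_of_nonneg (by positivity)]
    have k1 := ih (n + 1) (2 * κ) ((t.filter fun q => ¬ q.1 = n).filter
        fun q => q.2 / 2 ^ (q.1 - (n + 1)) = 2 * κ) fun q hq => by
      simp only [Finset.mem_filter] at hq
      obtain ⟨h1, h2, h3, h4⟩ := ht q hq.1.1
      exact ⟨h1, by omega, by omega, hq.2⟩
    have k2 := ih (n + 1) (2 * κ + 1) ((t.filter fun q => ¬ q.1 = n).filter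
        fun q => ¬ q.2 / 2 ^ (q.1 - (n + 1)) = 2 * κ) fun q hq => by
      simp only [Finset.mem_filter] at hq
      obtain ⟨h1, h2, h3, h4⟩ := ht q hq.1.1
      have := par q hq.1.1 hq.1.2
      exact ⟨h1, by omega, by omega, by omega⟩
    rw [halve _ fun q hq => by
      simp only [Finset.mem_filter] at hq
      have := (ht q hq.1.1).2.1
      omega, halve _ fun q hq => by
      simp only [Finset.mem_filter] at hq
      have := (ht q hq.1.1).2.1
      omega] at e2
    rw [WN]
    linarith

/-- The distinguished point of a dyadic box. -/
def bx (L : ℝ) (q : ℕ × ℤ) : ℂ := ⟨(q.2 + 1 / 2) * (L / 2 ^ q.1), L / 2 ^ q.1⟩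

lemma exists_sum_cs_bx_le : ∃ C : ℝ, 0 < C ∧ ∀ (S : ℕ → ℤ → Prop) (A L : ℝ) (z : ℂ)
    (t : Finset (ℕ × ℤ)), (∀ D n κ, WN S D n κ ≤ A) → 0 < L → z ∈ uhp → z.im ≤ L →
    (∀ q ∈ t, S q.1 q.2) → ∑ q ∈ t, cs z (bx L q) ≤ C * (A + 1) := by
  classical
  obtain ⟨C, hC, hker⟩ := exists_sum_kernel_le
  refine ⟨24 * C, by positivity, fun S A L z t hA hL hz hzL ht => ?_⟩
  have hA0 : 0 ≤ A := by simpa [WN] using hA 0 0 0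
  have hy : 0 < z.im := hz
  have hex : ∃ n : ℕ, L / 2 ^ n ≤ z.im := by
    obtain ⟨n, hn⟩ := exists_nat_gt (L / z.im)
    refine ⟨n, ?_⟩
    rw [div_lt_iff₀ hy] at hn
    rw [div_le_iff₀ (by positivity)]
    have : (n : ℝ) ≤ 2 ^ n := by exact_mod_cast Nat.lt_two_pow_self.le
    nlinarith
  set n₀ := Nat.find hex
  have hn₀ : L / 2 ^ n₀ ≤ z.im := Nat.find_spec hex
  have hmin : ∀ n < n₀, z.im < L / 2 ^ n := fun n hn => not_le.1 (Nat.find_min hex hn)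
  have hcs : ∀ q, cs z (bx L q) = 4 * z.im * (L / 2 ^ q.1) /
      ((z.re - (q.2 + 1 / 2) * (L / 2 ^ q.1)) ^ 2 + (z.im + L / 2 ^ q.1) ^ 2) := by
    intro q; rw [cs, normSq_sub_conj]; rfl
  have hcs0 : ∀ q, 0 ≤ cs z (bx L q) := fun q => cs_nonneg hy (by change 0 < L / 2 ^ q.1; positivity)
  have e1 := Finset.sum_filter_add_sum_filter_not t (fun q => q.1 < n₀) (fun q => cs z (bx L q))
  have up : ∑ q ∈ t with q.1 < n₀, cs z (bx L q) ≤ 8 * C := by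
    have h1 : ∑ q ∈ t with q.1 < n₀, cs z (bx L q) ≤
        ∑ q ∈ Finset.range n₀ ×ˢ t.image Prod.snd, cs z (bx L q) := by
      refine Finset.sum_le_sum_of_subset_of_nonneg (fun q hq => ?_) fun q _ _ => hcs0 q
      obtain ⟨h2, h3⟩ := Finset.mem_filter.1 hq
      exact Finset.mem_product.2 ⟨Finset.mem_range.2 h3, Finset.mem_image_of_mem _ h2⟩
    rw [Finset.sum_product] at h1
    have h2 : ∀ n ∈ Finset.range n₀, ∑ κ ∈ t.image Prod.snd, cs z (bx L (n, κ)) ≤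
        4 * C * (1 / 2) ^ (n₀ - 1 - n) := by
      intro n hn
      have hn := Finset.mem_range.1 hn
      have hl : 0 < L / 2 ^ n := by positivity
      set l := L / 2 ^ n with hldef
      have h3 : ∀ κ ∈ t.image Prod.snd, cs z (bx L (n, κ)) ≤
          4 * (z.im / l) * (1 / (1 + ((z.re / l - 1 / 2) - κ) ^ 2)) := by
        intro κ _
        rw [hcs]
        simp only [← hldef]
        have : 4 * (z.im / l) * (1 / (1 + ((z.re / l - 1 / 2) - κ) ^ 2)) =
            4 * z.im * l / ((z.re - (κ + 1 / 2) * l) ^ 2 + l ^ 2) := by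
          field_simp
          ring
        rw [this]
        gcongr
        nlinarith
      refine (Finset.sum_le_sum h3).trans ?_
      rw [← Finset.mul_sum]
      have h4 : z.im / l ≤ (1 / 2) ^ (n₀ - 1 - n) := by
        rw [div_le_iff₀ hl]
        have h5 := (hmin (n₀ - 1) (by omega)).le
        refine h5.trans (le_of_eq ?_)
        obtain ⟨k, hk⟩ : ∃ k, n₀ - 1 = n + k := ⟨n₀ - 1 - n, by omega⟩
        rw [hldef, hk, Nat.add_sub_cancel_left, pow_add]
        field_simp
        rw [← mul_pow]; norm_num
      have := hker (z.re / l - 1 / 2) (t.image Prod.snd)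
      have h6 : 0 ≤ z.im / l := by positivity
      calc 4 * (z.im / l) * _ ≤ 4 * (z.im / l) * C := by gcongr
        _ ≤ 4 * (1 / 2) ^ (n₀ - 1 - n) * C := by gcongr
        _ = _ := by ring
    refine h1.trans ((Finset.sum_le_sum h2).trans ?_)
    rw [← Finset.mul_sum, Finset.sum_range_reflect (fun k => (1 / 2 : ℝ) ^ k) n₀]
    have := sum_geometric_two_le n₀
    nlinarith
  have down : ∑ q ∈ t with ¬ q.1 < n₀, cs z (bx L q) ≤ 16 * C * (A + 1) := by
    set u := t.filter fun q => ¬ q.1 < n₀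
    set anc : ℕ × ℤ → ℤ := fun q => q.2 / 2 ^ (q.1 - n₀)
    rw [← Finset.sum_fiberwise_of_maps_to (fun q hq => Finset.mem_image_of_mem anc hq)]
    have hH : 0 < L / 2 ^ n₀ := by positivity
    set H := L / 2 ^ n₀ with hHdef
    have h1 : ∀ κ ∈ u.image anc, ∑ q ∈ u with anc q = κ, cs z (bx L q) ≤
        16 * (A + 1) * (1 / (1 + ((z.re / H - 1 / 2) - κ) ^ 2)) := by
      intro κ _
      have h2 : ∀ q ∈ u.filter (fun q => anc q = κ), cs z (bx L q) ≤
          16 * (1 / (1 + ((z.re / H - 1 / 2) - κ) ^ 2)) * (1 / 2) ^ (q.1 - n₀) := by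
        intro q hq
        obtain ⟨hq, hanc⟩ := Finset.mem_filter.1 hq
        obtain ⟨hqt, hqn⟩ := Finset.mem_filter.1 hq
        obtain ⟨k, hk⟩ : ∃ k, q.1 = n₀ + k := ⟨q.1 - n₀, by omega⟩
        have hl : L / 2 ^ q.1 = H * (1 / 2) ^ k := by
          rw [hk, hHdef, pow_add, one_div_pow]; field_simp
        have hanc' : q.2 / 2 ^ k = κ := by rw [← hanc]; simp only [anc, hk, Nat.add_sub_cancel_left]
        have hb1 : (κ : ℝ) * 2 ^ k ≤ q.2 := by
          have := Int.ediv_mul_le q.2 (b := 2 ^ k) (by positivity)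
          rw [hanc'] at this
          exact_mod_cast this
        have hb2 : (q.2 : ℝ) + 1 ≤ (κ + 1) * 2 ^ k := by
          have := Int.lt_ediv_add_one_mul_self q.2 (b := 2 ^ k) (by positivity)
          rw [hanc'] at this
          exact_mod_cast this
        rw [hcs, hl, show q.1 - n₀ = k by omega]
        have he : (0 : ℝ) < (1 / 2) ^ k := by positivity
        have hee : (2 : ℝ) ^ k * (1 / 2) ^ k = 1 := by rw [← mul_pow]; norm_num
        set e : ℝ := (1 / 2) ^ k
        have hd1 : (κ : ℝ) * H ≤ (q.2 + 1 / 2) * (H * e) := by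
          have : (κ : ℝ) * 2 ^ k * (H * e) ≤ (q.2 + 1 / 2) * (H * e) := by gcongr; linarith
          calc (κ : ℝ) * H = κ * H * (2 ^ k * e) := by rw [hee, mul_one]
            _ = (κ : ℝ) * 2 ^ k * (H * e) := by ring
            _ ≤ _ := this
        have hd2 : (q.2 + 1 / 2) * (H * e) ≤ (κ + 1 : ℝ) * H := by
          have : (q.2 + 1 / 2) * (H * e) ≤ (κ + 1 : ℝ) * 2 ^ k * (H * e) := by gcongr; linarith
          calc _ ≤ (κ + 1 : ℝ) * 2 ^ k * (H * e) := this
            _ = (κ + 1 : ℝ) * H * (2 ^ k * e) := by ring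
            _ = _ := by rw [hee, mul_one]
        set p := (q.2 + 1 / 2) * (H * e)
        have h7 : 16 * (1 / (1 + ((z.re / H - 1 / 2) - κ) ^ 2)) * e =
            16 * H ^ 2 * e / (H ^ 2 + (z.re - (κ + 1 / 2) * H) ^ 2) := by
          field_simp
          ring
        rw [h7, div_le_div_iff₀ (by positivity) (by positivity)]
        have h8 : H ^ 2 + (z.re - (κ + 1 / 2) * H) ^ 2 ≤ 2 * ((z.re - p) ^ 2 + z.im ^ 2) := by
          have : (p - (κ + 1 / 2) * H) ^ 2 ≤ (H / 2) ^ 2 := sq_le_sq' (by linarith) (by linarith)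
          nlinarith [sq_nonneg ((z.re - p) - (p - (κ + 1 / 2) * H))]
        have h9 : z.im ≤ 2 * H ∨ n₀ = 0 := by
          rcases Nat.eq_zero_or_pos n₀ with h | h
          · exact Or.inr h
          · left
            have := hmin (n₀ - 1) (by omega)
            obtain ⟨m, hm⟩ : ∃ m, n₀ = m + 1 := ⟨n₀ - 1, by omega⟩
            rw [hHdef, hm, pow_succ]
            rw [hm, Nat.add_sub_cancel] at this
            have h10 : 2 * (L / (2 ^ m * 2)) = L / 2 ^ m := by field_simp
            linarith
        have h9' : z.im ≤ 2 * H := by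
          rcases h9 with h | h
          · exact h
          · rw [hHdef, h]; norm_num; linarith
        have h11 : (z.re - p) ^ 2 + z.im ^ 2 ≤ (z.re - p) ^ 2 + (z.im + H * e) ^ 2 := by
          have : 0 < H * e := by positivity
          nlinarith
        calc 4 * z.im * (H * e) * (H ^ 2 + (z.re - (κ + 1 / 2) * H) ^ 2)
            ≤ 4 * (2 * H) * (H * e) * (2 * ((z.re - p) ^ 2 + (z.im + H * e) ^ 2)) := by
              gcongr
              linarith
          _ = _ := by ring
      refine (Finset.sum_le_sum h2).trans ?_
      rw [← Finset.mul_sum]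
      have h3 := sum_desc_le S (u.sup Prod.fst) n₀ κ (u.filter fun q => anc q = κ) (fun q hq => by
        obtain ⟨hq, hanc⟩ := Finset.mem_filter.1 hq
        obtain ⟨hqt, hqn⟩ := Finset.mem_filter.1 hq
        have := Finset.le_sup (f := Prod.fst) hq
        exact ⟨ht q hqt, by omega, by omega, hanc⟩)
      have h4 := hA (u.sup Prod.fst) n₀ κ
      have h5 : 0 < 1 / (1 + ((z.re / H - 1 / 2) - κ) ^ 2) := by positivity
      calc _ ≤ 16 * (1 / (1 + ((z.re / H - 1 / 2) - κ) ^ 2)) * (1 + A) := by gcongr; linarith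
        _ = _ := by ring
    refine (Finset.sum_le_sum h1).trans ?_
    rw [← Finset.mul_sum]
    have := hker (z.re / H - 1 / 2) (u.image anc)
    calc _ ≤ 16 * (A + 1) * C := by gcongr
      _ = _ := by ring
  rw [← e1]
  nlinarith

lemma one_sub_bl {p z : ℂ} (hz : 0 < z.im) (hp : 0 < p.im) :
    (p - (starRingEnd ℂ) p * bl p z) / (1 - bl p z) = z := by
  have h1 := sub_conj_ne_zero hz hp
  have h2 := sub_conj_ne_zero hp hp
  have e1 : p - (starRingEnd ℂ) p * bl p z =
      z * (p - (starRingEnd ℂ) p) / (z - (starRingEnd ℂ) p) := by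
    unfold bl; field_simp; ring
  have e2 : 1 - bl p z = (p - (starRingEnd ℂ) p) / (z - (starRingEnd ℂ) p) := by
    unfold bl; field_simp; ring
  rw [e1, e2]
  field_simp

lemma norm_bl_lt_one {p z : ℂ} (hz : 0 < z.im) (hp : 0 < p.im) : ‖bl p z‖ < 1 := by
  have h1 := norm_bl_sq hz hp
  have h2 := cs_pos hz hp
  nlinarith [norm_nonneg (bl p z)]

lemma moebius_mem_uhp {p ζ : ℂ} (hp : 0 < p.im) (hζ : ‖ζ‖ < 1) :
    (p - (starRingEnd ℂ) p * ζ) / (1 - ζ) ∈ uhp := by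
  have h1 : 1 - ζ ≠ 0 := by
    intro h
    rw [← sub_eq_zero.1 h, norm_one] at hζ
    exact lt_irrefl _ hζ
  have h2 := normSq_pos.2 h1
  have h3 : ζ.re ^ 2 + ζ.im ^ 2 < 1 := by
    have := Complex.sq_norm ζ
    rw [normSq_apply] at this
    nlinarith [norm_nonneg ζ]
  change 0 < ((p - (starRingEnd ℂ) p * ζ) / (1 - ζ)).im
  have : ((p - (starRingEnd ℂ) p * ζ) / (1 - ζ)).im =
      p.im * (1 - (ζ.re ^ 2 + ζ.im ^ 2)) / normSq (1 - ζ) := by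
    rw [div_im]
    simp
    field_simp
    ring
  rw [this]
  have : 0 < 1 - (ζ.re ^ 2 + ζ.im ^ 2) := by linarith
  positivity

/-- The Schwarz–Pick lemma at a zero in the half-plane. -/
lemma norm_le_norm_bl {h : ℂ → ℂ} (hd : DifferentiableOn ℂ h uhp) (hb : ∀ z ∈ uhp, ‖h z‖ ≤ 1)
    {p z : ℂ} (hp : p ∈ uhp) (h0 : h p = 0) (hz : z ∈ uhp) : ‖h z‖ ≤ ‖bl p z‖ := by
  set φ : ℂ → ℂ := fun ζ => (p - (starRingEnd ℂ) p * ζ) / (1 - ζ)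
  have hm : ∀ ζ ∈ ball (0 : ℂ) 1, φ ζ ∈ uhp := fun ζ hζ =>
    moebius_mem_uhp hp (mem_ball_zero_iff.1 hζ)
  have hφ : DifferentiableOn ℂ φ (ball 0 1) := by
    intro ζ hζ
    have h1 : 1 - ζ ≠ 0 := by
      intro h
      rw [mem_ball_zero_iff, ← sub_eq_zero.1 h, norm_one] at hζ
      exact lt_irrefl _ hζ
    simp only [φ]
    fun_prop (disch := assumption)
  have := norm_le_norm_of_mapsTo_ball (f := h ∘ φ) (R := 1) (hd.comp hφ hm)
    (fun ζ hζ => mem_closedBall_zero_iff.2 (hb _ (hm ζ hζ))) (by simp [φ, h0])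
    (norm_bl_lt_one hz hp)
  rwa [Function.comp_apply, show φ (bl p z) = z from one_sub_bl hz hp] at this

/-- A bounded function is dominated by the Blaschke product of finitely many of its zeros. -/
lemma norm_le_prod_norm_bl {h : ℂ → ℂ} (hd : DifferentiableOn ℂ h uhp)
    (hb : ∀ z ∈ uhp, ‖h z‖ ≤ 1) (t : Finset ℂ) (ht : ∀ p ∈ t, p ∈ uhp ∧ h p = 0) {z : ℂ}
    (hz : z ∈ uhp) : ‖h z‖ ≤ ∏ p ∈ t, ‖bl p z‖ := by
  induction t using Finset.induction_on generalizing h z with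
  | empty => simpa using hb z hz
  | insert p t hpt ih =>
    obtain ⟨hp, h0⟩ := ht p (Finset.mem_insert_self _ _)
    set g : ℂ → ℂ := fun z => dslope h p z * (z - (starRingEnd ℂ) p)
    have hg : DifferentiableOn ℂ g uhp :=
      ((differentiableOn_dslope (isOpen_uhp.mem_nhds hp)).2 hd).mul (by fun_prop)
    have hgz : ∀ z ∈ uhp, z ≠ p → g z * bl p z = h z := by
      intro z hz hne
      have h1 := sub_conj_ne_zero hz hp
      have h2 := sub_ne_zero.2 hne
      simp only [g, bl]
      rw [dslope_of_ne _ hne, slope_def_field, h0]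
      field_simp
      ring
    have hg1 : ∀ z ∈ uhp, z ≠ p → ‖g z‖ ≤ 1 := by
      intro z hz hne
      have h1 := norm_le_norm_bl hd hb hp h0 hz
      rw [← hgz z hz hne, norm_mul] at h1
      have h2 : 0 < ‖bl p z‖ :=
        norm_pos_iff.2 (div_ne_zero (sub_ne_zero.2 hne) (sub_conj_ne_zero hz hp))
      exact le_of_mul_le_mul_right (by linarith) h2
    have hgp : ‖g p‖ ≤ 1 := by
      have hc : Filter.Tendsto g (𝓝[≠] p) (𝓝 (g p)) :=
        ((hg.differentiableAt (isOpen_uhp.mem_nhds hp)).continuousAt).tendsto.mono_left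
          nhdsWithin_le_nhds
      refine le_of_tendsto hc.norm ?_
      filter_upwards [nhdsWithin_le_nhds (isOpen_uhp.mem_nhds hp), self_mem_nhdsWithin] with w hw hne
      exact hg1 w hw hne
    have hgb : ∀ z ∈ uhp, ‖g z‖ ≤ 1 := fun z hz => by
      rcases eq_or_ne z p with rfl | hne
      exacts [hgp, hg1 z hz hne]
    rw [Finset.prod_insert hpt]
    rcases eq_or_ne z p with rfl | hne
    · rw [h0, norm_zero]; positivity
    · rw [← hgz z hz hne, norm_mul, mul_comm]
      refine mul_le_mul_of_nonneg_left (ih hg hgb (fun q hq => ?_) hz) (norm_nonneg _)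
      obtain ⟨hq1, hq2⟩ := ht q (Finset.mem_insert_of_mem hq)
      refine ⟨hq1, ?_⟩
      have hne : q ≠ p := fun h => hpt (h ▸ hq)
      have := hgz q hq1 hne
      rw [hq2] at this
      exact (mul_eq_zero.1 this).resolve_right
        (div_ne_zero (sub_ne_zero.2 hne) (sub_conj_ne_zero hq1 hp))

/-- Zeros of a bounded function satisfy a Carleson type bound. -/
lemma sum_cs_zeros_le {h : ℂ → ℂ} (hd : DifferentiableOn ℂ h uhp)
    (hb : ∀ z ∈ uhp, ‖h z‖ ≤ 1) (t : Finset ℂ) (ht : ∀ p ∈ t, p ∈ uhp ∧ h p = 0) {z : ℂ}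
    (hz : z ∈ uhp) {δ : ℝ} (hδ : 0 < δ) (hzδ : δ ≤ ‖h z‖) :
    ∑ p ∈ t, cs z p ≤ -2 * Real.log δ := by
  have h1 := hzδ.trans (norm_le_prod_norm_bl hd hb t ht hz)
  have h2 : δ ^ 2 ≤ Real.exp (-∑ p ∈ t, cs z p) := by
    calc δ ^ 2 ≤ (∏ p ∈ t, ‖bl p z‖) ^ 2 := by gcongr
      _ = ∏ p ∈ t, (1 - cs z p) := by
        rw [← Finset.prod_pow]
        exact Finset.prod_congr rfl fun p hp => norm_bl_sq hz (ht p hp).1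
      _ ≤ ∏ p ∈ t, Real.exp (-cs z p) := by
        refine Finset.prod_le_prod (fun p hp => ?_) fun p hp => ?_
        · linarith [cs_le_one hz (ht p hp).1]
        · linarith [Real.add_one_le_exp (-cs z p)]
      _ = _ := by rw [← Real.exp_sum, Finset.sum_neg_distrib]
  have h3 := Real.log_le_log (by positivity) h2
  rw [Real.log_exp, Real.log_pow] at h3
  push_cast at h3
  linarith

/-- A Landau type covering theorem. -/
lemma ball_subset_image_of_le_deriv {f : ℂ → ℂ} {s : ℂ} {R ε : ℝ} (hR : 0 < R)
    (hd : DifferentiableOn ℂ f (ball s R)) (hb : ∀ z ∈ ball s R, ‖f z‖ ≤ 1) (hε : 0 < ε)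
    (h : ε ≤ R * ‖deriv f s‖) :
    ball (f s) (ε ^ 2 / 48) ⊆ f '' closedBall s (R / 2) := by
  have hs : s ∈ ball s R := mem_ball_self hR
  have hmaps : MapsTo f (ball s R) (closedBall (f s) 2) := fun z hz => by
    rw [mem_closedBall, dist_eq_norm]
    linarith [norm_sub_le (f z) (f s), hb z hz, hb s hs]
  have hε2 : ε ≤ 2 := by
    have := norm_deriv_le_div_of_mapsTo_ball hd hmaps hR
    rw [le_div_iff₀ hR] at this
    linarith
  set g := dslope f s
  have hg : DifferentiableOn ℂ g (ball s R) :=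
    (differentiableOn_dslope (isOpen_ball.mem_nhds hs)).2 hd
  have hgb : ∀ w ∈ ball s R, ‖g w‖ ≤ 2 / R := fun w hw => norm_dslope_le_div_of_mapsTo_ball hd hmaps hw
  have hgs : g s = deriv f s := dslope_same f s
  set r := ε / 12 * R with hr
  have hr0 : 0 < r := by positivity
  have hrR : r ≤ R / 2 := by rw [hr]; nlinarith
  have hsub : closedBall s r ⊆ ball s R := closedBall_subset_ball (by linarith)
  have key := DiffContOnCl.ball_subset_image_closedBall (f := f) (z₀ := s) (r := r)
    (ε := ε ^ 2 / 24) ((hd.mono hsub).diffContOnCl_ball Subset.rfl) hr0 (fun z hz => by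
      have hzR : z ∈ ball s R := hsub (sphere_subset_closedBall hz)
      have h1 := dist_le_of_norm_le_ball hg hgb hzR
      rw [mem_sphere] at hz
      rw [hz, hgs, dist_eq_norm] at h1
      have hne : z ≠ s := by
        rintro rfl
        rw [dist_self] at hz
        linarith
      have h2 : f z - f s = (z - s) * g z := by
        rw [show g z = slope f s z from dslope_of_ne _ hne, slope_def_field,
          mul_div_cancel₀ _ (sub_ne_zero.2 hne)]
      rw [h2, norm_mul, ← dist_eq_norm, hz]
      have h3 : ‖deriv f s‖ ≤ ‖g z‖ + ‖g z - deriv f s‖ := by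
        have := norm_sub_le (g z) (g z - deriv f s)
        rwa [sub_sub_cancel] at this
      have h4 : 2 * (2 / R) / R * r = ε / (3 * R) := by rw [hr]; field_simp; norm_num
      rw [h4] at h1
      have h5 : ε / R ≤ ‖deriv f s‖ := by rw [div_le_iff₀ hR]; linarith
      have h6 : ε / R - ε / (3 * R) ≤ ‖g z‖ := by linarith
      calc ε ^ 2 / 24 ≤ r * (ε / R - ε / (3 * R)) := by
            have : r * (ε / R - ε / (3 * R)) = ε ^ 2 / 18 := by rw [hr]; field_simp; norm_num
            rw [this]; nlinarith [sq_nonneg ε]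
        _ ≤ r * ‖g z‖ := by gcongr) (by
      have hne : deriv f s ≠ 0 := by
        intro h0
        rw [h0, norm_zero, mul_zero] at h
        linarith
      have := (hd.differentiableAt (isOpen_ball.mem_nhds hs)).hasDerivAt.eventually_ne hne (c := f s)
      exact this.frequently.filter_mono nhdsWithin_le_nhds)
  rw [show ε ^ 2 / 24 / 2 = ε ^ 2 / 48 by ring] at key
  exact key.trans (image_mono (closedBall_subset_closedBall hrR))

lemma card_le_of_abs_sub_le {s : Finset ℤ} {a d : ℝ} (hd : 0 ≤ d) (h : ∀ k ∈ s, |(k : ℝ) - a| ≤ d) :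
    (s.card : ℝ) ≤ 2 * d + 1 := by
  have hsub : s ⊆ Finset.Icc ⌈a - d⌉ ⌊a + d⌋ := fun k hk => by
    have := abs_le.1 (h k hk)
    rw [Finset.mem_Icc, Int.ceil_le, Int.le_floor]
    constructor <;> linarith
  have h1 := Finset.card_le_card hsub
  rw [Int.card_Icc] at h1
  have h2 : ((⌊a + d⌋ + 1 - ⌈a - d⌉).toNat : ℝ) ≤ 2 * d + 1 := by
    rcases le_total 0 (⌊a + d⌋ + 1 - ⌈a - d⌉) with h | h
    · have h3 : (((⌊a + d⌋ + 1 - ⌈a - d⌉).toNat : ℤ) : ℝ) = ((⌊a + d⌋ + 1 - ⌈a - d⌉ : ℤ) : ℝ) := by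
        rw [Int.toNat_of_nonneg h]
      rw [Int.cast_natCast] at h3
      rw [h3]
      push_cast
      linarith [Int.floor_le (a + d), Int.le_ceil (a - d)]
    · rw [Int.toNat_of_nonpos h]
      push_cast
      linarith
  exact (by exact_mod_cast h1 : (s.card : ℝ) ≤ _).trans h2

lemma card_near_le {P : ℕ} (hP : GoodP P) {K : ℝ} (hK : 0 ≤ K) {q : ℂ} (hq : 0 < q.im)
    {t : Finset (ℤ × ℤ)} (ht : ∀ τ ∈ t, ‖bc P τ - q‖ ≤ K * (bc P τ).im ∧ ‖bc P τ - q‖ ≤ K * q.im) :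
    (t.card : ℝ) ≤ (2 * (K * P) + 1) * (2 * (P * Real.log (1 + K) / Real.log 2) + 1) := by
  classical
  have hp := hP.pos
  have hl2 : 0 < Real.log 2 := Real.log_pos (by norm_num)
  have hlK : 0 ≤ Real.log (1 + K) := Real.log_nonneg (by linarith)
  have h1 : ((t.image Prod.fst).card : ℝ) ≤ 2 * (P * Real.log (1 + K) / Real.log 2) + 1 := by
    refine card_le_of_abs_sub_le (a := -(P * Real.log q.im / Real.log 2)) (by positivity)
      fun r hr => ?_
    obtain ⟨τ, hτ, rfl⟩ := Finset.mem_image.1 hr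
    obtain ⟨ha, hb⟩ := ht τ hτ
    have him := (abs_le.1 ((abs_im_le_norm (bc P τ - q))))
    rw [sub_im] at him
    have hpos := bc_mem P τ
    have hlog : Real.log (bc P τ).im = -(τ.1 : ℝ) / P * Real.log 2 := by
      change Real.log (bh P τ.1) = _
      rw [bh, Real.log_rpow (by norm_num)]
    have l1 : Real.log (bc P τ).im ≤ Real.log (1 + K) + Real.log q.im := by
      rw [← Real.log_mul (by positivity) hq.ne']
      exact Real.log_le_log hpos (by linarith)
    have l2 : Real.log q.im ≤ Real.log (1 + K) + Real.log (bc P τ).im := by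
      rw [← Real.log_mul (by positivity) hpos.ne']
      exact Real.log_le_log hq (by linarith)
    rw [hlog] at l1 l2
    have e : (τ.1 : ℝ) - -(P * Real.log q.im / Real.log 2) =
        P * (Real.log q.im - -(τ.1 : ℝ) / P * Real.log 2) / Real.log 2 := by
      field_simp
      ring
    rw [e, abs_div, abs_mul, abs_of_pos hp, abs_of_pos hl2]
    gcongr
    rw [abs_le]
    constructor <;> linarith
  have h2 : ∀ r ∈ t.image Prod.fst, (t.filter fun τ => τ.1 = r).card ≤ ⌊2 * (K * P) + 1⌋₊ := by
    intro r _
    refine Nat.le_floor ?_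
    rw [← Finset.card_image_of_injOn (f := Prod.snd) (fun x hx y hy hxy => by
      rw [Finset.mem_coe, Finset.mem_filter] at hx hy
      exact Prod.ext (hx.2.trans hy.2.symm) hxy)]
    refine card_le_of_abs_sub_le (a := q.re / bw P r - bs r) (by positivity) fun k hk => ?_
    obtain ⟨τ, hτ, rfl⟩ := Finset.mem_image.1 hk
    obtain ⟨hτt, rfl⟩ := Finset.mem_filter.1 hτ
    have hw := bw_pos hP τ.1
    have hre := (abs_re_le_norm (bc P τ - q)).trans (ht τ hτt).1
    rw [sub_re] at hre
    have hh := bh_le hP τ.1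
    have e : (τ.2 : ℝ) - (q.re / bw P τ.1 - bs τ.1) = ((bc P τ).re - q.re) / bw P τ.1 := by
      change _ = ((τ.2 + bs τ.1) * bw P τ.1 - q.re) / bw P τ.1
      field_simp
      ring
    rw [e, abs_div, abs_of_pos hw, div_le_iff₀ hw]
    calc _ ≤ K * bh P τ.1 := hre
      _ ≤ K * (P * bw P τ.1) := by gcongr
      _ = _ := by ring
  have h3 := Finset.card_le_mul_card_image t _ h2
  have h4 : (⌊2 * (K * P) + 1⌋₊ : ℝ) ≤ 2 * (K * P) + 1 := Nat.floor_le (by positivity)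
  calc (t.card : ℝ) ≤ ⌊2 * (K * P) + 1⌋₊ * (t.image Prod.fst).card := by exact_mod_cast h3
    _ ≤ _ := by gcongr

lemma exists_sum_cs_le_of_near {P : ℕ} (hP : GoodP P) {K : ℝ} (hK : 0 ≤ K) : ∃ m : ℝ, 0 < m ∧
    ∀ (t : Finset (ℤ × ℤ)) (p : ℤ × ℤ → ℂ) (z : ℂ) (B : ℝ), z ∈ uhp →
    (∀ τ ∈ t, p τ ∈ uhp ∧ ‖bc P τ - p τ‖ ≤ K * (bc P τ).im ∧ ‖bc P τ - p τ‖ ≤ K * (p τ).im) →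
    ∑ q ∈ t.image p, cs z q ≤ B → ∑ τ ∈ t, cs z (bc P τ) ≤ m * B := by
  classical
  have hp := hP.pos
  have hl2 : 0 < Real.log 2 := Real.log_pos (by norm_num)
  have hlK : 0 ≤ Real.log (1 + K) := Real.log_nonneg (by linarith)
  set m := (2 * (K * P) + 1) * (2 * (P * Real.log (1 + K) / Real.log 2) + 1)
  have hm : 0 < m := by positivity
  refine ⟨(1 + K) ^ 3 * m, by positivity, fun t p z B hz ht hB => ?_⟩
  calc ∑ τ ∈ t, cs z (bc P τ) ≤ ∑ τ ∈ t, (1 + K) ^ 3 * cs z (p τ) :=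
        Finset.sum_le_sum fun τ hτ =>
          cs_le_mul hz (bc_mem P τ) (ht τ hτ).1 hK (ht τ hτ).2.2 (ht τ hτ).2.1
    _ = (1 + K) ^ 3 * ∑ q ∈ t.image p, ((t.filter fun τ => p τ = q).card : ℝ) * cs z q := by
        rw [← Finset.mul_sum, Finset.sum_comp (cs z) p]
        simp
    _ ≤ (1 + K) ^ 3 * ∑ q ∈ t.image p, m * cs z q := by
        gcongr with q hq
        · obtain ⟨τ, hτ, rfl⟩ := Finset.mem_image.1 hq
          exact cs_nonneg hz (ht τ hτ).1
        · obtain ⟨τ, hτ, rfl⟩ := Finset.mem_image.1 hq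
          refine card_near_le hP hK (ht τ hτ).1 fun τ' hτ' => ?_
          obtain ⟨h1, h2⟩ := Finset.mem_filter.1 hτ'
          rw [← h2]
          exact (ht τ' h1).2
    _ ≤ (1 + K) ^ 3 * (m * B) := by rw [← Finset.mul_sum]; gcongr
    _ = _ := by ring

lemma exists_sum_cs_le_of_deriv {P : ℕ} (hP : GoodP P) {K ε : ℝ} (hK : 0 ≤ K) (hε : 0 < ε) :
    ∃ M : ℝ, 0 < M ∧ ∀ f : ℂ → ℂ, DifferentiableOn ℂ f uhp → (∀ z ∈ uhp, ‖f z‖ ≤ 1) →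
    ∀ t : Finset (ℤ × ℤ), (∀ τ ∈ t, ∃ s ∈ uhp, ε ≤ s.im * ‖deriv f s‖ ∧
      ‖bc P τ - s‖ ≤ K * (bc P τ).im ∧ ‖bc P τ - s‖ ≤ K * s.im) →
    ∀ z ∈ uhp, ∑ τ ∈ t, cs z (bc P τ) ≤ M := by
  classical
  obtain ⟨m, hm, hnear⟩ := exists_sum_cs_le_of_near hP (K := 2 * K + 1) (by positivity)
  set κ := ε ^ 2 / 48 with hκ
  have hκ0 : 0 < κ := by positivity
  obtain ⟨T, -, hTf, hT⟩ := (isCompact_closedBall (0 : ℂ) 1).finite_cover_balls (half_pos hκ0)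
  set G : Finset ℂ := hTf.toFinset ∪ hTf.toFinset.image fun w => w + ((κ / 4 : ℝ) : ℂ)
  set δ : ℂ → ℝ := fun w => κ / 8 / (1 + ‖w‖)
  have hδ : ∀ w, 0 < δ w := fun w => by simp only [δ]; positivity
  refine ⟨(∑ w ∈ G, m * (2 * |Real.log (δ w)|)) + 1, by positivity,
    fun f hd hb t ht z hz => ?_⟩
  have key : ∀ τ ∈ t, ∃ p ∈ uhp, f p ∈ G ∧ κ / 8 ≤ ‖f z - f p‖ ∧
      ‖bc P τ - p‖ ≤ (2 * K + 1) * (bc P τ).im ∧ ‖bc P τ - p‖ ≤ (2 * K + 1) * p.im := by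
    intro τ hτ
    obtain ⟨s, hs, h1, h2, h3⟩ := ht τ hτ
    have hs0 : 0 < s.im := hs
    have hsub : ball s s.im ⊆ uhp := fun w hw => by
      have h4 := abs_lt.1 ((abs_im_le_norm (w - s)).trans_lt (mem_ball_iff_norm.1 hw))
      rw [sub_im] at h4
      change 0 < w.im
      linarith
    have himg := ball_subset_image_of_le_deriv hs0 (hd.mono hsub) (fun w hw => hb w (hsub hw)) hε h1
    obtain ⟨w, hwT, hw⟩ := mem_iUnion₂.1 (hT (mem_closedBall_zero_iff.2 (hb s hs)))
    rw [mem_ball, dist_comm, dist_eq_norm] at hw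
    have hnκ : ‖((κ / 4 : ℝ) : ℂ)‖ = κ / 4 := by
      rw [norm_real, Real.norm_of_nonneg (by positivity)]
    have hcase : ∃ w' ∈ G, w' ∈ ball (f s) κ ∧ κ / 8 ≤ ‖f z - w'‖ := by
      by_cases hc : κ / 8 ≤ ‖f z - w‖
      · refine ⟨w, Finset.mem_union_left _ (hTf.mem_toFinset.2 hwT), ?_, hc⟩
        rw [mem_ball, dist_eq_norm]; linarith
      · refine ⟨w + ((κ / 4 : ℝ) : ℂ), Finset.mem_union_right _
          (Finset.mem_image_of_mem _ (hTf.mem_toFinset.2 hwT)), ?_, ?_⟩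
        · rw [mem_ball, dist_eq_norm, add_sub_right_comm]
          have := norm_add_le (w - f s) ((κ / 4 : ℝ) : ℂ)
          linarith
        · rw [← sub_sub]
          have := norm_sub_le (f z - w) (f z - w - ((κ / 4 : ℝ) : ℂ))
          rw [sub_sub_cancel, hnκ] at this
          linarith [not_le.1 hc]
    obtain ⟨w', hw'G, hw'b, hw'z⟩ := hcase
    obtain ⟨p, hp, rfl⟩ := himg hw'b
    rw [mem_closedBall, dist_eq_norm] at hp
    have h4 := abs_le.1 ((abs_im_le_norm (p - s)).trans hp)
    rw [sub_im] at h4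
    have h5 : s.im / 2 ≤ p.im := by linarith
    have h6 : ‖bc P τ - p‖ ≤ ‖bc P τ - s‖ + s.im / 2 := by
      have := norm_sub_le_norm_sub_add_norm_sub (bc P τ) s p
      rw [norm_sub_rev s p] at this
      linarith
    have h7 := abs_le.1 ((abs_im_le_norm (bc P τ - s)).trans h2)
    rw [sub_im] at h7
    have h8 := bc_mem P τ
    refine ⟨p, (by change 0 < p.im; linarith), hw'G, hw'z, ?_, ?_⟩ <;> nlinarith
  choose! p hp hpG hpz hp1 hp2 using key
  rw [← Finset.sum_fiberwise_of_maps_to (g := fun τ => f (p τ)) (fun τ hτ => hpG τ hτ)]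
  refine (Finset.sum_le_sum fun w hw => ?_).trans (le_add_of_nonneg_right zero_le_one)
  set u := t.filter fun τ => f (p τ) = w
  rcases u.eq_empty_or_nonempty with hu | ⟨τ₀, hτ₀⟩
  · rw [hu, Finset.sum_empty]; positivity
  have hut : ∀ τ ∈ u, τ ∈ t ∧ f (p τ) = w := fun τ hτ => Finset.mem_filter.1 hτ
  refine hnear u p z _ hz (fun τ hτ => ⟨hp τ (hut τ hτ).1, hp1 τ (hut τ hτ).1, hp2 τ (hut τ hτ).1⟩) ?_
  have hD : (0 : ℝ) < 1 + ‖w‖ := by positivity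
  have hzw : κ / 8 ≤ ‖f z - w‖ := by
    have := hpz τ₀ (hut _ hτ₀).1
    rwa [(hut _ hτ₀).2] at this
  refine (sum_cs_zeros_le (h := fun z => (f z - w) / ((1 + ‖w‖ : ℝ) : ℂ)) ((hd.sub_const w).div_const _)
    (fun z hz => ?_) (u.image p) (fun q hq => ?_) hz (hδ w) ?_).trans ?_
  · rw [norm_div, norm_real, Real.norm_of_nonneg hD.le, div_le_one hD]
    exact (norm_sub_le _ _).trans (by linarith [hb z hz])
  · obtain ⟨τ, hτ, rfl⟩ := Finset.mem_image.1 hq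
    refine ⟨hp τ (hut τ hτ).1, ?_⟩
    simp [(hut τ hτ).2]
  · rw [norm_div, norm_real, Real.norm_of_nonneg hD.le]
    simp only [δ]
    gcongr
  · linarith [neg_abs_le (Real.log (δ w))]

/-- Average over a dyadic interval. -/
def av (f : ℂ → ℂ) (l : ℝ) (κ : ℤ) : ℂ := (∫ x in (κ * l)..((κ + 1) * l), f (x : ℂ)) / l

lemma norm_av_le {f : ℂ → ℂ} (hb : ∀ x : ℝ, ‖f x‖ ≤ 1) {l : ℝ} (hl : 0 < l) (κ : ℤ) :
    ‖av f l κ‖ ≤ 1 := by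
  have h1 := intervalIntegral.norm_integral_le_of_norm_le_const (f := fun x : ℝ => f (x : ℂ))
    (a := κ * l) (b := (κ + 1) * l) (C := 1) fun x _ => hb x
  rw [show ((κ : ℝ) + 1) * l - κ * l = l by ring, abs_of_pos hl, one_mul] at h1
  rw [av, norm_div, norm_real, Real.norm_of_nonneg hl.le, div_le_one hl]
  exact h1

lemma av_split {f : ℂ → ℂ} (hf : Continuous fun x : ℝ => f x) {l : ℝ} (hl : 0 < l) (κ : ℤ) :
    av f l κ = (av f (l / 2) (2 * κ) + av f (l / 2) (2 * κ + 1)) / 2 := by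
  have h := intervalIntegral.integral_add_adjacent_intervals (μ := MeasureTheory.volume)
    (hf.intervalIntegrable (κ * l) ((2 * κ + 1) * (l / 2)))
    (hf.intervalIntegrable ((2 * κ + 1) * (l / 2)) ((κ + 1) * l))
  unfold av
  push_cast
  rw [show (2 * (κ : ℝ)) * (l / 2) = κ * l by ring, show (2 * (κ : ℝ) + 1 + 1) * (l / 2) = (κ + 1) * l by ring,
    ← h]
  have hl' : (l : ℂ) ≠ 0 := by exact_mod_cast hl.ne'
  field_simp

/-- If a value differs from the boundary average, the derivative is large somewhere. -/
lemma exists_le_deriv {f : ℂ → ℂ} {h ε l : ℝ} (hh : 0 < h) (hd : DifferentiableOn ℂ f {z | -h < z.im})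
    (hb : ∀ z ∈ {z : ℂ | -h < z.im}, ‖f z‖ ≤ 1) (hε : 0 < ε) (hε1 : ε ≤ 1) (hl : 0 < l) {κ : ℤ} {z : ℂ}
    (hz1 : |z.re - κ * l| ≤ 2 * l) (hz2 : l / 4 ≤ z.im) (hz3 : z.im ≤ 2 * l)
    (hz : ε < ‖f z - av f l κ‖) :
    ∃ s : ℂ, |s.re - κ * l| ≤ 2 * l ∧ ε / 8 * l ≤ s.im ∧ s.im ≤ 2 * l ∧
      ε ^ 2 / 96 ≤ s.im * ‖deriv f s‖ := by
  by_contra! hcon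
  have hop : IsOpen {z : ℂ | -h < z.im} := isOpen_lt continuous_const continuous_im
  set η := ε / 8 * l with hη
  have hη0 : 0 < η := by positivity
  set R : Set ℂ := {s | |s.re - κ * l| ≤ 2 * l ∧ η ≤ s.im ∧ s.im ≤ 2 * l}
  have hRc : Convex ℝ R := by
    have : R = Icc (κ * l - 2 * l) (κ * l + 2 * l) ×ℂ Icc η (2 * l) := by
      ext s
      simp only [R, mem_ofPred_eq, mem_reProdIm, mem_Icc, abs_le]
      constructor
      · rintro ⟨⟨a, b⟩, c, d⟩
        exact ⟨⟨by linarith, by linarith⟩, c, d⟩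
      · rintro ⟨⟨a, b⟩, c, d⟩
        exact ⟨⟨by linarith, by linarith⟩, c, d⟩
    rw [this]
    exact ((convex_Icc _ _).linear_preimage reLm).inter ((convex_Icc _ _).linear_preimage imLm)
  have hosc : ∀ s ∈ R, ‖f z - f s‖ ≤ ε / 2 := by
    intro s hs
    have hzR : z ∈ R := ⟨hz1, by rw [hη]; nlinarith, hz3⟩
    have h1 := hRc.norm_image_sub_le_of_norm_deriv_le (f := f) (C := ε / (12 * l)) (fun x hx =>
      hd.differentiableAt (hop.mem_nhds (by
        change -h < x.im
        have : η ≤ x.im := hx.2.1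
        linarith))) (fun x hx => by
      have h2 := (hcon x hx.1 hx.2.1 hx.2.2).le
      have h3 : η * ‖deriv f x‖ ≤ x.im * ‖deriv f x‖ := by gcongr; exact hx.2.1
      rw [le_div_iff₀ (by positivity)]
      have h4 : η * ‖deriv f x‖ ≤ ε ^ 2 / 96 := h3.trans h2
      rw [hη] at h4
      have h5 : ε * (‖deriv f x‖ * (12 * l)) ≤ ε * ε := by nlinarith
      exact le_of_mul_le_mul_left h5 hε) hs hzR
    refine h1.trans ?_
    have h6 : ‖z - s‖ ≤ 6 * l := by
      have h7 := norm_le_abs_re_add_abs_im (z - s)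
      rw [sub_re, sub_im] at h7
      have h8 := abs_le.1 hz1
      have h9 := abs_le.1 hs.1
      have h10 : |z.re - s.re| ≤ 4 * l := abs_le.2 ⟨by linarith, by linarith⟩
      have h11 : |z.im - s.im| ≤ 2 * l := abs_le.2 ⟨by linarith [hs.2.2], by linarith [hs.2.1]⟩
      linarith
    calc ε / (12 * l) * ‖z - s‖ ≤ ε / (12 * l) * (6 * l) := by gcongr
      _ = ε / 2 := by field_simp; norm_num
  set a : ℝ := κ * l with ha
  have hab : (κ + 1 : ℝ) * l = a + l := by rw [ha]; ring
  have hc1 : Continuous fun x : ℝ => f (x + η * I) := by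
    refine continuous_iff_continuousAt.2 fun x => ?_
    have : ContinuousAt f (x + η * I) := (hd.differentiableAt (hop.mem_nhds (by
      change -h < _
      simp
      linarith))).continuousAt
    exact this.comp (f := fun x : ℝ => (x + η * I : ℂ)) (by fun_prop)
  have hrect := integral_boundary_rect_eq_zero_of_differentiableOn f (a : ℂ) (⟨a + l, η⟩) (hd.mono (by
    intro w hw
    rw [mem_reProdIm] at hw
    have := hw.2
    simp only [ofReal_im] at this
    rw [uIcc_of_le hη0.le] at this
    change -h < w.im
    linarith [this.1]))
  simp only [ofReal_re, ofReal_im, ofReal_zero, zero_mul, add_zero] at hrect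
  have hs1 := intervalIntegral.norm_integral_le_of_norm_le_const
    (f := fun y : ℝ => f ((a + l : ℝ) + y * I)) (a := 0) (b := η) (C := 1) fun y hy => hb _ (by
      rw [uIoc_of_le hη0.le] at hy
      change -h < _
      simp
      linarith [hy.1])
  have hs2 := intervalIntegral.norm_integral_le_of_norm_le_const
    (f := fun y : ℝ => f (a + y * I)) (a := 0) (b := η) (C := 1) fun y hy => hb _ (by
      rw [uIoc_of_le hη0.le] at hy
      change -h < _
      simp
      linarith [hy.1])
  have hs3 := intervalIntegral.norm_integral_le_of_norm_le_const
    (f := fun x : ℝ => f z - f (x + η * I)) (a := a) (b := a + l) (C := ε / 2) fun x hx => hosc _ (by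
      rw [uIoc_of_le (by linarith)] at hx
      refine ⟨?_, ?_, ?_⟩
      · simp
        rw [abs_le]
        constructor <;> linarith [hx.1, hx.2]
      · simp
      · simp
        rw [hη]; nlinarith)
  rw [intervalIntegral.integral_sub (by simp) (hc1.intervalIntegrable _ _),
    intervalIntegral.integral_const, show a + l - a = l by ring, abs_of_pos hl] at hs3
  rw [sub_zero, abs_of_pos hη0, one_mul] at hs1 hs2
  have hav : f z - av f l κ = (l * f z - ∫ x in a..a + l, f (x : ℂ)) / l := by
    have hl' : (l : ℂ) ≠ 0 := by exact_mod_cast hl.ne'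
    rw [av, hab, ← ha]
    field_simp
  rw [hav, norm_div, norm_real, Real.norm_of_nonneg hl.le, lt_div_iff₀ hl] at hz
  have e : l * f z - ∫ x in a..a + l, f (x : ℂ) =
      ((l • f z) - ∫ x in a..a + l, f (x + η * I)) +
      (I * (∫ y in (0 : ℝ)..η, f ((a + l : ℝ) + y * I)) - I * ∫ y in (0 : ℝ)..η, f (a + y * I)) := by
    simp only [smul_eq_mul] at hrect
    rw [real_smul]
    linear_combination -hrect
  rw [e] at hz
  have h1 := norm_add_le ((l • f z) - ∫ x in a..a + l, f (x + η * I))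
      (I * (∫ y in (0 : ℝ)..η, f ((a + l : ℝ) + y * I)) - I * ∫ y in (0 : ℝ)..η, f (a + y * I))
  have h2 := norm_sub_le (I * (∫ y in (0 : ℝ)..η, f ((a + l : ℝ) + y * I)))
    (I * ∫ y in (0 : ℝ)..η, f (a + y * I))
  rw [norm_mul, norm_mul, norm_I, one_mul, one_mul] at h2
  have h3 : 2 * η = ε / 4 * l := by rw [hη]; ring
  nlinarith

/-- The dyadic box containing a brick. -/
def qb (P N : ℕ) (τ : ℤ × ℤ) : ℕ × ℤ := ((τ.1 / P + N).toNat, τ.2 / P)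

lemma qb_length {P N : ℕ} (hP : GoodP P) {τ : ℤ × ℤ} (h : -(N : ℤ) ≤ τ.1 / P) :
    (2 : ℝ) ^ N / 2 ^ (qb P N τ).1 = P * bw P τ.1 := by
  rw [bw, mul_div_cancel₀ _ hP.pos.ne', qb]
  have h1 : ((τ.1 / P + N).toNat : ℤ) = τ.1 / P + N := Int.toNat_of_nonneg (by omega)
  rw [← zpow_natCast (2 : ℝ) N, ← zpow_natCast (2 : ℝ) (τ.1 / P + N).toNat, h1,
    ← zpow_sub₀ (by norm_num)]
  congr 1
  ring

lemma bc_re_mem {P : ℕ} (hP : GoodP P) (τ : ℤ × ℤ) :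
    ((τ.2 / P : ℤ) : ℝ) * (P * bw P τ.1) ≤ (bc P τ).re ∧
      (bc P τ).re < (((τ.2 / P : ℤ) : ℝ) + 1) * (P * bw P τ.1) := by
  have hp : (0 : ℤ) < P := by have := hP.1; omega
  have hw := bw_pos hP τ.1
  have h1 := Int.ediv_mul_le τ.2 hp.ne'
  have h2 := Int.lt_ediv_add_one_mul_self τ.2 hp
  have h1' : ((τ.2 / P : ℤ) : ℝ) * P ≤ τ.2 := by exact_mod_cast h1
  have h2' : (τ.2 : ℝ) + 1 ≤ (((τ.2 / P : ℤ) : ℝ) + 1) * P := by exact_mod_cast h2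
  have h3 : 0 ≤ bs τ.1 ∧ bs τ.1 < 1 := by
    unfold bs
    rcases Int.emod_two_eq_zero_or_one τ.1 with h | h <;> rw [h] <;> norm_num
  change _ ≤ (τ.2 + bs τ.1) * bw P τ.1 ∧ (τ.2 + bs τ.1) * bw P τ.1 < _
  rw [← mul_assoc, ← mul_assoc]
  exact ⟨by gcongr; linarith, by gcongr; linarith⟩

section Side

variable {M : ℕ → ℤ → ℂ} {rd : ℂ → ℂ} {ε : ℝ}

lemma exists_side_of_ne {n : ℕ} {κ κ' : ℤ} {x x' l : ℝ} (hl : 0 < l) (h1 : κ * l ≤ x)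
    (h2 : x < (κ + 1) * l) (h1' : κ' * l ≤ x') (h2' : x' < (κ' + 1) * l) (hx : |x - x'| ≤ l / 2)
    (hne : colr M rd ε n κ ≠ colr M rd ε n κ') :
    ∃ k : ℤ, (sid (stp M rd ε) 0 n k ∨ sid (stp M rd ε) 1 n k) ∧ |(k + 1 / 2) * l - x| ≤ 2 * l ∧
      |(k + 1 / 2) * l - x'| ≤ 2 * l := by
  obtain ⟨hx1, hx2⟩ := abs_le.1 hx
  have hk1 : κ < κ' + 2 := by
    have : (κ : ℝ) * l < (κ' + 2) * l := by linarith
    exact_mod_cast lt_of_mul_lt_mul_right this hl.le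
  have hk2 : κ' < κ + 2 := by
    have : (κ' : ℝ) * l < (κ + 2) * l := by linarith
    exact_mod_cast lt_of_mul_lt_mul_right this hl.le
  have near : ∀ k : ℤ, k = κ ∨ k = κ' → |(k + 1 / 2) * l - x| ≤ 2 * l ∧
      |(k + 1 / 2) * l - x'| ≤ 2 * l := by
    rintro k (rfl | rfl) <;> simp only [abs_le] <;> refine ⟨⟨?_, ?_⟩, ?_, ?_⟩ <;> linarith
  have hcase : κ' = κ ∨ κ' = κ + 1 ∨ κ = κ' + 1 := by omega
  rcases hcase with rfl | rfl | rfl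
  · exact absurd rfl hne
  · rcases colr_adjacent hne with h | h
    · exact ⟨κ, Or.inr h, near _ (Or.inl rfl)⟩
    · exact ⟨κ + 1, Or.inl h, near _ (Or.inr rfl)⟩
  · rcases colr_adjacent hne.symm with h | h
    · exact ⟨κ', Or.inr h, near _ (Or.inr rfl)⟩
    · exact ⟨κ' + 1, Or.inl h, near _ (Or.inl rfl)⟩

lemma norm_bc_sub_le {P : ℕ} {τ : ℤ × ℤ} {p : ℂ} {l : ℝ} (hl : 0 < l) (h1 : |p.re - (bc P τ).re| ≤ 2 * l)
    (h2 : l / 4 ≤ p.im) (h3 : p.im ≤ l) (h4 : l / 4 ≤ (bc P τ).im) (h5 : (bc P τ).im ≤ l) :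
    p ∈ uhp ∧ ‖bc P τ - p‖ ≤ 16 * (bc P τ).im ∧ ‖bc P τ - p‖ ≤ 16 * p.im := by
  have h6 := norm_le_abs_re_add_abs_im (bc P τ - p)
  rw [sub_re, sub_im, abs_sub_comm] at h6
  have h7 : |(bc P τ).im - p.im| ≤ l := abs_le.2 ⟨by linarith, by linarith⟩
  refine ⟨(by change 0 < p.im; linarith), by linarith, by linarith⟩

lemma exists_side {P N : ℕ} (hP : GoodP P) {τ τ' : ℤ × ℤ} (hj : -(N : ℤ) ≤ τ.1 / P)
    (hjj : τ.1 / P ≤ τ'.1 / P) {z : ℂ} (hz : z ∈ uhp) (hτ : chi P τ z ≠ 0) (hτ' : chi P τ' z ≠ 0)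
    (hne : colr M rd ε (qb P N τ).1 (qb P N τ).2 ≠ colr M rd ε (qb P N τ').1 (qb P N τ').2) :
    ∃ q : ℕ × ℤ, (sid (stp M rd ε) 0 q.1 q.2 ∨ sid (stp M rd ε) 1 q.1 q.2) ∧
      (bx (2 ^ N) q ∈ uhp ∧ ‖bc P τ - bx (2 ^ N) q‖ ≤ 16 * (bc P τ).im ∧
        ‖bc P τ - bx (2 ^ N) q‖ ≤ 16 * (bx (2 ^ N) q).im) ∧
      (bx (2 ^ N) q ∈ uhp ∧ ‖bc P τ' - bx (2 ^ N) q‖ ≤ 16 * (bc P τ').im ∧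
        ‖bc P τ' - bx (2 ^ N) q‖ ≤ 16 * (bx (2 ^ N) q).im) := by
  have hp := hP.pos
  have hp8 : (8 : ℝ) ≤ P := by exact_mod_cast hP.1
  have hpz : (8 : ℤ) ≤ P := by exact_mod_cast hP.1
  have hj' : -(N : ℤ) ≤ τ'.1 / P := by omega
  have hw := bw_pos hP τ.1
  have hw' := bw_pos hP τ'.1
  have hrow : τ'.1 ≤ τ.1 + 1 := by
    have h1 := abs_lt.1 (abs_lt_of_al_ne_zero (left_ne_zero_of_mul hτ))
    have h2 := abs_lt.1 (abs_lt_of_al_ne_zero (left_ne_zero_of_mul hτ'))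
    have : (τ'.1 : ℝ) < τ.1 + 2 := by linarith
    have : τ'.1 < τ.1 + 2 := by exact_mod_cast this
    omega
  have hjj' : τ'.1 / P = τ.1 / P ∨ τ'.1 / P = τ.1 / P + 1 := by
    have h1 : τ'.1 / P ≤ (τ.1 + 1 * P) / P := Int.ediv_le_ediv (by omega) (by omega)
    rw [Int.add_mul_ediv_right _ _ (by omega)] at h1
    omega
  have hl := qb_length hP hj
  have hl' := qb_length hP hj'
  obtain ⟨a1, a2⟩ := bc_re_mem hP τ
  obtain ⟨b1, b2⟩ := bc_re_mem hP τ'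
  have hi1 : (bc P τ).im ≤ P * bw P τ.1 := bh_le hP τ.1
  have hi2 : P * bw P τ.1 ≤ 2 * (bc P τ).im := le_bh hP τ.1
  have hi1' : (bc P τ').im ≤ P * bw P τ'.1 := bh_le hP τ'.1
  have hi2' : P * bw P τ'.1 ≤ 2 * (bc P τ').im := le_bh hP τ'.1
  have hww : bw P τ'.1 = bw P τ.1 ∨ bw P τ'.1 = bw P τ.1 / 2 := by
    unfold bw
    rcases hjj' with h | h
    · left; rw [h]
    · right
      rw [h, neg_add, zpow_add₀ (by norm_num), zpow_neg_one]
      ring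
  have hdist : |(bc P τ).re - (bc P τ').re| ≤ (P * bw P τ.1) / 2 := by
    have h1 := norm_sub_bc_le hP hz hτ
    have h2 := norm_sub_bc_le hP hz hτ'
    have h3 := (abs_re_le_norm (bc P τ - bc P τ')).trans
      (norm_sub_le_norm_sub_add_norm_sub (bc P τ) z (bc P τ'))
    rw [norm_sub_rev (bc P τ) z, sub_re] at h3
    have h4 : bw P τ'.1 ≤ bw P τ.1 := by rcases hww with h | h <;> rw [h]; linarith
    nlinarith
  have hLpos : 0 < P * bw P τ.1 := by positivity
  set n := (qb P N τ).1 with hn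
  have hnn : (qb P N τ').1 = n ∨ (qb P N τ').1 = n + 1 := by
    simp only [hn, qb]; omega
  rcases hnn with hnn | hnn
  · rw [hnn] at hne hl'
    have hll : P * bw P τ'.1 = P * bw P τ.1 := by rw [← hl, ← hl']
    rw [hll] at b1 b2 hi1' hi2'
    obtain ⟨k, hk, k1, k2⟩ := exists_side_of_ne hLpos a1 a2 b1 b2 hdist hne
    have e1 : (bx (2 ^ N) (n, k)).re = (k + 1 / 2) * (P * bw P τ.1) := by
      rw [← hl]; rfl
    have e2 : (bx (2 ^ N) (n, k)).im = P * bw P τ.1 := hl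
    refine ⟨(n, k), hk, norm_bc_sub_le hLpos ?_ ?_ ?_ ?_ ?_,
      norm_bc_sub_le hLpos ?_ ?_ ?_ ?_ ?_⟩ <;> (first | rwa [e1] | linarith [e2])
  · rw [hnn] at hne hl'
    have hll : P * bw P τ'.1 = (P * bw P τ.1) / 2 := by
      rw [← hl, ← hl', pow_succ]; field_simp
    rw [hll] at b1 b2 hi1' hi2'
    by_cases hstp : stp M rd ε (n + 1) (qb P N τ').2
    · have e1 : (bx (2 ^ N) (n + 1, (qb P N τ').2)).re =
          (((τ'.2 / P : ℤ) : ℝ) + 1 / 2) * ((P * bw P τ.1) / 2) := by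
        rw [← hll, ← hl']; rfl
      have e2 : (bx (2 ^ N) (n + 1, (qb P N τ').2)).im = (P * bw P τ.1) / 2 := hl'.trans hll
      have hd := abs_le.1 hdist
      refine ⟨(n + 1, (qb P N τ').2), Or.inl (Or.inl hstp),
        norm_bc_sub_le hLpos ?_ ?_ ?_ ?_ ?_,
        norm_bc_sub_le hLpos ?_ ?_ ?_ ?_ ?_⟩ <;>
        (first | rw [e1, abs_le]; constructor <;> linarith | (try rw [e2]); linarith)
    · rw [colr_succ_of_not_stp hstp] at hne
      have hm : ((τ'.2 / P / 2 : ℤ) : ℝ) * 2 ≤ ((τ'.2 / P : ℤ) : ℝ) := by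
        exact_mod_cast Int.ediv_mul_le (τ'.2 / P) (b := 2) (by norm_num)
      have hm' : ((τ'.2 / P : ℤ) : ℝ) + 1 ≤ (((τ'.2 / P / 2 : ℤ) : ℝ) + 1) * 2 := by
        exact_mod_cast Int.lt_ediv_add_one_mul_self (τ'.2 / P) (b := 2) (by norm_num)
      obtain ⟨k, hk, k1, k2⟩ := exists_side_of_ne (κ' := τ'.2 / P / 2) hLpos a1 a2
        (by nlinarith) (by nlinarith) hdist hne
      have e1 : (bx (2 ^ N) (n, k)).re = (k + 1 / 2) * (P * bw P τ.1) := by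
        rw [← hl]; rfl
      have e2 : (bx (2 ^ N) (n, k)).im = P * bw P τ.1 := hl
      refine ⟨(n, k), hk, norm_bc_sub_le hLpos ?_ ?_ ?_ ?_ ?_,
        norm_bc_sub_le hLpos ?_ ?_ ?_ ?_ ?_⟩ <;> (first | rwa [e1] | linarith [e2])

end Side

lemma exists_round {ε : ℝ} (hε : 0 < ε) : ∃ (Gr : Finset ℂ) (rd : ℂ → ℂ), (∀ w, rd w ∈ Gr) ∧
    ∀ w, ‖w‖ ≤ 1 → ‖w - rd w‖ ≤ ε / 4 := by
  classical
  obtain ⟨T, -, hTf, hT⟩ := (isCompact_closedBall (0 : ℂ) 1).finite_cover_balls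
    (show 0 < ε / 4 by positivity)
  have h : ∀ w : ℂ, ∃ v, v ∈ insert 0 hTf.toFinset ∧ (‖w‖ ≤ 1 → ‖w - v‖ ≤ ε / 4) := by
    intro w
    by_cases hw : ‖w‖ ≤ 1
    · have := hT (mem_closedBall_zero_iff.2 hw)
      simp only [mem_iUnion, exists_prop] at this
      obtain ⟨v, hv, hwv⟩ := this
      exact ⟨v, by simp [hv], fun _ => by rw [← dist_eq_norm]; exact le_of_lt hwv⟩
    · exact ⟨0, by simp, fun h => absurd h hw⟩
  choose rd h1 h2 using h
  exact ⟨_, rd, h1, h2⟩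

/-- The averages of `f` over the dyadic intervals of top length `2 ^ N`. -/
def mart (f : ℂ → ℂ) (N n : ℕ) (κ : ℤ) : ℂ := av f (2 ^ N / 2 ^ n) κ

/-- The discretized value of `f` on a brick obtained from dyadic averages. -/
def cbox (f : ℂ → ℂ) (rd : ℂ → ℂ) (ε : ℝ) (P N : ℕ) (τ : ℤ × ℤ) : ℂ :=
  colr (mart f N) rd ε (qb P N τ).1 (qb P N τ).2

/-- The bricks on which the dyadic average is a poor approximation. -/
def bad (f : ℂ → ℂ) (rd : ℂ → ℂ) (ε : ℝ) (P N : ℕ) (τ : ℤ × ℤ) : Prop :=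
  ∃ z ∈ uhp, chi P τ z ≠ 0 ∧ 2 * ε < ‖f z - cbox f rd ε P N τ‖

open Classical in
/-- The coloring of bricks by approximate values of `f`. -/
def ccol (f : ℂ → ℂ) (rd : ℂ → ℂ) (ε : ℝ) (P N : ℕ) (τ : ℤ × ℤ) : ℂ :=
  if bad f rd ε P N τ then rd (f (bc P τ)) else cbox f rd ε P N τ

lemma ccol_mem {Gr : Finset ℂ} {rd : ℂ → ℂ} (h : ∀ w, rd w ∈ Gr) (f : ℂ → ℂ) (ε : ℝ) (P N : ℕ)
    (τ : ℤ × ℤ) : ccol f rd ε P N τ ∈ Gr := by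
  unfold ccol
  split_ifs
  exacts [h _, colr_mem h _ _]

lemma norm_sub_ccol_le {f rd : ℂ → ℂ} {ε : ℝ} {P : ℕ} (hP : GoodP P) (hε : 0 < ε) (hPε : 16 / ε ≤ P)
    (hd : DifferentiableOn ℂ f uhp) (hb : ∀ z ∈ uhp, ‖f z‖ ≤ 1)
    (hrd : ∀ w, ‖w‖ ≤ 1 → ‖w - rd w‖ ≤ ε / 4) (N : ℕ) {τ : ℤ × ℤ} {z : ℂ} (hz : z ∈ uhp)
    (hτ : chi P τ z ≠ 0) : ‖f z - ccol f rd ε P N τ‖ ≤ 2 * ε := by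
  unfold ccol
  split_ifs with h
  · have hp := hP.pos
    have hw := bw_pos hP τ.1
    have hwb : bw P τ.1 ≤ (bc P τ).im / 4 := bw_le hP τ.1
    have hwb2 : P * bw P τ.1 ≤ 2 * (bc P τ).im := le_bh hP τ.1
    have hi := bc_mem P τ
    have hball : ball (bc P τ) (bc P τ).im ⊆ uhp := by
      intro w hw
      have h1 := (abs_le.1 (abs_im_le_norm (w - bc P τ))).1
      rw [mem_ball, dist_eq_norm] at hw
      rw [sub_im] at h1
      change 0 < w.im
      linarith
    have hzb := norm_sub_bc_le hP hz hτ
    have h1 := dist_le_of_norm_le_ball (hd.mono hball) (fun w hw => hb w (hball hw))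
      (z := z) (by rw [mem_ball, dist_eq_norm]; linarith)
    rw [dist_eq_norm, dist_eq_norm] at h1
    have h2 := hrd _ (hb (bc P τ) hi)
    have h3 : 2 * 1 / (bc P τ).im * ‖z - bc P τ‖ ≤ ε := by
      rw [div_mul_eq_mul_div, div_le_iff₀ hi]
      rw [div_le_iff₀ hε] at hPε
      nlinarith
    calc ‖f z - rd (f (bc P τ))‖ ≤ ‖f z - f (bc P τ)‖ + ‖f (bc P τ) - rd (f (bc P τ))‖ :=
          norm_sub_le_norm_sub_add_norm_sub _ _ _
      _ ≤ _ := by linarith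
  · simp only [bad, not_exists, not_and, not_lt] at h
    exact h z hz hτ

lemma exists_deriv_of_bad {f rd : ℂ → ℂ} {ε h : ℝ} {P N : ℕ} (hP : GoodP P) (hε : 0 < ε) (hε1 : ε ≤ 1)
    (hh : 0 < h) (hd : DifferentiableOn ℂ f {z | -h < z.im})
    (hb : ∀ z ∈ {z : ℂ | -h < z.im}, ‖f z‖ ≤ 1) (hrd : ∀ w, ‖w‖ ≤ 1 → ‖w - rd w‖ ≤ ε / 4)
    {τ : ℤ × ℤ} (hj : -(N : ℤ) ≤ τ.1 / P) (hbad : bad f rd ε P N τ) :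
    ∃ s ∈ uhp, ε ^ 2 / 96 ≤ s.im * ‖deriv f s‖ ∧ ‖bc P τ - s‖ ≤ 40 / ε * (bc P τ).im ∧
      ‖bc P τ - s‖ ≤ 40 / ε * s.im := by
  obtain ⟨z, hz, hτ, hlt⟩ := hbad
  have hp8 : (8 : ℝ) ≤ P := by exact_mod_cast hP.1
  have hw := bw_pos hP τ.1
  set l := P * bw P τ.1 with hl
  have hwl : bw P τ.1 ≤ l / 8 := by nlinarith
  have hl0 : 0 < l := by positivity
  have hi1 : (bc P τ).im ≤ l := bh_le hP τ.1
  have hi2 : l ≤ 2 * (bc P τ).im := le_bh hP τ.1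
  obtain ⟨a1, a2⟩ := bc_re_mem hP τ
  rw [← hl] at a1 a2
  have hmart : ∀ n κ, ‖mart f N n κ‖ ≤ 1 := fun n κ =>
    norm_av_le (fun x => hb _ (by simpa using hh)) (by positivity) κ
  have hc := norm_sub_colr_le hε.le hmart hrd (qb P N τ).1 (qb P N τ).2
  have hq : mart f N (qb P N τ).1 (qb P N τ).2 = av f l (τ.2 / P) := by
    rw [mart, qb_length hP hj]; rfl
  rw [hq] at hc
  have hlt' : ε < ‖f z - av f l (τ.2 / P)‖ := by
    have := norm_sub_le_norm_sub_add_norm_sub (f z) (av f l (τ.2 / P)) (cbox f rd ε P N τ)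
    change ‖_ - cbox f rd ε P N τ‖ ≤ _ at hc
    linarith
  have hzb := norm_sub_bc_le hP hz hτ
  have hre := abs_le.1 ((abs_re_le_norm _).trans hzb)
  have him := abs_le.1 ((abs_im_le_norm _).trans hzb)
  rw [sub_re] at hre
  rw [sub_im] at him
  obtain ⟨s, s1, s2, s3, s4⟩ := exists_le_deriv hh hd hb hε hε1 hl0
    (abs_le.2 ⟨by linarith, by linarith⟩) (by linarith) (by linarith) hlt'
  have hs0 : 0 < s.im := lt_of_lt_of_le (by positivity) s2
  have hdist : ‖bc P τ - s‖ ≤ 5 * l := by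
    have h6 := norm_le_abs_re_add_abs_im (bc P τ - s)
    rw [sub_re, sub_im] at h6
    obtain ⟨s11, s12⟩ := abs_le.1 s1
    have h7 : |(bc P τ).re - s.re| ≤ 3 * l := abs_le.2 ⟨by linarith, by linarith⟩
    have h8 : |(bc P τ).im - s.im| ≤ 2 * l := abs_le.2 ⟨by linarith, by linarith⟩
    linarith
  refine ⟨s, hs0, s4, ?_, ?_⟩
  · rw [div_mul_eq_mul_div, le_div_iff₀ hε]
    nlinarith [norm_nonneg (bc P τ - s)]
  · rw [div_mul_eq_mul_div, le_div_iff₀ hε]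
    nlinarith [norm_nonneg (bc P τ - s)]

lemma near_of_overlap {P : ℕ} (hP : GoodP P) {τ τ' : ℤ × ℤ} {z s : ℂ} {K : ℝ} (hK : 0 ≤ K) (hz : z ∈ uhp)
    (hτ : chi P τ z ≠ 0) (hτ' : chi P τ' z ≠ 0) (h1 : ‖bc P τ' - s‖ ≤ K * (bc P τ').im)
    (h2 : ‖bc P τ' - s‖ ≤ K * s.im) (hs : s ∈ uhp) :
    ‖bc P τ - s‖ ≤ (2 * K + 1) * (bc P τ).im ∧ ‖bc P τ - s‖ ≤ (2 * K + 1) * s.im := by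
  have a := norm_sub_bc_le hP hz hτ
  have a' := norm_sub_bc_le hP hz hτ'
  have b : bw P τ.1 ≤ (bc P τ).im / 4 := bw_le hP τ.1
  have b' : bw P τ'.1 ≤ (bc P τ').im / 4 := bw_le hP τ'.1
  have i := bc_mem P τ
  have i' := bc_mem P τ'
  have hs0 : 0 < s.im := hs
  have hd : ‖bc P τ - bc P τ'‖ ≤ ((bc P τ).im + (bc P τ').im) / 4 := by
    have := norm_sub_le_norm_sub_add_norm_sub (bc P τ) z (bc P τ')
    rw [norm_sub_rev (bc P τ) z] at this
    linarith
  have him := abs_le.1 ((abs_im_le_norm _).trans hd)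
  rw [sub_im] at him
  have hsim := abs_le.1 ((abs_im_le_norm _).trans h2)
  rw [sub_im] at hsim
  have ht := norm_sub_le_norm_sub_add_norm_sub (bc P τ) (bc P τ') s
  constructor
  · nlinarith
  · nlinarith

theorem exists_sum_cs_ccol_le {P : ℕ} (hP : GoodP P) {ε : ℝ} (hε : 0 < ε) (hε1 : ε ≤ 1) :
    ∃ M : ℝ, 0 < M ∧ ∀ (f rd : ℂ → ℂ) (h : ℝ) (N : ℕ), 0 < h →
    DifferentiableOn ℂ f {z | -h < z.im} → (∀ z ∈ {z : ℂ | -h < z.im}, ‖f z‖ ≤ 1) →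
    (∀ w, ‖w‖ ≤ 1 → ‖w - rd w‖ ≤ ε / 4) → ∀ t : Finset (ℤ × ℤ),
    (∀ τ ∈ t, -(N : ℤ) ≤ τ.1 / P ∧ ∃ τ', -(N : ℤ) ≤ τ'.1 / P ∧ ∃ z ∈ uhp, chi P τ z ≠ 0 ∧
      chi P τ' z ≠ 0 ∧ ccol f rd ε P N τ' ≠ ccol f rd ε P N τ) →
    ∀ z ∈ uhp, z.im ≤ 2 ^ N → ∑ τ ∈ t, cs z (bc P τ) ≤ M := by
  classical
  set K := 2 * (40 / ε) + 1 with hK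
  have hK0 : 0 ≤ 40 / ε := by positivity
  obtain ⟨M1, hM1, h1⟩ := exists_sum_cs_le_of_deriv hP (K := K) (ε := ε ^ 2 / 96) (by positivity)
    (by positivity)
  obtain ⟨m, hm, h2⟩ := exists_sum_cs_le_of_near hP (K := 16) (by norm_num)
  obtain ⟨C, hC, h3⟩ := exists_sum_cs_bx_le
  set A := 2 + 4 * ((1 + ε ^ 2) / (15 / 16 * ε ^ 2)) with hA
  have hA0 : 0 < A := by positivity
  refine ⟨M1 + m * (C * (A + 1)), by positivity, fun f rd h N hh hd hb hrd t ht z hz hzN => ?_⟩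
  have hsub : uhp ⊆ {z : ℂ | -h < z.im} := fun w hw => by
    have : 0 < w.im := hw
    change -h < w.im
    linarith
  have hmart : ∀ n κ, ‖mart f N n κ‖ ≤ 1 := fun n κ =>
    norm_av_le (fun x => hb _ (by simpa using hh)) (by positivity) κ
  have hcont : Continuous fun x : ℝ => f x := by
    refine hd.continuousOn.comp_continuous continuous_ofReal fun x => ?_
    simpa using hh
  have hsplit : ∀ n κ, mart f N n κ = (mart f N (n + 1) (2 * κ) + mart f N (n + 1) (2 * κ + 1)) / 2 := by
    intro n κ
    unfold mart
    rw [av_split hcont (by positivity) κ, pow_succ, div_div]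
  set D : ℤ × ℤ → Prop := fun τ => ∃ s ∈ uhp, ε ^ 2 / 96 ≤ s.im * ‖deriv f s‖ ∧
      ‖bc P τ - s‖ ≤ K * (bc P τ).im ∧ ‖bc P τ - s‖ ≤ K * s.im with hD
  set S : ℕ → ℤ → Prop := fun n κ =>
    sid (stp (mart f N) rd ε) 0 n κ ∨ sid (stp (mart f N) rd ε) 1 n κ with hS
  have hq : ∀ τ ∈ t.filter (fun τ => ¬ D τ), ∃ q : ℕ × ℤ, S q.1 q.2 ∧ bx (2 ^ N) q ∈ uhp ∧
      ‖bc P τ - bx (2 ^ N) q‖ ≤ 16 * (bc P τ).im ∧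
      ‖bc P τ - bx (2 ^ N) q‖ ≤ 16 * (bx (2 ^ N) q).im := by
    intro τ hτ
    obtain ⟨hτt, hnD⟩ := Finset.mem_filter.1 hτ
    obtain ⟨hj, τ', hj', w, hw, hw1, hw2, hne⟩ := ht τ hτt
    have hb1 : ¬ bad f rd ε P N τ := fun hbad => by
      obtain ⟨s, s1, s2, s3, s4⟩ := exists_deriv_of_bad hP hε hε1 hh hd hb hrd hj hbad
      exact hnD ⟨s, s1, s2, near_of_overlap hP hK0 hw hw1 hw1 s3 s4 s1⟩
    have hb2 : ¬ bad f rd ε P N τ' := fun hbad => by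
      obtain ⟨s, s1, s2, s3, s4⟩ := exists_deriv_of_bad hP hε hε1 hh hd hb hrd hj' hbad
      exact hnD ⟨s, s1, s2, near_of_overlap hP hK0 hw hw1 hw2 s3 s4 s1⟩
    rw [ccol, ccol, if_neg hb1, if_neg hb2] at hne
    rcases le_total (τ.1 / (P : ℤ)) (τ'.1 / P) with hle | hle
    · obtain ⟨q, q1, q2, -⟩ := exists_side hP hj hle hw hw1 hw2 hne.symm
      exact ⟨q, q1, q2⟩
    · obtain ⟨q, q1, -, q2⟩ := exists_side hP hj' hle hw hw2 hw1 hne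
      exact ⟨q, q1, q2⟩
  choose! q hq1 hq2 using hq
  rw [← Finset.sum_filter_add_sum_filter_not t D]
  refine add_le_add (h1 f (hd.mono hsub) (fun z hz => hb z (hsub hz)) _
    (fun τ hτ => (Finset.mem_filter.1 hτ).2) z hz) ?_
  refine h2 _ (fun τ => bx (2 ^ N) (q τ)) z _ hz hq2 ?_
  have himg : (t.filter fun τ => ¬ D τ).image (fun τ => bx (2 ^ N) (q τ)) =
      ((t.filter fun τ => ¬ D τ).image q).image (bx (2 ^ N)) := by
    rw [Finset.image_image]; rfl
  rw [himg]
  refine (Finset.sum_image_le_of_nonneg ?_).trans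
    (h3 S A (2 ^ N) z _ (fun D n κ => WN_side_le hε hmart hsplit hrd D n κ) (by positivity) hz hzN ?_)
  · intro p hp
    obtain ⟨r, -, rfl⟩ := Finset.mem_image.1 hp
    refine cs_nonneg hz ?_
    change 0 < (2 : ℝ) ^ N / 2 ^ r.1
    positivity
  · intro p hp
    obtain ⟨τ, hτ, rfl⟩ := Finset.mem_image.1 hp
    exact hq1 τ hτ

lemma exists_eventually_eq {α : Type*} {Gr : Finset α} {a : ℕ → α} (h : ∀ n, a n ∈ Gr) :
    ∃ v ∈ Gr, ∀ᶠ n in (Filter.hyperfilter ℕ : Filter ℕ), a n = v := by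
  have h1 : ⋃ v ∈ (Gr : Set α), {n | a n = v} ∈ Filter.hyperfilter ℕ := by
    have : (⋃ v ∈ (Gr : Set α), {n | a n = v}) = univ := by
      ext n
      simpa using h n
    rw [this]
    exact Filter.univ_mem
  rw [Ultrafilter.finite_biUnion_mem_iff Gr.finite_toSet] at h1
  exact h1

lemma eventually_neg_le (j : ℤ) :
    ∀ᶠ N : ℕ in (Filter.hyperfilter ℕ : Filter ℕ), -(N : ℤ) ≤ j := by
  refine Nat.hyperfilter_le_atTop ?_
  filter_upwards [Filter.eventually_ge_atTop j.natAbs] with N hN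
  omega

/-- Every function in the unit ball of `H^∞` is, up to `2 * ε`, constant on bricks, in such a way
that the bricks where the constant jumps satisfy the Carleson condition. -/
theorem exists_coloring {P : ℕ} (hP : GoodP P) {ε : ℝ} (hε : 0 < ε) (hε1 : ε ≤ 1) (hPε : 16 / ε ≤ P) :
    ∃ (Gr : Finset ℂ) (M : ℝ), 0 < M ∧ ∀ f : ℂ → ℂ, DifferentiableOn ℂ f uhp →
    (∀ z ∈ uhp, ‖f z‖ ≤ 1) → ∃ c : ℤ × ℤ → ℂ, (∀ τ, c τ ∈ Gr) ∧
      (∀ τ, ∀ z ∈ uhp, chi P τ z ≠ 0 → ‖f z - c τ‖ ≤ 2 * ε) ∧ Carl (bc P) (Jmp P c) M := by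
  classical
  obtain ⟨Gr, rd, hGr, hrd⟩ := exists_round hε
  obtain ⟨M, hM, hsum⟩ := exists_sum_cs_ccol_le hP hε hε1
  refine ⟨Gr, M, hM, fun f hd hb => ?_⟩
  set F : ℕ → ℂ → ℂ := fun N z => f (z + (1 / ((N : ℝ) + 1) : ℝ) * I) with hF
  have hN : ∀ N : ℕ, 0 < 1 / ((N : ℝ) + 1) := fun N => by positivity
  have hmaps : ∀ N : ℕ, ∀ z ∈ {z : ℂ | -(1 / ((N : ℝ) + 1)) < z.im},
      z + (1 / ((N : ℝ) + 1) : ℝ) * I ∈ uhp := by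
    intro N z hz
    change 0 < (z + (1 / ((N : ℝ) + 1) : ℝ) * I).im
    rw [mem_ofPred_eq] at hz
    rw [add_im, im_ofReal_mul, I_im, mul_one]
    linarith
  have hFd : ∀ N : ℕ, DifferentiableOn ℂ (F N) {z | -(1 / ((N : ℝ) + 1)) < z.im} := fun N =>
    hd.comp (by fun_prop) (hmaps N)
  have hFb : ∀ N : ℕ, ∀ z ∈ {z : ℂ | -(1 / ((N : ℝ) + 1)) < z.im}, ‖F N z‖ ≤ 1 := fun N z hz =>
    hb _ (hmaps N z hz)
  have hsub : ∀ N : ℕ, uhp ⊆ {z : ℂ | -(1 / ((N : ℝ) + 1)) < z.im} := fun N w hw => by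
    have : 0 < w.im := hw
    have := hN N
    change -(1 / ((N : ℝ) + 1)) < w.im
    linarith
  choose c hcG hc using fun τ => exists_eventually_eq (fun N => ccol_mem hGr (F N) ε P N τ)
  refine ⟨c, hcG, fun τ z hz hτ => ?_, fun z hz t ht => ?_⟩
  · have hcz : ContinuousAt f z := (hd z hz).continuousWithinAt.continuousAt (isOpen_uhp.mem_nhds hz)
    have hlim : Filter.Tendsto (fun N : ℕ => F N z) (Filter.hyperfilter ℕ) (𝓝 (f z)) := by
      refine Filter.Tendsto.mono_left ?_ Nat.hyperfilter_le_atTop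
      refine hcz.tendsto.comp ?_
      have h1 := (Complex.continuous_ofReal.tendsto 0).comp
        (tendsto_one_div_add_atTop_nhds_zero_nat (𝕜 := ℝ))
      simpa using (h1.mul_const I).const_add z
    refine le_of_tendsto ((hlim.sub_const _).norm) ?_
    filter_upwards [hc τ] with N hcN
    rw [← hcN]
    exact norm_sub_ccol_le hP hε hPε ((hFd N).mono (hsub N)) (fun w hw => hFb N w (hsub N hw)) hrd N
      hz hτ
  · choose! τ' w hw using fun τ (hτ : τ ∈ t) => ht hτ
    have hev : ∀ᶠ N : ℕ in (Filter.hyperfilter ℕ : Filter ℕ), z.im ≤ 2 ^ N ∧ ∀ τ ∈ t,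
        (-(N : ℤ) ≤ τ.1 / P ∧ -(N : ℤ) ≤ (τ' τ).1 / P) ∧
          (ccol (F N) rd ε P N τ = c τ ∧ ccol (F N) rd ε P N (τ' τ) = c (τ' τ)) := by
      refine Filter.Eventually.and ?_ ?_
      · exact Nat.hyperfilter_le_atTop
          ((tendsto_pow_atTop_atTop_of_one_lt (one_lt_two : (1 : ℝ) < 2)).eventually_ge_atTop _)
      · refine (Filter.eventually_all_finset t).2 fun τ _ => ?_
        exact ((eventually_neg_le _).and (eventually_neg_le _)).and ((hc _).and (hc _))
    obtain ⟨N, hzN, hN2⟩ := hev.exists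
    refine hsum (F N) rd _ N (hN N) (hFd N) (hFb N) hrd t (fun τ hτ => ?_) z hz hzN
    obtain ⟨⟨h1, h2⟩, h3, h4⟩ := hN2 τ hτ
    obtain ⟨g1, g2, g3, g4⟩ := hw τ hτ
    exact ⟨h1, τ' τ, h2, w τ, g1, g2, g3, by rw [h3, h4]; exact g4⟩

lemma exists_goodP (x : ℝ) : ∃ P : ℕ, GoodP P ∧ x ≤ P := by
  refine ⟨2 * (⌈x⌉₊ + 4), ⟨by omega, by simp⟩, ?_⟩
  have := Nat.le_ceil x
  push_cast
  have h : (0 : ℝ) ≤ ⌈x⌉₊ := Nat.cast_nonneg _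
  linarith

theorem exists_coloring_pi (ι : Type*) [Fintype ι] {P : ℕ} (hP : GoodP P) {ε : ℝ} (hε : 0 < ε)
    (hε1 : ε ≤ 1) (hPε : 16 / ε ≤ P) : ∃ (Gr : Finset ℂ) (M : ℝ), 0 < M ∧ ∀ f : ι → ℂ → ℂ,
    (∀ i, DifferentiableOn ℂ (f i) uhp) → (∀ i, ∀ z ∈ uhp, ‖f i z‖ ≤ 1) →
    ∃ c : ℤ × ℤ → (ι → Gr), (∀ τ, ∀ z ∈ uhp, chi P τ z ≠ 0 → ∀ i, ‖f i z - c τ i‖ ≤ 2 * ε) ∧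
      Carl (bc P) (Jmp P c) M := by
  classical
  obtain ⟨Gr, M, hM, h⟩ := exists_coloring hP hε hε1 hPε
  refine ⟨Gr, Fintype.card ι * M + 1, by positivity, fun f hd hb => ?_⟩
  choose c hG hc hJ using fun i => h (f i) (hd i) (hb i)
  refine ⟨fun τ i => ⟨c i τ, hG i τ⟩, fun τ z hz hτ i => hc i τ z hz hτ, fun z hz t ht => ?_⟩
  have h1 : ∀ τ ∈ t, cs z (bc P τ) ≤ ∑ i, if τ ∈ Jmp P (c i) then cs z (bc P τ) else 0 := by
    intro τ hτ
    have h0 : 0 ≤ cs z (bc P τ) := cs_nonneg hz (bc_mem P τ)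
    obtain ⟨τ', w, hw, w1, w2, hne⟩ := ht hτ
    obtain ⟨i, hi⟩ := Function.ne_iff.1 hne
    have hi' : τ ∈ Jmp P (c i) := ⟨τ', w, hw, w1, w2, fun h => hi (Subtype.ext h)⟩
    calc cs z (bc P τ) = if τ ∈ Jmp P (c i) then cs z (bc P τ) else 0 := (if_pos hi').symm
      _ ≤ _ := Finset.single_le_sum (f := fun i => if τ ∈ Jmp P (c i) then cs z (bc P τ) else 0)
        (fun j _ => by split_ifs; exacts [h0, le_rfl]) (Finset.mem_univ i)
  refine (Finset.sum_le_sum h1).trans ?_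
  rw [Finset.sum_comm]
  have h2 : ∀ i ∈ (Finset.univ : Finset ι),
      (∑ τ ∈ t, if τ ∈ Jmp P (c i) then cs z (bc P τ) else 0) ≤ M := by
    intro i _
    rw [← Finset.sum_filter]
    exact hJ i z hz _ fun τ hτ => (Finset.mem_filter.1 hτ).2
  have h3 := Finset.sum_le_card_nsmul _ _ _ h2
  rw [nsmul_eq_mul, Finset.card_univ] at h3
  linarith

section Corona

variable {Col : Type*} [Fintype Col] [DecidableEq Col]

/-- The smooth combinations of the colors. -/
def psi (P : ℕ) (c : ℤ × ℤ → Col) (a : Col → ℂ) (z : ℂ) : ℂ := ∑ v, phc P c v z * a v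

lemma contDiffAt_psi {P : ℕ} (c : ℤ × ℤ → Col) (a : Col → ℂ) {n : ℕ∞} {z : ℂ} (hz : z ∈ uhp) :
    ContDiffAt ℝ n (psi P c a) z :=
  ContDiffAt.sum fun v _ => (contDiffAt_phc c v hz).mul contDiffAt_const

lemma norm_psi_le {P : ℕ} (c : ℤ × ℤ → Col) (a : Col → ℂ) (z : ℂ) : ‖psi P c a z‖ ≤ ∑ v, ‖a v‖ := by
  refine norm_sum_le_of_le _ fun v _ => ?_
  rw [norm_mul, phc, norm_real, Real.norm_of_nonneg (ph_nonneg c v z)]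
  exact mul_le_of_le_one_left (norm_nonneg _) (ph_le_one c v z)

lemma dbar_psi {P : ℕ} (c : ℤ × ℤ → Col) (a : Col → ℂ) {z : ℂ} (hz : z ∈ uhp) :
    dbar (psi P c a) z = ∑ v, dbar (phc P c v) z * a v := by
  have hd : ∀ v, DifferentiableAt ℝ (phc P c v) z := fun v =>
    (contDiffAt_phc c v (n := 1) hz).differentiableAt one_ne_zero
  unfold psi
  rw [dbar_sum _ fun v _ => (hd v).mul_const _]
  refine Finset.sum_congr rfl fun v _ => ?_
  rw [dbar_mul (hd v) (differentiableAt_const _), dbar_const]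
  ring

theorem exists_corona_of_psi {ι : Type*} [Fintype ι] {P : ℕ} (hP : GoodP P) (a : ι → Col → ℂ) (M : ℝ) :
    ∃ C : ℝ, 0 < C ∧ ∀ (c : ℤ × ℤ → Col) (f : ι → ℂ → ℂ), Carl (bc P) (Jmp P c) M →
    (∀ i, DifferentiableOn ℂ (f i) uhp) → (∀ i, ∀ z ∈ uhp, ‖f i z‖ ≤ 1) →
    (∀ z ∈ uhp, ‖∑ i, psi P c (a i) z * f i z - 1‖ ≤ 1 / 2) →
    ∃ g : ι → ℂ → ℂ, (∀ i, DifferentiableOn ℂ (g i) uhp) ∧ (∀ i, ∀ z ∈ uhp, ‖g i z‖ ≤ C) ∧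
      ∀ z ∈ uhp, ∑ i, g i z * f i z = 1 := by
  obtain ⟨C0, hC0, hphc⟩ := exists_dbar_phc_bound (Col := Col) hP
  set A := ∑ i, ∑ v, ‖a i v‖ with hA
  have hA0 : 0 ≤ A := Finset.sum_nonneg fun i _ => Finset.sum_nonneg fun v _ => norm_nonneg _
  have hAi : ∀ i, ∑ v, ‖a i v‖ ≤ A := fun i =>
    Finset.single_le_sum (f := fun i => ∑ v, ‖a i v‖)
      (fun i _ => Finset.sum_nonneg fun v _ => norm_nonneg _) (Finset.mem_univ i)
  set L := 2 * A * (A * (C0 * A * 4) + C0 * A * 2) with hL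
  obtain ⟨C1, c1, hC1, -, hsol⟩ := exists_dbar_solution hP (L := L) (by positivity) M
  refine ⟨2 * A + Fintype.card ι * (2 * C1) + 1, by positivity, fun c f hJ hd hb hE => ?_⟩
  set E : ℂ → ℂ := fun z => ∑ i, psi P c (a i) z * f i z with hEdef
  have hE2 : ∀ z ∈ uhp, 1 / 2 ≤ ‖E z‖ := fun z hz => by
    have h1 := hE z hz
    have h2 := norm_sub_norm_le (1 : ℂ) (1 - E z)
    rw [norm_one, sub_sub_cancel, norm_sub_rev] at h2
    change ‖E z - 1‖ ≤ _ at h1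
    linarith
  have hE0 : ∀ z ∈ uhp, E z ≠ 0 := fun z hz h => by
    have := hE2 z hz
    rw [h, norm_zero] at this
    norm_num at this
  have hfR : ∀ i, ContDiffOn ℝ 2 (f i) uhp := fun i =>
    ((hd i).contDiffOn isOpen_uhp).restrict_scalars ℝ
  have hpR : ∀ i, ContDiffOn ℝ 2 (psi P c (a i)) uhp := fun i z hz =>
    (contDiffAt_psi c (a i) (n := 2) hz).contDiffWithinAt
  have hER : ContDiffOn ℝ 2 E uhp := ContDiffOn.sum fun i _ => (hpR i).mul (hfR i)
  set q : ι → ℂ → ℂ := fun i z => psi P c (a i) z * (E z)⁻¹ with hq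
  have hqR : ∀ i, ContDiffOn ℝ 2 (q i) uhp := fun i => (hpR i).mul (hER.inv hE0)
  have dif : ∀ {F : ℂ → ℂ}, ContDiffOn ℝ 2 F uhp → ∀ z ∈ uhp, DifferentiableAt ℝ F z :=
    fun hF z hz => (hF.contDiffAt (isOpen_uhp.mem_nhds hz)).differentiableAt two_ne_zero
  have hfC : ∀ i, ∀ z ∈ uhp, DifferentiableAt ℂ (f i) z := fun i z hz =>
    (hd i z hz).differentiableAt (isOpen_uhp.mem_nhds hz)
  have hdE : ∀ z ∈ uhp, dbar E z = ∑ i, dbar (psi P c (a i)) z * f i z := by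
    intro z hz
    rw [hEdef, dbar_sum _ fun i _ => (dif (hpR i) z hz).fun_mul (dif (hfR i) z hz)]
    refine Finset.sum_congr rfl fun i _ => ?_
    rw [dbar_mul (dif (hpR i) z hz) (dif (hfR i) z hz), dbar_of_differentiableAt (hfC i z hz),
      mul_zero, zero_add]
  have hdq : ∀ i, ∀ z ∈ uhp, dbar (q i) z =
      psi P c (a i) z * -(dbar E z / E z ^ 2) + dbar (psi P c (a i)) z * (E z)⁻¹ := by
    intro i z hz
    rw [hq]
    change dbar (fun z => psi P c (a i) z * (E z)⁻¹) z = _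
    rw [dbar_mul (dif (hpR i) z hz) ((dif hER z hz).fun_inv (hE0 z hz)),
      dbar_inv (dif hER z hz) (hE0 z hz)]
  have bpsi : ∀ i, ∀ z ∈ uhp, ‖dbar (psi P c (a i)) z‖ ≤ C0 / z.im * ∑ v, ‖a i v‖ := by
    intro i z hz
    rw [dbar_psi c (a i) hz, Finset.mul_sum]
    refine norm_sum_le_of_le _ fun v _ => ?_
    rw [norm_mul]
    exact mul_le_mul_of_nonneg_right (hphc c v z hz) (norm_nonneg _)
  have bE : ∀ z ∈ uhp, ‖dbar E z‖ ≤ C0 / z.im * A := by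
    intro z hz
    rw [hdE z hz, hA, Finset.mul_sum]
    refine norm_sum_le_of_le _ fun i _ => ?_
    rw [norm_mul]
    exact (mul_le_of_le_one_right (norm_nonneg _) (hb i z hz)).trans (bpsi i z hz)
  have bq : ∀ i, ∀ z ∈ uhp, ‖q i z‖ ≤ 2 * A := by
    intro i z hz
    rw [hq]
    change ‖psi P c (a i) z * (E z)⁻¹‖ ≤ _
    rw [norm_mul, norm_inv, mul_comm]
    have h1 : ‖E z‖⁻¹ ≤ 2 := by
      rw [inv_le_comm₀ (lt_of_lt_of_le (by norm_num) (hE2 z hz)) (by norm_num)]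
      linarith [hE2 z hz]
    exact mul_le_mul h1 ((norm_psi_le c (a i) z).trans (hAi i)) (norm_nonneg _) (by norm_num)
  have bdq : ∀ i, ∀ z ∈ uhp, ‖dbar (q i) z‖ ≤ (A * (C0 * A * 4) + C0 * A * 2) / z.im := by
    intro i z hz
    have hy : 0 < z.im := hz
    have h1 : ‖E z‖⁻¹ ≤ 2 := by
      rw [inv_le_comm₀ (lt_of_lt_of_le (by norm_num) (hE2 z hz)) (by norm_num)]
      linarith [hE2 z hz]
    have h0 : 0 ≤ ‖E z‖⁻¹ := by positivity
    have h2 : (‖E z‖⁻¹) ^ 2 ≤ 4 := by nlinarith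
    have hb1 : ‖dbar E z‖ ≤ C0 / z.im * A := bE z hz
    have hb2 : ‖dbar (psi P c (a i)) z‖ ≤ C0 / z.im * A :=
      (bpsi i z hz).trans (mul_le_mul_of_nonneg_left (hAi i) (by positivity))
    have hb3 : ‖psi P c (a i) z‖ ≤ A := (norm_psi_le c (a i) z).trans (hAi i)
    rw [hdq i z hz]
    refine (norm_add_le _ _).trans ?_
    rw [norm_mul, norm_neg, norm_div, norm_pow, norm_mul, norm_inv, div_eq_mul_inv ‖dbar E z‖, ← inv_pow,
      add_div]
    refine add_le_add ?_ ?_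
    · calc _ ≤ A * ((C0 / z.im * A) * 4) := by gcongr
        _ = _ := by ring
    · calc _ ≤ (C0 / z.im * A) * 2 := by gcongr
        _ = _ := by ring
  have hzero : ∀ i, ∀ τ ∉ Jmp P c, ∀ z ∈ uhp, chi P τ z ≠ 0 → dbar (q i) z = 0 := by
    intro i τ hτ z hz h
    have hp : ∀ i, dbar (psi P c (a i)) z = 0 := fun i => by
      rw [dbar_psi c (a i) hz]
      exact Finset.sum_eq_zero fun v _ => by rw [dbar_phc_eq_zero hz hτ h, zero_mul]
    rw [hdq i z hz, hdE z hz]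
    simp [hp]
  have tame : ∀ i j, DTame P (Jmp P c) L fun z => q i z * dbar (q j) z := by
    intro i j
    refine ⟨((hqR i).of_le (by norm_num)).mul (contDiffOn_dbar isOpen_uhp (hqR j)), fun z hz => ?_,
      fun τ hτ z hz h => by
        change q i z * dbar (q j) z = 0
        rw [hzero j τ hτ z hz h, mul_zero]⟩
    rw [norm_mul, hL, mul_div_assoc]
    exact mul_le_mul (bq i z hz) (bdq j z hz) (norm_nonneg _) (by positivity)
  choose b B H hbC hbR hbD hrest using fun i j => hsol (Jmp P c) _ (tame i j) hJ
  have hqf : ∀ z ∈ uhp, ∑ i, q i z * f i z = 1 := by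
    intro z hz
    have : ∀ i ∈ Finset.univ, q i z * f i z = psi P c (a i) z * f i z * (E z)⁻¹ := fun i _ => by
      simp only [hq]; ring
    rw [Finset.sum_congr rfl this, ← Finset.sum_mul]
    exact mul_inv_cancel₀ (hE0 z hz)
  have hdqf : ∀ z ∈ uhp, ∑ i, dbar (q i) z * f i z = 0 := by
    intro z hz
    have h1 : (fun z => ∑ i, q i z * f i z) =ᶠ[𝓝 z] fun _ => 1 := by
      filter_upwards [isOpen_uhp.mem_nhds hz] with s hs using hqf s hs
    have h2 := dbar_congr h1
    rw [dbar_const, dbar_sum _ fun i _ => (dif (hqR i) z hz).fun_mul (dif (hfR i) z hz)] at h2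
    rw [← h2]
    refine Finset.sum_congr rfl fun i _ => ?_
    rw [dbar_mul (dif (hqR i) z hz) (dif (hfR i) z hz), dbar_of_differentiableAt (hfC i z hz),
      mul_zero, zero_add]
  refine ⟨fun i z => q i z + ∑ j, (b i j z - b j i z) * f j z, fun i z hz => ?_, fun i z hz => ?_,
    fun z hz => ?_⟩
  · have hsd : ∀ j, DifferentiableAt ℝ (fun z => (b i j z - b j i z) * f j z) z := fun j =>
      ((hbR i j z hz).fun_sub (hbR j i z hz)).mul (dif (hfR j) z hz)
    have hsum : DifferentiableAt ℝ (fun z => ∑ j, (b i j z - b j i z) * f j z) z :=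
      DifferentiableAt.fun_sum fun j _ => hsd j
    refine (differentiableAt_of_dbar ((dif (hqR i) z hz).add hsum) ?_).differentiableWithinAt
    change dbar (fun z => q i z + ∑ j, (b i j z - b j i z) * f j z) z = 0
    rw [dbar_add (dif (hqR i) z hz) hsum, dbar_sum _ fun j _ => hsd j]
    have h1 : ∀ j ∈ Finset.univ, dbar (fun z => (b i j z - b j i z) * f j z) z =
        q i z * (dbar (q j) z * f j z) - dbar (q i) z * (q j z * f j z) := by
      intro j _
      rw [dbar_mul ((hbR i j z hz).fun_sub (hbR j i z hz)) (dif (hfR j) z hz),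
        dbar_of_differentiableAt (hfC j z hz), dbar_sub (hbR i j z hz) (hbR j i z hz),
        hbD i j z hz, hbD j i z hz]
      ring
    rw [Finset.sum_congr rfl h1, Finset.sum_sub_distrib, ← Finset.mul_sum, ← Finset.mul_sum,
      hdqf z hz, hqf z hz]
    ring
  · have h1 : ‖∑ j, (b i j z - b j i z) * f j z‖ ≤ ∑ _j : ι, (2 * C1) := by
      refine norm_sum_le_of_le _ fun j _ => ?_
      rw [norm_mul]
      refine (mul_le_of_le_one_right (norm_nonneg _) (hb j z hz)).trans ?_
      refine (norm_sub_le _ _).trans ?_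
      linarith [hbC i j z hz, hbC j i z hz]
    rw [Finset.sum_const, Finset.card_univ, nsmul_eq_mul] at h1
    refine (norm_add_le _ _).trans ?_
    linarith [bq i z hz]
  · have h1 : ∀ i ∈ Finset.univ, (q i z + ∑ j, (b i j z - b j i z) * f j z) * f i z =
        q i z * f i z + (∑ j, b i j z * f j z * f i z - ∑ j, b j i z * f j z * f i z) := by
      intro i _
      rw [add_mul, ← Finset.sum_sub_distrib, Finset.sum_mul]
      congr 1
      exact Finset.sum_congr rfl fun j _ => by ring
    rw [Finset.sum_congr rfl h1, Finset.sum_add_distrib, hqf z hz, Finset.sum_sub_distrib]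
    have h2 : ∑ i, ∑ j, b j i z * f j z * f i z = ∑ i, ∑ j, b i j z * f j z * f i z := by
      rw [Finset.sum_comm]
      exact Finset.sum_congr rfl fun i _ => Finset.sum_congr rfl fun j _ => by ring
    rw [h2, sub_self, add_zero]

end Corona

theorem exists_corona (ι : Type*) [Fintype ι] {δ : ℝ} (hδ : 0 < δ) : ∃ C : ℝ, 0 < C ∧
    ∀ f : ι → ℂ → ℂ, (∀ i, DifferentiableOn ℂ (f i) uhp) → (∀ i, ∀ z ∈ uhp, ‖f i z‖ ≤ 1) →
    (∀ z ∈ uhp, ∃ i, δ ≤ ‖f i z‖) →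
    ∃ g : ι → ℂ → ℂ, (∀ i, DifferentiableOn ℂ (g i) uhp) ∧ (∀ i, ∀ z ∈ uhp, ‖g i z‖ ≤ C) ∧
      ∀ z ∈ uhp, ∑ i, g i z * f i z = 1 := by
  classical
  set m : ℝ := (Fintype.card ι : ℝ) with hm
  have hm0 : 0 ≤ m := Nat.cast_nonneg _
  set ε := min 1 (δ / (8 * (m + 1))) with hε
  have hε0 : 0 < ε := lt_min one_pos (by positivity)
  have hεδ : ε * (8 * (m + 1)) ≤ δ := (le_div_iff₀ (by positivity)).1 (min_le_right _ _)
  obtain ⟨P, hP, hPε⟩ := exists_goodP (16 / ε)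
  obtain ⟨Gr, M, -, hcol⟩ := exists_coloring_pi ι hP hε0 (min_le_left _ _) hPε
  set N : (ι → Gr) → ℝ := fun v => ∑ k, ‖(v k : ℂ)‖ ^ 2 with hN
  set a : ι → (ι → Gr) → ℂ := fun i v => (starRingEnd ℂ) (v i) / N v with ha
  obtain ⟨C, hC, h⟩ := exists_corona_of_psi hP a M
  refine ⟨C, hC, fun f hd hb hlow => ?_⟩
  obtain ⟨c, hc, hJ⟩ := hcol f hd hb
  refine h c f hJ hd hb fun z hz => ?_
  have hX : ∀ v, ph P c v z ≠ 0 → ‖∑ i, a i v * f i z - 1‖ ≤ 1 / 2 := by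
    intro v hv
    obtain ⟨τ, rfl, hτ⟩ := exists_chi_ne_zero_of_ph hv
    set v := c τ
    obtain ⟨i, hi⟩ := hlow z hz
    have hvi : δ / 2 ≤ ‖(v i : ℂ)‖ := by
      have h1 := hc τ z hz hτ i
      have h2 := norm_sub_norm_le (f i z) (v i : ℂ)
      nlinarith
    have hNi : ∀ k, ‖(v k : ℂ)‖ ^ 2 ≤ N v := fun k =>
      Finset.single_le_sum (f := fun k => ‖(v k : ℂ)‖ ^ 2) (fun _ _ => by positivity) (Finset.mem_univ k)
    have hNpos : 0 < N v := lt_of_lt_of_le (pow_pos (lt_of_lt_of_le (by positivity) hvi) 2) (hNi i)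
    have hak : ∀ k, ‖a k v‖ ≤ 2 / δ := by
      intro k
      simp only [ha, norm_div, RCLike.norm_conj, norm_real, Real.norm_of_nonneg hNpos.le]
      rw [div_le_div_iff₀ hNpos hδ]
      have := hNi k
      have h1 := hNi i
      nlinarith [sq_nonneg (‖(v k : ℂ)‖ - δ / 2), norm_nonneg (v k : ℂ)]
    have h1 : ∑ k, a k v * v k = 1 := by
      have : ∀ k ∈ Finset.univ, a k v * v k = ((‖(v k : ℂ)‖ ^ 2 : ℝ) : ℂ) / N v := by
        intro k _
        simp only [ha]
        rw [div_mul_eq_mul_div, conj_mul']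
        push_cast
        rfl
      rw [Finset.sum_congr rfl this, ← Finset.sum_div, ← ofReal_sum]
      exact div_self (ofReal_ne_zero.2 hNpos.ne')
    rw [← h1, ← Finset.sum_sub_distrib]
    have h2 : ‖∑ k, (a k v * f k z - a k v * v k)‖ ≤ ∑ _k : ι, (2 / δ) * (2 * ε) := by
      refine norm_sum_le_of_le _ fun k _ => ?_
      rw [← mul_sub, norm_mul]
      exact mul_le_mul (hak k) (hc τ z hz hτ k) (norm_nonneg _) (by positivity)
    rw [Finset.sum_const, Finset.card_univ, nsmul_eq_mul] at h2
    refine h2.trans ?_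
    rw [← hm, show m * (2 / δ * (2 * ε)) = (4 * m * ε) / δ by ring, div_le_iff₀ hδ]
    nlinarith
  have hsum : ∑ i, psi P c (a i) z * f i z - 1 =
      ∑ v, (ph P c v z : ℂ) * (∑ i, a i v * f i z - 1) := by
    simp only [mul_sub, Finset.sum_sub_distrib, mul_one]
    rw [← ofReal_sum, sum_ph c z, ofReal_one]
    congr 1
    simp only [psi, Finset.sum_mul, Finset.mul_sum, phc]
    rw [Finset.sum_comm]
    exact Finset.sum_congr rfl fun _ _ => Finset.sum_congr rfl fun _ _ => by ring
  rw [hsum]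
  calc _ ≤ ∑ v, ph P c v z * (1 / 2) := by
        refine norm_sum_le_of_le _ fun v _ => ?_
        rw [norm_mul, norm_real, Real.norm_of_nonneg (ph_nonneg c v z)]
        rcases eq_or_ne (ph P c v z) 0 with h0 | h0
        · rw [h0, zero_mul, zero_mul]
        · exact mul_le_mul_of_nonneg_left (hX v h0) (ph_nonneg c v z)
    _ = 1 / 2 := by rw [← Finset.sum_mul, sum_ph c z, one_mul]

lemma exists_lipschitz_ph {Col : Type*} [Fintype Col] [DecidableEq Col] {P : ℕ} (hP : GoodP P) :
    ∃ C : ℝ, 0 < C ∧ ∀ (c : ℤ × ℤ → Col) (v : Col), ∀ z ∈ uhp, ∀ z', ‖z' - z‖ ≤ z.im / 2 →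
      |ph P c v z' - ph P c v z| ≤ C / z.im * ‖z' - z‖ := by
  obtain ⟨C, hC, hb⟩ := exists_dbar_phc_bound (Col := Col) hP
  refine ⟨8 * C, by positivity, fun c v z hz z' h => ?_⟩
  have hy : 0 < z.im := hz
  have him : ∀ s ∈ closedBall z (z.im / 2), z.im / 2 ≤ s.im := fun s hs => by
    have h1 := (abs_le.1 ((abs_im_le_norm (s - z)).trans (mem_closedBall_iff_norm.1 hs))).1
    rw [sub_im] at h1
    linarith
  have hmem : ∀ s ∈ closedBall z (z.im / 2), s ∈ uhp := fun s hs =>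
    lt_of_lt_of_le (by positivity) (him s hs)
  have hd : ∀ s ∈ closedBall z (z.im / 2), DifferentiableAt ℝ (ph P c v) s := fun s hs =>
    (contDiffAt_ph c v (n := 1) (hmem s hs)).differentiableAt one_ne_zero
  have hbd : ∀ s ∈ closedBall z (z.im / 2), ‖fderiv ℝ (ph P c v) s‖ ≤ 8 * C / z.im := by
    intro s hs
    have h1 : HasFDerivAt (phc P c v) (Complex.ofRealCLM.comp (fderiv ℝ (ph P c v) s)) s :=
      Complex.ofRealCLM.hasFDerivAt.comp s (hd s hs).hasFDerivAt
    have h2 := hb c v s (hmem s hs)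
    have h3 : dbar (phc P c v) s =
        ((fderiv ℝ (ph P c v) s 1 : ℝ) + I * (fderiv ℝ (ph P c v) s I : ℝ)) / 2 := by
      rw [dbar, h1.fderiv]
      rfl
    have h4 : C / s.im ≤ 2 * C / z.im := by
      rw [div_le_div_iff₀ (hmem s hs) hy]
      nlinarith [him s hs]
    have e1 : |fderiv ℝ (ph P c v) s 1| ≤ 4 * C / z.im := by
      have := (abs_re_le_norm (dbar (phc P c v) s)).trans (h2.trans h4)
      rw [h3] at this
      simp [abs_div] at this
      rw [show 4 * C / z.im = 2 * C / z.im * 2 by ring]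
      linarith
    have e2 : |fderiv ℝ (ph P c v) s I| ≤ 4 * C / z.im := by
      have := (abs_im_le_norm (dbar (phc P c v) s)).trans (h2.trans h4)
      rw [h3] at this
      simp [abs_div] at this
      rw [show 4 * C / z.im = 2 * C / z.im * 2 by ring]
      linarith
    refine ContinuousLinearMap.opNorm_le_bound _ (by positivity) fun w => ?_
    have e3 : fderiv ℝ (ph P c v) s w =
        w.re * fderiv ℝ (ph P c v) s 1 + w.im * fderiv ℝ (ph P c v) s I := by
      conv_lhs => rw [show w = w.re • (1 : ℂ) + w.im • I by
      rw [real_smul, real_smul, mul_one, re_add_im]]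
      rw [map_add, map_smul, map_smul, smul_eq_mul, smul_eq_mul]
    rw [e3, Real.norm_eq_abs]
    refine (abs_add_le _ _).trans ?_
    rw [abs_mul, abs_mul]
    calc _ ≤ ‖w‖ * (4 * C / z.im) + ‖w‖ * (4 * C / z.im) := by
          gcongr
          · exact abs_re_le_norm w
          · exact abs_im_le_norm w
      _ = _ := by ring
  have := (convex_closedBall z (z.im / 2)).norm_image_sub_le_of_norm_fderiv_le hd hbd
    (mem_closedBall_self (by positivity)) (mem_closedBall_iff_norm.2 h)
  simpa using this

theorem exists_blaschke {Z : ℤ × ℤ → ℂ} {s : Set (ℤ × ℤ)} {M : ℝ} (hZ : ∀ i ∈ s, 0 < (Z i).im)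
    (hM : Carl Z s M) : ∃ B : ℂ → ℂ, DifferentiableOn ℂ B uhp ∧ (∀ z ∈ uhp, ‖B z‖ ≤ 1) ∧
      (∀ z ∈ uhp, ∀ i ∈ s, ‖B z‖ ≤ ‖bl (Z i) z‖) ∧
      ∀ z ∈ uhp, ∀ δ : ℝ, 0 < δ → (∀ i ∈ s, δ ≤ ‖bl (Z i) z‖) → Real.exp (-(M / δ ^ 2)) ≤ ‖B z‖ := by
  classical
  set t : ℕ → Finset (ℤ × ℤ) := fun N => (sqBox N).filter (· ∈ s) with ht
  have hts : ∀ N, ∀ i ∈ t N, i ∈ s := fun N i hi => (Finset.mem_filter.1 hi).2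
  set F : ℕ → ℂ → ℂ := fun N z => ∏ i ∈ t N, bl (Z i) z with hF
  have h1 : ∀ N, ∀ z ∈ uhp, ‖F N z‖ ≤ 1 := fun N z hz =>
    norm_prod_bl_le_one (fun i hi => hZ i (hts N i hi)) hz
  have hlim : ∀ z ∈ uhp, Filter.Tendsto (fun N => F N z) (Filter.hyperfilter ℕ)
      (𝓝 (ulim fun N => F N z)) := fun z hz =>
    tendsto_ulim (Filter.Eventually.of_forall fun N => h1 N z hz)
  refine ⟨fun z => ulim fun N => F N z, differentiableOn_ulim isOpen_uhp (M := 1)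
    (Filter.Eventually.of_forall fun N => ⟨?_, h1 N⟩), fun z hz =>
    norm_ulim_le (Filter.Eventually.of_forall fun N => h1 N z hz), fun z hz i hi => ?_,
    fun z hz δ hδ h => ?_⟩
  · exact DifferentiableOn.fun_finsetProd fun i hi => differentiableOn_bl (hZ i (hts N i hi))
  · obtain ⟨N0, hN0⟩ := eventually_subset_sqBox {i}
    refine le_of_tendsto (hlim z hz).norm ?_
    filter_upwards [eventually_hyperfilter_ge N0] with N hN
    exact norm_prod_bl_le (fun i hi => hZ i (hts N i hi)) hz
      (Finset.mem_filter.2 ⟨hN0 N hN (Finset.mem_singleton_self i), hi⟩)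
  · refine ge_of_tendsto (hlim z hz).norm (Filter.Eventually.of_forall fun N => ?_)
    exact exp_le_prod_norm_bl (fun i hi => hZ i (hts N i hi)) hz
      (hM z hz _ fun i hi => hts N i hi) hδ fun i hi => h i (hts N i hi)

/-- The point with relative position `q` in the brick `τ`. -/
def brickPt (P : ℕ) (q : ℂ) (τ : ℤ × ℤ) : ℂ := bc P τ + bw P τ.1 * q

lemma norm_brickPt_sub {P : ℕ} (hP : GoodP P) {q : ℂ} (hq : ‖q‖ ≤ 3 / 2) (τ : ℤ × ℤ) :
    ‖brickPt P q τ - bc P τ‖ ≤ 3 / 8 * bh P τ.1 := by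
  rw [brickPt, add_sub_cancel_left, norm_mul, norm_real, Real.norm_of_nonneg (bw_pos hP _).le]
  calc _ ≤ bh P τ.1 / 4 * (3 / 2) :=
        mul_le_mul (bw_le hP _) hq (norm_nonneg _) (by linarith [bh_pos P τ.1])
    _ = _ := by ring

lemma le_im_brickPt {P : ℕ} (hP : GoodP P) {q : ℂ} (hq : ‖q‖ ≤ 3 / 2) (τ : ℤ × ℤ) :
    5 / 8 * bh P τ.1 ≤ (brickPt P q τ).im := by
  have h1 := (abs_le.1 ((abs_im_le_norm _).trans (norm_brickPt_sub hP hq τ))).1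
  rw [sub_im] at h1
  have h2 : (bc P τ).im = bh P τ.1 := rfl
  linarith

lemma brickPt_mem {P : ℕ} (hP : GoodP P) {q : ℂ} (hq : ‖q‖ ≤ 3 / 2) (τ : ℤ × ℤ) :
    0 < (brickPt P q τ).im :=
  lt_of_lt_of_le (by linarith [bh_pos P τ.1]) (le_im_brickPt hP hq τ)

lemma bw_le_im_brickPt {P : ℕ} (hP : GoodP P) {q : ℂ} (hq : ‖q‖ ≤ 3 / 2) (τ : ℤ × ℤ) :
    bw P τ.1 ≤ (brickPt P q τ).im / 2 := by
  linarith [bw_le hP τ.1, le_im_brickPt hP hq τ, bh_pos P τ.1]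

lemma Carl.brickPt {P : ℕ} (hP : GoodP P) {q : ℂ} (hq : ‖q‖ ≤ 3 / 2) {J S : Set (ℤ × ℤ)} {M : ℝ}
    (hJ : Carl (bc P) J M) (hS : S ⊆ J) : Carl (brickPt P q) S (8 * M) := by
  intro z hz t ht
  have h1 : ∀ τ ∈ t, cs z (_root_.brickPt P q τ) ≤ 8 * cs z (bc P τ) := by
    intro τ _
    have hb := norm_brickPt_sub hP hq τ
    have hi := le_im_brickPt hP hq τ
    have h0 := bh_pos P τ.1
    have := cs_le_mul (K := 1) hz (brickPt_mem hP hq τ) (bc_mem P τ) zero_le_one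
      (hb.trans (by change _ ≤ 1 * bh P τ.1; linarith)) (hb.trans (by linarith))
    norm_num at this
    exact this
  refine (Finset.sum_le_sum h1).trans ?_
  rw [← Finset.mul_sum]
  exact mul_le_mul_of_nonneg_left (hJ z hz t (ht.trans hS)) (by norm_num)

lemma le_norm_bl {s p : ℂ} (hs : 0 < s.im) (hp : 0 < p.im) {r : ℝ} (hr : 0 < r) (hr1 : r ≤ 1)
    (h : r * p.im ≤ ‖s - p‖) : r / 3 ≤ ‖bl p s‖ := by
  have h0 : 0 < ‖s - (starRingEnd ℂ) p‖ := norm_pos_iff.2 (sub_conj_ne_zero hs hp)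
  rw [bl, norm_div, div_le_div_iff₀ (by norm_num) h0]
  have h1 : ‖s - (starRingEnd ℂ) p‖ ≤ ‖s - p‖ + 2 * p.im := by
    have e : s - (starRingEnd ℂ) p = (s - p) + (2 * p.im : ℝ) * I := by
      apply Complex.ext <;> simp
      ring
    rw [e]
    refine (norm_add_le _ _).trans ?_
    rw [norm_mul, norm_I, mul_one, norm_real, Real.norm_of_nonneg (by positivity)]
  have h2 := norm_nonneg (s - p)
  nlinarith

lemma norm_bl_le {s p : ℂ} (hs : 0 < s.im) (hp : 0 < p.im) {r : ℝ}
    (h : ‖s - p‖ ≤ r * p.im) : ‖bl p s‖ ≤ r := by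
  have h0 : 0 < ‖s - (starRingEnd ℂ) p‖ := norm_pos_iff.2 (sub_conj_ne_zero hs hp)
  rw [bl, norm_div, div_le_iff₀ h0]
  have h1 : p.im ≤ ‖s - (starRingEnd ℂ) p‖ := by
    have := (le_abs_self _).trans (abs_im_le_norm (s - (starRingEnd ℂ) p))
    simp only [sub_im, conj_im] at this
    linarith
  have hr : 0 ≤ r := by
    by_contra hn
    have := norm_nonneg (s - p)
    nlinarith
  exact h.trans (mul_le_mul_of_nonneg_left h1 hr)

theorem exists_near_separation {Col : Type*} [Fintype Col] [DecidableEq Col] {P : ℕ} (hP : GoodP P)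
    (M : ℝ) {a : ℝ} (ha : 0 < a) : ∃ (net : Finset ℂ) (e : ℝ), 0 < e ∧
    ∀ (c : ℤ × ℤ → Col) (v : Col), Carl (bc P) (Jmp P c) M → ∃ B : Bool → net → ℂ → ℂ,
      (∀ b q, DifferentiableOn ℂ (B b q) uhp) ∧ (∀ b q, ∀ z ∈ uhp, ‖B b q z‖ ≤ 1) ∧
      (∀ q, ∀ z ∈ uhp, ph P c v z = 0 → e ≤ ‖B true q z‖) ∧
      (∀ q, ∀ z ∈ uhp, a ≤ ph P c v z → e ≤ ‖B false q z‖) ∧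
      ∀ z ∈ uhp, (∃ τ ∈ Jmp P c, ‖z - bc P τ‖ < 3 / 2 * bw P τ.1) → ∃ q,
        (a ≤ ph P c v z → ‖B true q z‖ ≤ e / 2) ∧ (ph P c v z = 0 → ‖B false q z‖ ≤ e / 2) := by
  classical
  obtain ⟨C, hC, hlip⟩ := exists_lipschitz_ph (Col := Col) hP
  set r := min (1 / 2) (a / (2 * C)) with hr
  have hr0 : 0 < r := by positivity
  have hr1 : r ≤ 1 / 2 := min_le_left _ _
  have hrC : C * r ≤ a / 2 := by
    have := (le_div_iff₀ (by positivity)).1 (min_le_right (1 / 2) (a / (2 * C)))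
    rw [← hr] at this
    linarith
  have far : ∀ (c : ℤ × ℤ → Col) (v : Col), ∀ s ∈ uhp, ∀ p ∈ uhp,
      a / 2 ≤ |ph P c v s - ph P c v p| → r / 3 ≤ ‖bl p s‖ := by
    intro c v s hs p hp h
    have hp' : 0 < p.im := hp
    refine le_norm_bl hs hp hr0 (by linarith) ?_
    by_contra! hn
    have h1 := hlip c v p hp s (by nlinarith)
    have h2 : C / p.im * ‖s - p‖ < C / p.im * (r * p.im) :=
      mul_lt_mul_of_pos_left hn (by positivity)
    have h3 : C / p.im * (r * p.im) = C * r := by field_simp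
    linarith
  set e := Real.exp (-(8 * M / (r / 3) ^ 2)) with he
  have he0 : 0 < e := Real.exp_pos _
  set θ := min r (e / 2) with hθ
  have hθ0 : 0 < θ := by positivity
  obtain ⟨t, hts, htf, hcov⟩ := (isCompact_closedBall (0 : ℂ) (3 / 2)).finite_cover_balls hθ0
  have hq : ∀ q : htf.toFinset, ‖(q : ℂ)‖ ≤ 3 / 2 := fun q => by
    simpa using hts (htf.mem_toFinset.1 q.2)
  refine ⟨htf.toFinset, e, he0, fun c v hJ => ?_⟩
  set S : Bool → ℂ → Set (ℤ × ℤ) := fun b q => {τ | τ ∈ Jmp P c ∧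
    (b = true → a / 2 ≤ ph P c v (brickPt P q τ)) ∧ (b = false → ph P c v (brickPt P q τ) ≤ a / 2)}
    with hS
  choose B hBd hB1 hBs hBl using fun (b : Bool) (q : htf.toFinset) =>
    exists_blaschke (Z := brickPt P q) (s := S b q) (fun i _ => brickPt_mem hP (hq q) i)
      (hJ.brickPt hP (hq q) fun τ hτ => hτ.1)
  refine ⟨B, hBd, hB1, fun q z hz h => ?_, fun q z hz h => ?_, fun z hz h => ?_⟩
  · refine hBl true q z hz (r / 3) (by positivity) fun τ hτ => ?_
    refine far c v z hz _ (brickPt_mem hP (hq q) τ) ?_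
    rw [h, zero_sub, abs_neg]
    exact (hτ.2.1 rfl).trans (le_abs_self _)
  · refine hBl false q z hz (r / 3) (by positivity) fun τ hτ => ?_
    refine far c v z hz _ (brickPt_mem hP (hq q) τ) (le_trans ?_ (le_abs_self _))
    linarith [hτ.2.2 rfl]
  · obtain ⟨τ, hτ, hn⟩ := h
    have hw := bw_pos hP τ.1
    have hwc : (bw P τ.1 : ℂ) ≠ 0 := ofReal_ne_zero.2 hw.ne'
    set q0 := (z - bc P τ) / bw P τ.1 with hq0
    have hz0 : z = bc P τ + bw P τ.1 * q0 := by
      rw [hq0, mul_div_cancel₀ _ hwc]; ring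
    have hq0m : q0 ∈ closedBall (0 : ℂ) (3 / 2) := by
      rw [mem_closedBall_zero_iff, hq0, norm_div, norm_real, Real.norm_of_nonneg hw.le,
        div_le_iff₀ hw]
      exact hn.le
    obtain ⟨q, hqt, hqb⟩ := mem_iUnion₂.1 (hcov hq0m)
    set q' : htf.toFinset := ⟨q, htf.mem_toFinset.2 hqt⟩ with hq'
    have hp : 0 < (brickPt P q τ).im := brickPt_mem hP (hq q') τ
    have hdist : ‖z - brickPt P q τ‖ ≤ θ * (brickPt P q τ).im := by
      rw [brickPt]
      conv_lhs => rw [hz0]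
      rw [add_sub_add_left_eq_sub, ← mul_sub, norm_mul, norm_real, Real.norm_of_nonneg hw.le]
      have h1 := bw_le_im_brickPt hP (hq q') τ
      have h2 : ‖q0 - q‖ ≤ θ := by rw [← dist_eq_norm]; exact (mem_ball.1 hqb).le
      change _ ≤ θ * (brickPt P q τ).im
      change _ ≤ (brickPt P q τ).im / 2 at h1
      have h3 := norm_nonneg (q0 - q)
      calc _ ≤ (brickPt P q τ).im * θ := mul_le_mul (by linarith) h2 h3 hp.le
        _ = _ := mul_comm _ _
    have hph : |ph P c v z - ph P c v (brickPt P q τ)| ≤ a / 2 := by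
      refine (hlip c v _ hp z (hdist.trans ?_)).trans ?_
      · have : θ ≤ 1 / 2 := (min_le_left _ _).trans hr1
        nlinarith
      · calc _ ≤ C / (brickPt P q τ).im * (r * (brickPt P q τ).im) := by
              gcongr
              exact hdist.trans (mul_le_mul_of_nonneg_right (min_le_left _ _) hp.le)
          _ = C * r := by field_simp
          _ ≤ a / 2 := hrC
    have hbl : ‖bl (brickPt P q τ) z‖ ≤ e / 2 := (norm_bl_le hz hp hdist).trans (min_le_right _ _)
    refine ⟨q', fun h => (hBs true q' z hz τ ⟨hτ, fun _ => ?_, fun h => absurd h (by decide)⟩).trans hbl,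
      fun h => (hBs false q' z hz τ ⟨hτ, fun h => absurd h (by decide), fun _ => ?_⟩).trans hbl⟩
    · have := (abs_le.1 hph).2
      change a / 2 ≤ ph P c v (brickPt P q τ)
      linarith
    · have := (abs_le.1 hph).1
      change ph P c v (brickPt P q τ) ≤ a / 2
      linarith

lemma norm_pow_sub_pow_le {x y : ℂ} (hx : ‖x‖ ≤ 1) (hy : ‖y‖ ≤ 1) (K : ℕ) :
    ‖x ^ K - y ^ K‖ ≤ K * ‖x - y‖ := by
  induction K with
  | zero => simp
  | succ K ih =>
    have e : x ^ (K + 1) - y ^ (K + 1) = x * (x ^ K - y ^ K) + (x - y) * y ^ K := by ring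
    rw [e]
    refine (norm_add_le _ _).trans ?_
    rw [norm_mul, norm_mul, norm_pow]
    have h1 : ‖x‖ * ‖x ^ K - y ^ K‖ ≤ ‖x ^ K - y ^ K‖ := mul_le_of_le_one_left (norm_nonneg _) hx
    have h2 : ‖x - y‖ * ‖y‖ ^ K ≤ ‖x - y‖ :=
      mul_le_of_le_one_right (norm_nonneg _) (pow_le_one₀ (norm_nonneg _) hy)
    push_cast
    linarith

theorem exists_far_separation {Col : Type*} [Fintype Col] [DecidableEq Col] {P : ℕ} (hP : GoodP P)
    (M : ℝ) {a : ℝ} (ha : 0 < a) : ∃ (b C : ℝ) (K : ℕ), 0 < b ∧ 1 ≤ C ∧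
    ∀ (c : ℤ × ℤ → Col) (v : Col), Carl (bc P) (Jmp P c) M → ∃ h B H : ℂ → ℂ,
      (DifferentiableOn ℂ h uhp ∧ DifferentiableOn ℂ B uhp ∧ DifferentiableOn ℂ H uhp) ∧
      (∀ z ∈ uhp, ‖h z‖ ≤ C ∧ ‖B z‖ ≤ 1 ∧ ‖H z‖ ≤ C) ∧
      ∀ z ∈ uhp, (∀ τ ∈ Jmp P c, 3 / 2 * bw P τ.1 ≤ ‖z - bc P τ‖) →
        b ≤ ‖B z‖ ∧ ‖(phc P c v z - h z) * B z ^ K - H z‖ ≤ a / 8 * ‖B z‖ ^ K := by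
  obtain ⟨C0, hC0, hphc⟩ := exists_dbar_phc_bound (Col := Col) hP
  obtain ⟨C, b, hC, hb, hsol⟩ := exists_dbar_solution hP hC0.le M
  obtain ⟨K, hK⟩ : ∃ K : ℕ, C * (2 / 3 : ℝ) ^ K ≤ a / 8 := by
    obtain ⟨K, hK⟩ := exists_pow_lt_of_lt_one (show 0 < a / 8 / C by positivity)
      (show (2 / 3 : ℝ) < 1 by norm_num)
    refine ⟨K, ?_⟩
    rw [lt_div_iff₀ hC] at hK
    linarith
  refine ⟨b, 1 + C + K * C, K, hb, by nlinarith [mul_nonneg (Nat.cast_nonneg (α := ℝ) K) hC.le],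
    fun c v hJ => ?_⟩
  have hKC : 0 ≤ K * C := by positivity
  obtain ⟨u, B, H, hu, hud, hudb, hB, hB1, hBb, hH⟩ := hsol (Jmp P c) (dbar (phc P c v))
    ⟨contDiffOn_dbar isOpen_uhp fun z hz => (contDiffAt_phc c v (n := 2) hz).contDiffWithinAt,
      hphc c v, fun τ hτ z hz h => dbar_phc_eq_zero hz hτ h⟩ hJ
  have hdp : ∀ z ∈ uhp, DifferentiableAt ℝ (phc P c v) z := fun z hz =>
    (contDiffAt_phc c v (n := 1) hz).differentiableAt one_ne_zero
  refine ⟨fun z => phc P c v z - u z, B, H K, ⟨fun z hz => ?_, hB, (hH K).1⟩,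
    fun z hz => ⟨?_, hB1 z hz, ?_⟩, fun z hz hfar => ⟨hBb z hz hfar, ?_⟩⟩
  · refine (differentiableAt_of_dbar ((hdp z hz).fun_sub (hud z hz)) ?_).differentiableWithinAt
    rw [dbar_sub (hdp z hz) (hud z hz), hudb z hz, sub_self]
  · refine (norm_sub_le _ _).trans ?_
    have h1 : ‖phc P c v z‖ ≤ 1 := by
      rw [phc, norm_real, Real.norm_of_nonneg (ph_nonneg c v z)]
      exact ph_le_one c v z
    linarith [hu z hz]
  · linarith [(hH K).2.1 z hz]
  · rw [sub_sub_cancel]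
    exact ((hH K).2.2 z hz hfar).trans (mul_le_mul_of_nonneg_right hK (by positivity))

lemma far_separation_aux {a b C : ℝ} (ha : 0 < a) (hb : 0 < b) (hC : 1 ≤ C) (K : ℕ) :
    ∃ κ : ℝ, 0 < κ ∧ ∀ φ h B H φ' h' B' H' : ℂ, ‖B‖ ≤ 1 → ‖B'‖ ≤ 1 → ‖H'‖ ≤ C → b ≤ ‖B‖ → b ≤ ‖B'‖ →
      ‖(φ - h) * B ^ K - H‖ ≤ a / 8 * ‖B‖ ^ K → ‖(φ' - h') * B' ^ K - H'‖ ≤ a / 8 * ‖B'‖ ^ K →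
      a ≤ ‖φ - φ'‖ → κ ≤ ‖h - h'‖ ∨ κ ≤ ‖B - B'‖ ∨ κ ≤ ‖H - H'‖ := by
  set D := 1 + (b ^ K)⁻¹ + C * K * (b ^ K)⁻¹ * (b ^ K)⁻¹ with hD
  have hD0 : 0 < D := by positivity
  refine ⟨a / (2 * D), by positivity, fun φ h B H φ' h' B' H' hB hB' hH' hb1 hb2 h1 h2 hφ => ?_⟩
  by_contra! hn
  obtain ⟨n1, n2, n3⟩ := hn
  set κ := a / (2 * D) with hκ
  have hκD : κ * D = a / 2 := by rw [hκ]; field_simp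
  have hκ0 : 0 < κ := by positivity
  have hB0 : B ≠ 0 := norm_pos_iff.1 (hb.trans_le hb1)
  have hB0' : B' ≠ 0 := norm_pos_iff.1 (hb.trans_le hb2)
  have p1 : 0 < ‖B‖ ^ K := pow_pos (hb.trans_le hb1) K
  have p2 : 0 < ‖B'‖ ^ K := pow_pos (hb.trans_le hb2) K
  have i1 : (‖B‖ ^ K)⁻¹ ≤ (b ^ K)⁻¹ := inv_anti₀ (by positivity) (pow_le_pow_left₀ hb.le hb1 K)
  have i2 : (‖B'‖ ^ K)⁻¹ ≤ (b ^ K)⁻¹ := inv_anti₀ (by positivity) (pow_le_pow_left₀ hb.le hb2 K)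
  have e1 : ‖(φ - h) - H / B ^ K‖ ≤ a / 8 := by
    have : (φ - h) - H / B ^ K = ((φ - h) * B ^ K - H) / B ^ K := by field_simp
    rw [this, norm_div, norm_pow, div_le_iff₀ p1]
    exact h1
  have e2 : ‖(φ' - h') - H' / B' ^ K‖ ≤ a / 8 := by
    have : (φ' - h') - H' / B' ^ K = ((φ' - h') * B' ^ K - H') / B' ^ K := by field_simp
    rw [this, norm_div, norm_pow, div_le_iff₀ p2]
    exact h2
  have e3 : ‖H / B ^ K - H' / B' ^ K‖ ≤ κ * (b ^ K)⁻¹ + C * (K * κ) * ((b ^ K)⁻¹ * (b ^ K)⁻¹) := by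
    have : H / B ^ K - H' / B' ^ K =
        (H - H') * (B ^ K)⁻¹ + H' * (B' ^ K - B ^ K) * ((B ^ K)⁻¹ * (B' ^ K)⁻¹) := by
      field_simp
      ring
    rw [this]
    refine (norm_add_le _ _).trans ?_
    simp only [norm_mul, norm_inv, norm_pow]
    have h3 : ‖B' ^ K - B ^ K‖ ≤ K * κ := by
      refine (norm_pow_sub_pow_le hB' hB K).trans ?_
      rw [norm_sub_rev]
      gcongr
    gcongr
  have e4 : φ - φ' = (h - h') + (H / B ^ K - H' / B' ^ K) + (((φ - h) - H / B ^ K) -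
      ((φ' - h') - H' / B' ^ K)) := by ring
  have e5 : ‖φ - φ'‖ ≤ ‖h - h'‖ + ‖H / B ^ K - H' / B' ^ K‖ + (‖(φ - h) - H / B ^ K‖ +
      ‖(φ' - h') - H' / B' ^ K‖) := by
    conv_lhs => rw [e4]
    exact (norm_add_le _ _).trans (add_le_add (norm_add_le _ _) (norm_sub_le _ _))
  have e6 : κ * D = κ + κ * (b ^ K)⁻¹ + C * (K * κ) * ((b ^ K)⁻¹ * (b ^ K)⁻¹) := by
    rw [hD]; ring
  linarith

/-- Finitely many uniformly bounded holomorphic functions separate the set where a color is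
prominent from the set where it is absent. -/
theorem exists_separation {Col : Type*} [Fintype Col] [DecidableEq Col] {P : ℕ} (hP : GoodP P)
    (M : ℝ) {a : ℝ} (ha : 0 < a) : ∃ (net : Finset ℂ) (κ C : ℝ), 0 < κ ∧
    ∃ F : (ℤ × ℤ → Col) → Col → (Fin 3 ⊕ Bool × net) → ℂ → ℂ,
      (∀ c v i, Carl (bc P) (Jmp P c) M → DifferentiableOn ℂ (F c v i) uhp ∧ ∀ z ∈ uhp, ‖F c v i z‖ ≤ C) ∧
      ∀ c c' v, Carl (bc P) (Jmp P c) M → Carl (bc P) (Jmp P c') M → ∀ z ∈ uhp, ∀ z' ∈ uhp,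
        a ≤ ph P c v z → ph P c' v z' = 0 → ∃ i, κ ≤ ‖F c v i z - F c' v i z'‖ := by
  classical
  obtain ⟨net, e, he, hnear⟩ := exists_near_separation (Col := Col) hP M ha
  obtain ⟨b, C, K, hb, hC, hfar⟩ := exists_far_separation (Col := Col) hP M ha
  obtain ⟨κ, hκ, haux⟩ := far_separation_aux ha hb hC K
  have hex : ∀ (c : ℤ × ℤ → Col) (v : Col), ∃ F : (Fin 3 ⊕ Bool × net) → ℂ → ℂ,
      Carl (bc P) (Jmp P c) M →
      (∀ i, DifferentiableOn ℂ (F i) uhp ∧ ∀ z ∈ uhp, ‖F i z‖ ≤ C) ∧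
      ((∀ q, ∀ z ∈ uhp, ph P c v z = 0 → e ≤ ‖F (.inr (true, q)) z‖) ∧
      (∀ q, ∀ z ∈ uhp, a ≤ ph P c v z → e ≤ ‖F (.inr (false, q)) z‖) ∧
      ∀ z ∈ uhp, (∃ τ ∈ Jmp P c, ‖z - bc P τ‖ < 3 / 2 * bw P τ.1) → ∃ q,
        (a ≤ ph P c v z → ‖F (.inr (true, q)) z‖ ≤ e / 2) ∧
        (ph P c v z = 0 → ‖F (.inr (false, q)) z‖ ≤ e / 2)) ∧
      (∀ z ∈ uhp, ‖F (.inl 1) z‖ ≤ 1) ∧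
      ∀ z ∈ uhp, (∀ τ ∈ Jmp P c, 3 / 2 * bw P τ.1 ≤ ‖z - bc P τ‖) →
        b ≤ ‖F (.inl 1) z‖ ∧ ‖(phc P c v z - F (.inl 0) z) * F (.inl 1) z ^ K - F (.inl 2) z‖ ≤
          a / 8 * ‖F (.inl 1) z‖ ^ K := by
    intro c v
    by_cases hJ : Carl (bc P) (Jmp P c) M
    · obtain ⟨B, hBd, hB1, hB⟩ := hnear c v hJ
      obtain ⟨h, B', H, ⟨d1, d2, d3⟩, hbd, hf⟩ := hfar c v hJ
      refine ⟨Sum.elim ![h, B', H] fun x => B x.1 x.2, fun _ => ⟨?_, hB, fun z hz => (hbd z hz).2.1, hf⟩⟩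
      rintro (i | ⟨x, q⟩)
      · fin_cases i
        · exact ⟨d1, fun z hz => (hbd z hz).1⟩
        · exact ⟨d2, fun z hz => (hbd z hz).2.1.trans hC⟩
        · exact ⟨d3, fun z hz => (hbd z hz).2.2⟩
      · exact ⟨hBd x q, fun z hz => (hB1 x q z hz).trans hC⟩
    · exact ⟨fun _ _ => 0, fun h => absurd h hJ⟩
  choose F hF using hex
  refine ⟨net, min κ (e / 2), C, by positivity, F, fun c v i hJ => (hF c v hJ).1 i,
    fun c c' v hJ hJ' z hz z' hz' h h' => ?_⟩
  obtain ⟨f1, ⟨f2, f3, f4⟩, f5, f6⟩ := hF c v hJ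
  obtain ⟨g1, ⟨g2, g3, g4⟩, g5, g6⟩ := hF c' v hJ'
  by_cases hn : ∃ τ ∈ Jmp P c, ‖z - bc P τ‖ < 3 / 2 * bw P τ.1
  · obtain ⟨q, hq, -⟩ := f4 z hz hn
    refine ⟨.inr (true, q), (min_le_right _ _).trans ?_⟩
    have h1 := g2 q z' hz' h'
    have h2 := hq h
    have h3 := norm_sub_norm_le (F c' v (.inr (true, q)) z') (F c v (.inr (true, q)) z)
    rw [norm_sub_rev] at h3
    linarith
  by_cases hn' : ∃ τ ∈ Jmp P c', ‖z' - bc P τ‖ < 3 / 2 * bw P τ.1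
  · obtain ⟨q, -, hq⟩ := g4 z' hz' hn'
    refine ⟨.inr (false, q), (min_le_right _ _).trans ?_⟩
    have h1 := f3 q z hz h
    have h2 := hq h'
    have h3 := norm_sub_norm_le (F c v (.inr (false, q)) z) (F c' v (.inr (false, q)) z')
    linarith
  push Not at hn hn'
  obtain ⟨a1, a2⟩ := f6 z hz hn
  obtain ⟨b1, b2⟩ := g6 z' hz' hn'
  have hφ : a ≤ ‖phc P c v z - phc P c' v z'‖ := by
    rw [phc, phc, h', ofReal_zero, sub_zero, norm_real]
    exact h.trans (le_abs_self _)
  rcases haux _ _ _ _ _ _ _ _ (f5 z hz) (g5 z' hz') ((g1 (.inl 2)).2 z' hz') a1 b1 a2 b2 hφ with k | k | k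
  · exact ⟨.inl 0, (min_le_left _ _).trans k⟩
  · exact ⟨.inl 1, (min_le_left _ _).trans k⟩
  · exact ⟨.inl 2, (min_le_left _ _).trans k⟩

lemma HinfDiskNat.exists_eq (f : HinfDiskNat) (n : ℕ) : ∃ g : ℂ → ℂ, DifferentiableOn ℂ g unitDisk ∧
    ∀ z : unitDisk, f.1 (z, n) = g z := f.2 n

lemma exists_hinf (F : ℕ → ℂ → ℂ) (C : ℝ) (hF : ∀ n, DifferentiableOn ℂ (F n) unitDisk)
    (hb : ∀ n, ∀ z ∈ unitDisk, ‖F n z‖ ≤ C) :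
    ∃ f : HinfDiskNat, ∀ p : DiskNat, f.1 p = F p.2 p.1 := by
  have hc : Continuous fun p : DiskNat => F p.2 p.1 := by
    rw [continuous_prod_of_discrete_right]
    intro n
    exact continuousOn_iff_continuous_domRestrict.1 (hF n).continuousOn
  exact ⟨⟨BoundedContinuousFunction.ofNormedAddCommGroup _ hc C fun p => hb p.2 p.1 p.1.2,
    fun n => ⟨F n, hF n, fun z => rfl⟩⟩, fun p => rfl⟩

lemma isClosed_hinf : IsClosed (HinfDiskNat : Set (DiskNat →ᵇ ℂ)) := by
  classical
  rw [← isSeqClosed_iff_isClosed]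
  intro f F hf hF n
  choose g hg hfg using fun k => hf k n
  refine ⟨fun z => if h : z ∈ unitDisk then F (⟨z, h⟩, n) else 0, ?_, fun z => by dsimp only; rw [dif_pos z.2]⟩
  have hu : TendstoUniformlyOn g (fun z => if h : z ∈ unitDisk then F (⟨z, h⟩, n) else 0)
      Filter.atTop unitDisk := by
    rw [Metric.tendstoUniformlyOn_iff]
    intro ε hε
    have := BoundedContinuousFunction.tendsto_iff_tendstoUniformly.1 hF
    rw [Metric.tendstoUniformly_iff] at this
    filter_upwards [this ε hε] with k hk z hz
    rw [dif_pos hz, ← hfg k ⟨z, hz⟩]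
    exact hk _
  exact hu.tendstoLocallyUniformlyOn.differentiableOn (Filter.Eventually.of_forall hg) isOpen_ball

instance : CompleteSpace HinfDiskNat := isClosed_hinf.completeSpace_coe

lemma norm_apply_le (f : HinfDiskNat) (p : DiskNat) : ‖f.1 p‖ ≤ ‖f‖ := f.1.norm_coe_le_norm p

/-- Evaluation at a point, as a character. -/
def evChar (p : DiskNat) : MaxIdealSpaceDiskNat :=
  ⟨StrongDual.toWeakDual ((BoundedContinuousFunction.evalCLM ℂ p).comp HinfDiskNat.toSubmodule.subtypeL), by
    constructor
    · intro h
      have := DFunLike.congr_fun h (1 : HinfDiskNat)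
      exact one_ne_zero this
    · intro f g
      rfl⟩

lemma evChar_apply (p : DiskNat) (f : HinfDiskNat) : evChar p f = f.1 p := rfl

lemma isInducing_coe : IsInducing (fun (x : MaxIdealSpaceDiskNat) (f : HinfDiskNat) => x f) := by
  have h1 : IsInducing (fun (x : WeakDual ℂ HinfDiskNat) (f : HinfDiskNat) => x f) := ⟨rfl⟩
  exact h1.comp IsInducing.subtypeVal

lemma continuous_apply_hinf (f : HinfDiskNat) : Continuous fun x : MaxIdealSpaceDiskNat => x f :=
  (continuous_apply f).comp isInducing_coe.continuous

lemma exists_finset_of_mem_nhds {x : MaxIdealSpaceDiskNat} {U : Set MaxIdealSpaceDiskNat}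
    (hU : U ∈ 𝓝 x) : ∃ (S : Finset HinfDiskNat) (ε : ℝ), 0 < ε ∧
      ∀ y : MaxIdealSpaceDiskNat, (∀ f ∈ S, ‖y f - x f‖ < ε) → y ∈ U := by
  rw [isInducing_coe.nhds_eq_comap] at hU
  obtain ⟨V, hV, hVU⟩ := hU
  rw [nhds_pi, Filter.mem_pi] at hV
  obtain ⟨I, hI, t, ht, hIV⟩ := hV
  choose r hr hrt using fun f => Metric.mem_nhds_iff.1 (ht f)
  obtain ⟨ε, hε, hεr⟩ : ∃ ε > 0, ∀ f ∈ hI.toFinset, ε ≤ r f := by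
    rcases hI.toFinset.eq_empty_or_nonempty with h | h
    · exact ⟨1, one_pos, by simp [h]⟩
    · exact ⟨hI.toFinset.inf' h r, (Finset.lt_inf'_iff h).2 fun f _ => hr f, fun f hf =>
        Finset.inf'_le r hf⟩
  refine ⟨hI.toFinset, ε, hε, fun y hy => hVU (hIV fun f hf => hrt f ?_)⟩
  have hf' := hI.mem_toFinset.2 hf
  exact mem_ball_iff_norm.2 ((hy f hf').trans_le (hεr f hf'))

/-- The Cayley transform from the upper half plane to the disk. -/
def cay (z : ℂ) : ℂ := (z - I) / (z + I)

/-- The inverse Cayley transform. -/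
def cayInv (w : ℂ) : ℂ := I * (1 + w) / (1 - w)

lemma add_I_ne_zero {z : ℂ} (hz : z ∈ uhp) : z + I ≠ 0 := by
  intro h
  have h1 := congrArg Complex.im h
  have h2 : 0 < z.im := hz
  simp at h1
  linarith

lemma one_sub_ne_zero {w : ℂ} (hw : w ∈ unitDisk) : 1 - w ≠ 0 := by
  intro h
  have : w = 1 := by linear_combination -h
  rw [mem_ball_zero_iff, this] at hw
  simp at hw

lemma cay_mem {z : ℂ} (hz : z ∈ uhp) : cay z ∈ unitDisk := by
  have h2 : 0 < z.im := hz
  rw [mem_ball_zero_iff, cay, norm_div, div_lt_one (norm_pos_iff.2 (add_I_ne_zero hz))]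
  rw [← sq_lt_sq₀ (norm_nonneg _) (norm_nonneg _), ← Complex.normSq_eq_norm_sq,
    ← Complex.normSq_eq_norm_sq, Complex.normSq_apply, Complex.normSq_apply]
  simp
  nlinarith

lemma cayInv_mem {w : ℂ} (hw : w ∈ unitDisk) : cayInv w ∈ uhp := by
  have h0 := one_sub_ne_zero hw
  rw [mem_ball_zero_iff, ← sq_lt_one_iff₀ (norm_nonneg _), ← Complex.normSq_eq_norm_sq,
    Complex.normSq_apply] at hw
  change 0 < (cayInv w).im
  have h1 : 0 < Complex.normSq (1 - w) := Complex.normSq_pos.2 h0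
  have : (cayInv w).im = (1 - (w.re * w.re + w.im * w.im)) / Complex.normSq (1 - w) := by
    rw [cayInv, Complex.div_im]
    simp
    field_simp
    ring
  rw [this]
  exact div_pos (by linarith) h1

lemma cay_cayInv {w : ℂ} (hw : w ∈ unitDisk) : cay (cayInv w) = w := by
  have h0 := one_sub_ne_zero hw
  have h1 := add_I_ne_zero (cayInv_mem hw)
  rw [cay, div_eq_iff h1, cayInv]
  field_simp
  ring

lemma cayInv_cay {z : ℂ} (hz : z ∈ uhp) : cayInv (cay z) = z := by
  have h0 := one_sub_ne_zero (cay_mem hz)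
  have h1 := add_I_ne_zero hz
  rw [cayInv, div_eq_iff h0, cay]
  field_simp
  ring

lemma differentiableOn_cay : DifferentiableOn ℂ cay uhp := fun _ hz =>
  ((differentiableAt_id.sub_const I).div (differentiableAt_id.add_const I)
    (add_I_ne_zero hz)).differentiableWithinAt

lemma differentiableOn_cayInv : DifferentiableOn ℂ cayInv unitDisk := fun w hw => by
  have h0 := one_sub_ne_zero hw
  refine DifferentiableAt.differentiableWithinAt ?_
  unfold cayInv
  fun_prop (disch := assumption)

/-- Bounded holomorphic functions on copies of the upper half plane transfer to `HinfDiskNat`. -/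
lemma exists_hinf_uhp (F : ℕ → ℂ → ℂ) (C : ℝ) (hF : ∀ n, DifferentiableOn ℂ (F n) uhp)
    (hb : ∀ n, ∀ z ∈ uhp, ‖F n z‖ ≤ C) :
    ∃ f : HinfDiskNat, ∀ p : DiskNat, f.1 p = F p.2 (cayInv p.1) :=
  exists_hinf (fun n z => F n (cayInv z)) C
    (fun n => (hF n).comp differentiableOn_cayInv fun _ => cayInv_mem)
    fun n _ hz => hb n _ (cayInv_mem hz)

lemma exists_uhp_of_hinf (f : HinfDiskNat) (n : ℕ) : ∃ g : ℂ → ℂ, DifferentiableOn ℂ g uhp ∧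
    (∀ z ∈ uhp, ‖g z‖ ≤ ‖f‖) ∧ ∀ z : unitDisk, f.1 (z, n) = g (cayInv z) := by
  obtain ⟨g, hg, hfg⟩ := HinfDiskNat.exists_eq f n
  refine ⟨fun z => g (cay z), hg.comp differentiableOn_cay fun _ => cay_mem, fun z hz => ?_,
    fun z => ?_⟩
  · have := norm_apply_le f (⟨cay z, cay_mem hz⟩, n)
    rwa [hfg] at this
  · rw [hfg]
    dsimp only
    rw [cay_cayInv z.2]

lemma corona_hinf {ι : Type} [Fintype ι] {δ : ℝ} (hδ : 0 < δ) (f : ι → HinfDiskNat)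
    (hf : ∀ i, ‖f i‖ ≤ 1) (h : ∀ p, ∃ i, δ ≤ ‖(f i).1 p‖) :
    ∃ g : ι → HinfDiskNat, ∑ i, g i * f i = 1 := by
  obtain ⟨C, hC, H⟩ := exists_corona ι hδ
  choose F hF hFb hFf using fun i n => exists_uhp_of_hinf (f i) n
  have key : ∀ n, ∀ z ∈ uhp, ∃ i, δ ≤ ‖F i n z‖ := by
    intro n z hz
    obtain ⟨i, hi⟩ := h (⟨cay z, cay_mem hz⟩, n)
    refine ⟨i, ?_⟩
    rw [hFf] at hi
    rwa [cayInv_cay hz] at hi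
  choose g hg hgb hgs using fun n => H (fun i => F i n) (fun i => hF i n)
    (fun i z hz => (hFb i n z hz).trans (hf i)) (key n)
  choose G hG using fun i => exists_hinf_uhp (fun n => g n i) C (fun n => hg n i)
    (fun n => hgb n i)
  refine ⟨G, Subtype.ext (BoundedContinuousFunction.ext fun p => ?_)⟩
  have h1 := hgs p.2 (cayInv p.1) (cayInv_mem p.1.2)
  rw [show ((∑ i, G i * f i : HinfDiskNat) : DiskNat →ᵇ ℂ) p
    = evChar p (∑ i, G i * f i) from rfl, map_sum]
  simp only [map_mul, evChar_apply, hG]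
  change _ = (1 : ℂ)
  rw [← h1]
  refine Finset.sum_congr rfl fun i _ => ?_
  rw [show p = (p.1, p.2) from rfl, hFf]

lemma exists_evChar_near (x : MaxIdealSpaceDiskNat) (S : Finset HinfDiskNat) {ε : ℝ} (hε : 0 < ε) :
    ∃ p, ∀ f ∈ S, ‖f.1 p - x f‖ < ε := by
  by_contra! hcon
  obtain ⟨R, hR, hRb⟩ : ∃ R : ℝ, 0 < R ∧ ∀ f ∈ S, ‖f - algebraMap ℂ _ (x f)‖ ≤ R := by
    refine ⟨1 + ∑ f ∈ S, ‖f - algebraMap ℂ HinfDiskNat (x f)‖, by positivity, fun f hf => ?_⟩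
    have := Finset.single_le_sum (f := fun f => ‖f - algebraMap ℂ HinfDiskNat (x f)‖)
      (fun i _ => norm_nonneg _) hf
    linarith
  obtain ⟨g, hg⟩ := corona_hinf (ι := S) (δ := ε / R) (by positivity)
    (fun f => (R⁻¹ : ℂ) • (f.1 - algebraMap ℂ HinfDiskNat (x f.1)))
    (fun f => by
      rw [norm_smul, norm_inv, Complex.norm_of_nonneg hR.le, inv_mul_le_one₀ hR]
      exact hRb f f.2)
    (fun p => by
      obtain ⟨f, hf, hle⟩ := hcon p
      refine ⟨⟨f, hf⟩, ?_⟩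
      rw [← evChar_apply, map_smul, map_sub, AlgHomClass.commutes, norm_smul, norm_inv,
        Complex.norm_of_nonneg hR.le, evChar_apply, div_eq_inv_mul]
      exact mul_le_mul_of_nonneg_left hle (by positivity))
  have h1 := congrArg x hg
  rw [map_sum, map_one] at h1
  refine one_ne_zero (h1.symm.trans (Finset.sum_eq_zero fun f _ => ?_))
  rw [map_mul, map_smul, map_sub, AlgHomClass.commutes]
  simp

lemma denseRange_evChar : DenseRange evChar := by
  intro x
  rw [mem_closure_iff_nhds]
  intro U hU
  obtain ⟨S, ε, hε, h⟩ := exists_finset_of_mem_nhds hU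
  obtain ⟨p, hp⟩ := exists_evChar_near x S hε
  exact ⟨evChar p, h _ hp, p, rfl⟩

/-- A dense subset carrying, for every open cover, a subordinate finite partition of unity of
order at most `n + 1` whose superlevel sets and zero sets have disjoint closures. -/
lemma covDimLE_of_partition {X D : Type} [TopologicalSpace X] {ev : D → X} (hev : DenseRange ev)
    (n : ℕ) (H : ∀ 𝒰 : Set (Set X), (∀ U ∈ 𝒰, IsOpen U) → ⋃₀ 𝒰 = Set.univ →
      ∃ (Col : Type) (_ : Fintype Col) (φ : Col → D → ℝ) (a : ℝ),
        (∀ p, ∃ v, a ≤ φ v p) ∧ (∀ p, {v | φ v p ≠ 0}.ncard ≤ n + 1) ∧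
        (∀ v, Disjoint (closure (ev '' {p | a ≤ φ v p})) (closure (ev '' {p | φ v p = 0}))) ∧
        ∀ v, (closure (ev '' {p | φ v p ≠ 0})).Nonempty →
          ∃ U ∈ 𝒰, closure (ev '' {p | φ v p ≠ 0}) ⊆ U) : CovDimLE X n := by
  intro 𝒰 h𝒰 hcov
  obtain ⟨Col, _, φ, a, ha, hn, hd, hU⟩ := H 𝒰 h𝒰 hcov
  set V : Col → Set X := fun v => (closure (ev '' {p | φ v p = 0}))ᶜ with hV
  have hVo : ∀ v, IsOpen (V v) := fun v => isClosed_closure.isOpen_compl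
  have hVs : ∀ v, V v ⊆ closure (ev '' {p | φ v p ≠ 0}) := by
    intro v x hx
    have h1 : x ∈ closure (ev '' {p | φ v p = 0} ∪ ev '' {p | φ v p ≠ 0}) := by
      rw [← image_union, show {p | φ v p = 0} ∪ {p | φ v p ≠ 0} = univ from union_compl_self _,
        image_univ]
      exact hev x
    rw [closure_union] at h1
    exact h1.resolve_left hx
  refine ⟨{W | W.Nonempty ∧ ∃ v, W = V v}, ?_, ?_, ?_, ?_⟩
  · rintro _ ⟨-, v, rfl⟩
    exact hVo v
  · refine eq_univ_of_forall fun x => ?_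
    have h1 : x ∈ closure (⋃ v, ev '' {p | a ≤ φ v p}) := by
      refine closure_mono ?_ (hev x)
      rintro _ ⟨p, rfl⟩
      obtain ⟨v, hv⟩ := ha p
      exact mem_iUnion.2 ⟨v, p, hv, rfl⟩
    rw [closure_iUnion_of_finite] at h1
    obtain ⟨v, hv⟩ := mem_iUnion.1 h1
    have h2 : x ∈ V v := fun h => disjoint_left.1 (hd v) hv h
    exact ⟨V v, ⟨⟨x, h2⟩, v, rfl⟩, h2⟩
  · rintro _ ⟨hne, v, rfl⟩
    obtain ⟨U, hU1, hU2⟩ := hU v (hne.mono (hVs v))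
    exact ⟨U, hU1, (hVs v).trans hU2⟩
  · intro x
    have hsub : {W ∈ {W | W.Nonempty ∧ ∃ v, W = V v} | x ∈ W} ⊆ V '' {v | x ∈ V v} := by
      rintro _ ⟨⟨-, v, rfl⟩, hx⟩
      exact ⟨v, hx, rfl⟩
    refine ⟨(toFinite _).subset hsub, (ncard_le_ncard hsub (toFinite _)).trans
      ((ncard_image_le (toFinite _)).trans ?_)⟩
    have hO : IsOpen (⋂ v ∈ {v | x ∈ V v}, V v) :=
      (toFinite _).isOpen_biInter fun v _ => hVo v
    obtain ⟨p, hp⟩ := hev.exists_mem_open hO ⟨x, mem_iInter₂.2 fun v hv => hv⟩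
    refine (ncard_le_ncard (fun v hv => ?_) (toFinite _)).trans (hn p)
    intro h0
    exact mem_iInter₂.1 hp v hv (subset_closure ⟨p, h0, rfl⟩)

lemma exists_finset_lebesgue {𝒰 : Set (Set MaxIdealSpaceDiskNat)} (ho : ∀ U ∈ 𝒰, IsOpen U)
    (hc : ⋃₀ 𝒰 = univ) : ∃ (S : Finset HinfDiskNat) (ε : ℝ), 0 < ε ∧
      ∀ x : MaxIdealSpaceDiskNat, ∃ U ∈ 𝒰, ∀ y : MaxIdealSpaceDiskNat, (∀ f ∈ S, ‖y f - x f‖ < ε) → y ∈ U := by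
  classical
  have h1 : ∀ x : MaxIdealSpaceDiskNat, ∃ U ∈ 𝒰, x ∈ U := fun x => by
    have := hc.symm ▸ mem_univ x
    exact this
  choose U hU hxU using h1
  choose S ε hε hS using fun x => exists_finset_of_mem_nhds ((ho _ (hU x)).mem_nhds (hxU x))
  obtain ⟨t, ht⟩ := isCompact_univ.elim_nhds_subcover
    (fun x => {y : MaxIdealSpaceDiskNat | ∀ f ∈ S x, ‖y f - x f‖ < ε x / 2}) fun x _ => by
      refine IsOpen.mem_nhds ?_ fun f _ => by simpa using hε x
      have : {y : MaxIdealSpaceDiskNat | ∀ f ∈ S x, ‖y f - x f‖ < ε x / 2}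
        = ⋂ f ∈ S x, {y | ‖y f - x f‖ < ε x / 2} := by ext; simp
      rw [this]
      exact isOpen_biInter_finset fun f _ =>
        isOpen_lt ((continuous_apply_hinf f).sub continuous_const).norm continuous_const
  obtain ⟨δ, hδ, hδε⟩ : ∃ δ > 0, ∀ x ∈ t, δ ≤ ε x / 2 := by
    rcases t.eq_empty_or_nonempty with h | h
    · exact ⟨1, one_pos, by simp [h]⟩
    · exact ⟨t.inf' h fun x => ε x / 2, (Finset.lt_inf'_iff h).2 fun x _ => half_pos (hε x),
        fun x hx => Finset.inf'_le _ hx⟩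
  refine ⟨t.biUnion S, δ, hδ, fun x => ?_⟩
  obtain ⟨x₀, hx₀, hx⟩ := mem_iUnion₂.1 (ht.2 (mem_univ x))
  refine ⟨U x₀, hU x₀, fun y hy => hS x₀ y fun f hf => ?_⟩
  have h2 := hy f (Finset.mem_biUnion.2 ⟨x₀, hx₀, hf⟩)
  have h3 := hx f hf
  calc ‖y f - x₀ f‖ = ‖(y f - x f) + (x f - x₀ f)‖ := by congr 1; ring
    _ ≤ ‖y f - x f‖ + ‖x f - x₀ f‖ := norm_add_le _ _
    _ < ε x₀ := by linarith [hδε x₀ hx₀]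

lemma exists_unit_lebesgue {𝒰 : Set (Set MaxIdealSpaceDiskNat)} (ho : ∀ U ∈ 𝒰, IsOpen U)
    (hc : ⋃₀ 𝒰 = univ) : ∃ (ι : Type) (_ : Fintype ι) (f : ι → HinfDiskNat) (ε : ℝ), 0 < ε ∧
      (∀ i, ‖f i‖ ≤ 1) ∧
      ∀ x : MaxIdealSpaceDiskNat, ∃ U ∈ 𝒰, ∀ y : MaxIdealSpaceDiskNat, (∀ i, ‖y (f i) - x (f i)‖ < ε) → y ∈ U := by
  obtain ⟨S, ε, hε, H⟩ := exists_finset_lebesgue ho hc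
  set R : ℝ := 1 + ∑ f ∈ S, ‖f‖ with hR
  have hR0 : 0 < R := by positivity
  refine ⟨S, inferInstance, fun f => (R⁻¹ : ℂ) • f.1, R⁻¹ * ε, by positivity, fun f => ?_,
    fun x => ?_⟩
  · rw [norm_smul, norm_inv, Complex.norm_of_nonneg hR0.le, inv_mul_le_one₀ hR0]
    have := Finset.single_le_sum (f := fun f : HinfDiskNat => ‖f‖) (fun i _ => norm_nonneg _) f.2
    linarith
  · obtain ⟨U, hU, h⟩ := H x
    refine ⟨U, hU, fun y hy => h y fun f hf => ?_⟩
    have h1 := hy ⟨f, hf⟩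
    dsimp only at h1
    rw [map_smul, map_smul, ← smul_sub, norm_smul, norm_inv, Complex.norm_of_nonneg hR0.le] at h1
    exact lt_of_mul_lt_mul_left h1 (by positivity)

lemma covDimLE_maxIdealSpace : CovDimLE MaxIdealSpaceDiskNat 2 := by
  classical
  refine covDimLE_of_partition denseRange_evChar 2 fun 𝒰 ho hc => ?_
  obtain ⟨ι, _, f, ε₀, hε₀, hf1, hleb⟩ := exists_unit_lebesgue ho hc
  set ε : ℝ := min 1 (ε₀ / 5) with hεdef
  have hε : 0 < ε := by positivity
  have hε5 : 5 * ε ≤ ε₀ := by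
    have := min_le_right 1 (ε₀ / 5)
    linarith
  obtain ⟨P, hP, hPε⟩ := exists_goodP (16 / ε)
  obtain ⟨Gr, M, hM, hcol⟩ := exists_coloring_pi ι hP hε (min_le_left _ _) hPε
  choose g hg hgb hgf using fun i n => exists_uhp_of_hinf (f i) n
  choose c hc1 hc2 using fun n => hcol (fun i => g i n) (fun i => hg i n)
    fun i z hz => (hgb i n z hz).trans (hf1 i)
  set a : ℝ := ((Fintype.card (ι → Gr) : ℝ) + 1)⁻¹ with ha
  have ha0 : 0 < a := by positivity
  obtain ⟨net, κ, C, hκ, F, hF, hsep⟩ := exists_separation (Col := ι → Gr) hP M ha0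
  choose H hH using fun v i => exists_hinf_uhp (fun n => F (c n) v i) C
    (fun n => (hF (c n) v i (hc2 n)).1) (fun n => (hF (c n) v i (hc2 n)).2)
  refine ⟨ι → Gr, inferInstance, fun v p => ph P (c p.2) v (cayInv p.1), a, fun p => ?_,
    fun p => (ncard_ph_ne_zero hP _ _).2, fun v => ?_, fun v hne => ?_⟩
  · by_contra! hlt
    have h1 := sum_ph (P := P) (c p.2) (cayInv p.1)
    have h2 : ∑ v, ph P (c p.2) v (cayInv p.1) ≤ ∑ _v : ι → Gr, a :=
      Finset.sum_le_sum fun v _ => (hlt v).le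
    rw [h1, Finset.sum_const, Finset.card_univ, nsmul_eq_mul, ha, ← div_eq_mul_inv,
      le_div_iff₀ (by positivity)] at h2
    linarith
  · rw [Set.disjoint_left]
    intro x hx hx'
    set O : Set MaxIdealSpaceDiskNat := {y | ∀ i, ‖y (H v i) - x (H v i)‖ < κ / 2} with hO
    have hOo : IsOpen O := by
      rw [hO, ofPred_forall]
      exact isOpen_iInter_of_finite fun i =>
        isOpen_lt ((continuous_apply_hinf _).sub continuous_const).norm continuous_const
    have hxO : x ∈ O := fun i => by simpa using hκ
    obtain ⟨_, hp, p, hpa, rfl⟩ := mem_closure_iff.1 hx O hOo hxO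
    obtain ⟨_, hq, q, hq0, rfl⟩ := mem_closure_iff.1 hx' O hOo hxO
    obtain ⟨i, hi⟩ := hsep (c p.2) (c q.2) v (hc2 _) (hc2 _) _ (cayInv_mem p.1.2) _
      (cayInv_mem q.1.2) hpa hq0
    have h1 := hp i
    have h2 := hq i
    rw [evChar_apply, hH] at h1 h2
    have h3 := norm_sub_le_norm_sub_add_norm_sub (F (c p.2) v i (cayInv p.1)) (x (H v i))
      (F (c q.2) v i (cayInv q.1))
    rw [norm_sub_rev (x (H v i))] at h3
    linarith
  · obtain ⟨x, hx⟩ := hne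
    obtain ⟨U, hU, hUx⟩ := hleb x
    refine ⟨U, hU, fun y hy => hUx y fun i => ?_⟩
    have key : ∀ y ∈ closure (evChar '' {p | ph P (c p.2) v (cayInv p.1) ≠ 0}),
        ‖y (f i) - v i‖ ≤ 2 * ε := by
      refine closure_minimal (t := {y : MaxIdealSpaceDiskNat | ‖y (f i) - v i‖ ≤ 2 * ε}) ?_ (isClosed_le
        ((continuous_apply_hinf (f i)).sub continuous_const).norm continuous_const)
      rintro _ ⟨p, hp, rfl⟩
      obtain ⟨τ, hτ, hχ⟩ := exists_chi_ne_zero_of_ph hp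
      have := hc1 p.2 τ _ (cayInv_mem p.1.2) hχ i
      rw [hτ] at this
      rw [mem_ofPred_eq, evChar_apply, show p = (p.1, p.2) from rfl, hgf]
      exact this
    have h1 := key x hx
    have h2 := key y hy
    have h3 := norm_sub_le_norm_sub_add_norm_sub (y (f i)) (v i) (x (f i))
    rw [norm_sub_rev (v i : ℂ)] at h3
    linarith

/-- A continuous map close to the identity on a disk covers a smaller concentric disk. -/
lemma ball_subset_image_of_near_id {g : ℂ → ℂ} (hg : Continuous g)
    (hgz : ∀ z ∈ closedBall (0 : ℂ) (1 / 2), ‖g z - z‖ ≤ 1 / 10) :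
    ball (0 : ℂ) (1 / 4) ⊆ g '' closedBall 0 (1 / 2) := by
  intro w hw
  by_contra hcon
  rw [mem_ball_zero_iff] at hw
  set ρ : ℂ → ℂ := fun z => ((max 1 (2 * ‖z‖))⁻¹ : ℝ) * z with hρ
  have hpos : ∀ z : ℂ, 0 < max 1 (2 * ‖z‖) := fun z => lt_max_of_lt_left one_pos
  have hρc : Continuous ρ := by
    have : Continuous fun z : ℂ => (max 1 (2 * ‖z‖))⁻¹ :=
      (continuous_const.max (by fun_prop)).inv₀ fun z => (hpos z).ne'
    fun_prop
  have hρm : ∀ z, ρ z ∈ closedBall (0 : ℂ) (1 / 2) := by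
    intro z
    rw [mem_closedBall_zero_iff, hρ, norm_mul, Complex.norm_of_nonneg (inv_nonneg.2 (hpos z).le),
      inv_mul_le_iff₀ (hpos z)]
    have := le_max_right 1 (2 * ‖z‖)
    linarith
  have hρe : ∀ z : ℂ, ‖z‖ = 1 / 2 → ρ z = z := by
    intro z hz
    simp [hρ, hz]
  obtain ⟨L, hL, hLe⟩ := exists_continuousOn_eqOn_exp_comp (U := (univ : Set ℂ))
    (g := fun z => g (ρ z) - w) (by
      have := (convex_univ (𝕜 := ℝ) (E := ℂ)).contractibleSpace univ_nonempty
      exact SimplyConnectedSpace.ofContractible _) isOpen_univ (by fun_prop) (by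
      rintro ⟨z, -, hz⟩
      exact hcon ⟨ρ z, hρm z, sub_eq_zero.1 hz⟩)
  rw [continuousOn_univ] at hL
  set c : ℝ → ℂ := fun θ => (1 / 2 : ℂ) * exp (θ * I) with hc
  have hcc : Continuous c := by fun_prop
  have hcn : ∀ θ, ‖c θ‖ = 1 / 2 := fun θ => by
    rw [hc, norm_mul, norm_exp_ofReal_mul_I]
    norm_num
  have hc0 : ∀ θ, c θ ≠ 0 := fun θ h => by
    have := hcn θ
    rw [h, norm_zero] at this
    norm_num at this
  set q : ℝ → ℂ := fun θ => (g (c θ) - w) / c θ with hq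
  have hqs : ∀ θ, q θ ∈ slitPlane := by
    intro θ
    have h1 : ‖q θ - 1‖ < 1 := by
      have : q θ - 1 = ((g (c θ) - c θ) - w) / c θ := by
        rw [hq]
        field_simp [hc0 θ]
        ring
      rw [this, norm_div, div_lt_one (norm_pos_iff.2 (hc0 θ)), hcn]
      have h2 := hgz (c θ) (by rw [mem_closedBall_zero_iff, hcn])
      have h3 := norm_sub_le (g (c θ) - c θ) w
      linarith
    left
    have h2 := (abs_re_le_norm (q θ - 1)).trans_lt h1
    rw [sub_re, one_re, abs_lt] at h2
    linarith
  have hqc : Continuous q := ((hg.comp hcc).sub continuous_const).div hcc hc0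
  set m : ℝ → ℝ := fun θ => ((L (c θ)).im - (log (q θ)).im - θ) / (2 * Real.pi) with hm
  have hmc : Continuous m := by
    have h1 : Continuous fun θ => log (q θ) := hqc.clog hqs
    exact (((continuous_im.comp (hL.comp hcc)).sub (continuous_im.comp h1)).sub
      continuous_id).div_const _
  have hmz : ∀ θ, ∃ k : ℤ, m θ = k := by
    intro θ
    have h1 : exp (L (c θ)) = g (c θ) - w := by
      have := hLe (mem_univ (c θ))
      simpa [hρe _ (hcn θ)] using this
    have h2 : exp (log (q θ)) = q θ := exp_log (slitPlane_ne_zero (hqs θ))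
    have h3 : q θ ≠ 0 := slitPlane_ne_zero (hqs θ)
    have h4 : exp (L (c θ)) = exp (log (q θ) + Real.log (1 / 2) + θ * I) := by
      rw [exp_add, exp_add, h1, h2, ← ofReal_exp, Real.exp_log (by norm_num), mul_assoc,
        show (((1 / 2 : ℝ) : ℂ) * exp (θ * I)) = c θ by rw [hc]; push_cast; ring, hq]
      field_simp [hc0 θ]
    obtain ⟨k, hk⟩ := exp_eq_exp_iff_exists_int.1 h4
    refine ⟨k, ?_⟩
    have h5 := congrArg Complex.im hk
    have h6 : (L (c θ)).im = (log (q θ)).im + θ + k * (2 * Real.pi) := by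
      rw [h5, add_im, add_im, add_im, ofReal_im]
      simp
    rw [hm]
    dsimp only
    rw [h6]
    field_simp [Real.pi_pos.ne']
    ring
  have hper : m (2 * Real.pi) = m 0 - 1 := by
    have h1 : c (2 * Real.pi) = c 0 := by
      rw [hc]
      simp [exp_two_pi_mul_I]
    rw [hm]
    dsimp only
    rw [hq]
    dsimp only
    rw [h1]
    field_simp [Real.pi_pos.ne']
    ring
  obtain ⟨θ, hθ⟩ := mem_range_of_exists_le_of_exists_ge hmc (c := m 0 - 1 / 2)
    ⟨2 * Real.pi, by rw [hper]; linarith⟩ ⟨0, by linarith⟩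
  obtain ⟨k, hk⟩ := hmz θ
  obtain ⟨l, hl⟩ := hmz 0
  rw [hk, hl] at hθ
  have : (2 * k : ℤ) = 2 * l - 1 := by
    have : (2 * k : ℝ) = 2 * l - 1 := by linarith
    exact_mod_cast this
  omega

lemma not_ball_subset_iUnion_segment {ι : Type} [Finite ι] (p : ι → ℂ) {r : ℝ} (hr : 0 < r) :
    ¬ ball (0 : ℂ) r ⊆ ⋃ i, ⋃ j, segment ℝ (p i) (p j) := by
  intro h
  have h0 : ∀ x y : ℂ, MeasureTheory.volume (segment ℝ x y) = 0 := by
    intro x y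
    refine MeasureTheory.measure_mono_null (t := (affineSpan ℝ {x, y} : Set ℂ)) ?_
      (MeasureTheory.Measure.addHaar_affineSubspace _ _ fun htop => ?_)
    · rw [← convexHull_pair]
      exact convexHull_subset_affineSpan _
    · have h1 := (collinear_iff_finrank_le_one (k := ℝ) (s := ({x, y} : Set ℂ))).1
        (collinear_pair ℝ x y)
      rw [← direction_affineSpan, htop, AffineSubspace.direction_top, finrank_top,
        Complex.finrank_real_complex] at h1
      omega
  have h1 : MeasureTheory.volume (ball (0 : ℂ) r) = 0 :=
    MeasureTheory.measure_mono_null h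
      (MeasureTheory.measure_iUnion_null fun i => MeasureTheory.measure_iUnion_null fun j => h0 _ _)
  exact (isOpen_ball.measure_pos _ ⟨0, mem_ball_self hr⟩).ne' h1

lemma sum_smul_mem_segment {ι : Type} [Fintype ι] (a : ι → ℝ) (p : ι → ℂ) (ha : ∀ i, 0 ≤ a i)
    (hs : ∑ i, a i = 1) (hc : {i | a i ≠ 0}.ncard ≤ 2) :
    ∃ i j, ∑ k, a k • p k ∈ segment ℝ (p i) (p j) := by
  classical
  have hne : ∃ i, a i ≠ 0 := by
    by_contra! h
    simp [h] at hs
  obtain ⟨i, hi⟩ := hne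
  obtain ⟨j, hj⟩ : ∃ j, ∀ k, a k ≠ 0 → k = i ∨ k = j := by
    by_cases h : ∃ j, a j ≠ 0 ∧ j ≠ i
    · obtain ⟨j, hj, hji⟩ := h
      refine ⟨j, fun k hk => ?_⟩
      by_contra! hk2
      have h3 : ({i, j, k} : Set ι) ⊆ {i | a i ≠ 0} := by
        rintro x (rfl | rfl | rfl) <;> assumption
      have h4 := ncard_le_ncard h3 (toFinite _)
      rw [ncard_eq_three.2 ⟨i, j, k, hji.symm, hk2.1.symm, hk2.2.symm, rfl⟩] at h4
      omega
    · push Not at h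
      exact ⟨i, fun k hk => Or.inl (h k hk)⟩
  refine ⟨i, j, ?_⟩
  rw [← finsum_eq_sum_of_fintype] at hs ⊢
  refine (convex_segment (p i) (p j)).finsum_mem ha hs fun k hk => ?_
  rcases hj k hk with rfl | rfl
  · exact left_mem_segment _ _ _
  · exact right_mem_segment _ _ _

lemma not_covDimLE_one : ¬ CovDimLE MaxIdealSpaceDiskNat 1 := by
  intro hdim
  obtain ⟨Z, hZ⟩ := exists_hinf (fun _ z => z) 1 (fun _ => differentiableOn_id)
    fun _ z hz => (mem_ball_zero_iff.1 hz).le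
  have hZc : Continuous fun x : MaxIdealSpaceDiskNat => x Z := continuous_apply_hinf Z
  obtain ⟨𝒱, h𝒱o, h𝒱c, h𝒱r, h𝒱n⟩ := hdim
    (range fun p : ℂ => {x : MaxIdealSpaceDiskNat | x Z ∈ ball p (1 / 10)})
    (by rintro _ ⟨p, rfl⟩; exact isOpen_ball.preimage hZc)
    (eq_univ_of_forall fun x => ⟨_, ⟨x Z, rfl⟩, mem_ball_self (by norm_num)⟩)
  have hcent : ∀ V : 𝒱, ∃ p : ℂ, ∀ x ∈ V.1, x Z ∈ ball p (1 / 10) := by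
    rintro ⟨V, hV⟩
    obtain ⟨_, ⟨p, rfl⟩, hp⟩ := h𝒱r V hV
    exact ⟨p, fun x hx => hp hx⟩
  choose p hp using hcent
  have hev : Continuous fun z : unitDisk => evChar (z, 0) := by
    rw [isInducing_coe.continuous_iff, continuous_pi_iff]
    intro f
    exact f.1.continuous.comp (by fun_prop : Continuous fun z : unitDisk => (z, 0))
  set U : 𝒱 → Set ℂ := fun V => Subtype.val '' {z : unitDisk | evChar (z, 0) ∈ V.1} with hU
  have hUo : ∀ V, IsOpen (U V) := fun V =>
    (isOpen_ball.isOpenEmbedding_subtypeVal).isOpenMap _ ((h𝒱o _ V.2).preimage hev)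
  have hsub : closedBall (0 : ℂ) (1 / 2) ⊆ unitDisk := closedBall_subset_ball (by norm_num)
  have hUc : closedBall (0 : ℂ) (1 / 2) ⊆ ⋃ V, U V := by
    intro z hz
    have h1 : evChar (⟨z, hsub hz⟩, 0) ∈ ⋃₀ 𝒱 := h𝒱c ▸ mem_univ _
    obtain ⟨V, hV, h2⟩ := h1
    exact mem_iUnion.2 ⟨⟨V, hV⟩, ⟨z, hsub hz⟩, h2, rfl⟩
  obtain ⟨t, ht⟩ := (isCompact_closedBall (0 : ℂ) (1 / 2)).elim_finite_subcover U hUo hUc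
  obtain ⟨χ, hχ⟩ := PartitionOfUnity.exists_isSubordinate (isClosed_closedBall (x := (0 : ℂ))
    (ε := 1 / 2)) (fun V : t => U V.1) (fun V => hUo V.1) (by
      intro z hz
      obtain ⟨V, hV, h⟩ := mem_iUnion₂.1 (ht hz)
      exact mem_iUnion.2 ⟨⟨V, hV⟩, h⟩)
  have hmem : ∀ (V : t) (z : ℂ) (hz : z ∈ closedBall (0 : ℂ) (1 / 2)), χ V z ≠ 0 →
      evChar (⟨z, hsub hz⟩, 0) ∈ V.1.1 := by
    intro V z hz h
    obtain ⟨y, hy, rfl⟩ := hχ V (subset_tsupport _ h)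
    exact hy
  have hsum : ∀ z ∈ closedBall (0 : ℂ) (1 / 2), ∑ V, χ V z = 1 := fun z hz => by
    rw [← finsum_eq_sum_of_fintype]
    exact χ.sum_eq_one hz
  set g : ℂ → ℂ := fun z => ∑ V : t, χ V z • p V.1 with hg
  have hgc : Continuous g := by
    refine continuous_finsetSum _ fun V _ => ?_
    exact (χ V).continuous.smul continuous_const
  refine not_ball_subset_iUnion_segment (fun V : t => p V.1) (by norm_num : (0 : ℝ) < 1 / 4)
    ((ball_subset_image_of_near_id hgc fun z hz => ?_).trans ?_)
  · have h1 : g z - z = ∑ V : t, χ V z • (p V.1 - z) := by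
      simp only [smul_sub, Finset.sum_sub_distrib]
      rw [← Finset.sum_smul, hsum z hz, one_smul]
    rw [h1]
    calc ‖∑ V : t, χ V z • (p V.1 - z)‖ ≤ ∑ V : t, χ V z * (1 / 10) := by
          refine norm_sum_le_of_le _ fun V _ => ?_
          rw [norm_smul, Real.norm_of_nonneg (χ.nonneg V z)]
          by_cases h : χ V z = 0
          · simp [h]
          · have h2 := hp V.1 _ (hmem V z hz h)
            rw [evChar_apply, hZ] at h2
            refine mul_le_mul_of_nonneg_left ?_ (χ.nonneg V z)
            rw [norm_sub_rev]
            exact (mem_ball_iff_norm.1 h2).le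
      _ = 1 / 10 := by rw [← Finset.sum_mul, hsum z hz, one_mul]
  · rintro _ ⟨z, hz, rfl⟩
    have hcard : {V : t | χ V z ≠ 0}.ncard ≤ 2 := by
      obtain ⟨hf, hn⟩ := h𝒱n (evChar (⟨z, hsub hz⟩, 0))
      refine le_trans ?_ hn
      rw [← ncard_image_of_injective {V : t | χ V z ≠ 0}
        (Subtype.val_injective.comp Subtype.val_injective)]
      refine ncard_le_ncard ?_ hf
      rintro _ ⟨V, hV, rfl⟩
      exact ⟨V.1.2, hmem V z hz hV⟩
    obtain ⟨i, j, hij⟩ := sum_smul_mem_segment (fun V => χ V z) (fun V : t => p V.1)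
      (fun V => χ.nonneg V z) (hsum z hz) hcard
    exact mem_iUnion₂.2 ⟨i, j, hij⟩

/-- The covering dimension of `𝔐(H^∞(𝔻 × ℕ))` equals `2`. -/
theorem covDim_maxIdealSpace_diskNat : CovDimEq MaxIdealSpaceDiskNat 2 := by
  exact ⟨covDimLE_maxIdealSpace, not_covDimLE_one⟩

end
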